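/- Every capture component (parabubble) P of generation n ≥ 2 of the family R_a is an open, simply connected subset of ℂ, and P contains exactly one parameter a₀ (its center) satisfying R_{a₀}^n(−1) = ∞. -/

import Mathlib

open Filter Topology OnePoint

/-- The Riemann sphere as the one-point compactification of `ℂ`. -/
notation "RSphere" => OnePoint ℂ

/-- The quadratic rational map `R_a(z) = a/(z² + 2z)` on the Riemann sphere, with
`R_a(0) = R_a(−2) = ∞` and `R_a(∞) = 0`. -/
noncomputable def Rhat (a : ℂ) : RSphere → RSphere := fun z =>
  match z with
  | ∞ => ((0 : ℂ) : RSphere)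
  | (w : ℂ) => if w ^ 2 + 2 * w = 0 then ∞ else ((a / (w ^ 2 + 2 * w) : ℂ) : RSphere)

/-- The basin of attraction of the superattracting 2-cycle `∞ ↦ 0 ↦ ∞` of `R_a`. -/
def sphereBasin (a : ℂ) : Set RSphere :=
  {z | Tendsto (fun n => (Rhat a)^[2 * n] z) atTop (𝓝 ∞) ∨
       Tendsto (fun n => (Rhat a)^[2 * n] z) atTop (𝓝 ((0 : ℂ) : RSphere))}

/-- `A_∞(a)`: the connected component of the basin containing `∞`. -/
noncomputable def Ainf (a : ℂ) : Set RSphere := connectedComponentIn (sphereBasin a) ∞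

/-- `A_0(a)`: the connected component of the basin containing `0`. -/
noncomputable def Azero (a : ℂ) : Set RSphere :=
  connectedComponentIn (sphereBasin a) ((0 : ℂ) : RSphere)

/-- `P_∞`: the parameters for which the critical value `−a` lies in `A_∞(a)`. -/
def Pinf : Set ℂ := {a | a ≠ 0 ∧ (((-a : ℂ) : RSphere) ∈ Ainf a)}

/-- The set of parameters whose critical orbit first enters `A_∞(a)` at time exactly `n`. -/
def captureSet (n : ℕ) : Set ℂ :=
  {a | a ≠ 0 ∧ (Rhat a)^[n] ((-1 : ℂ) : RSphere) ∈ Ainf a ∧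
       ∀ k < n, (Rhat a)^[k] ((-1 : ℂ) : RSphere) ∉ Ainf a}

/-- A capture component (parabubble) of generation `n` is a connected component of
`captureSet n`. -/
def IsParabubble (n : ℕ) (P : Set ℂ) : Prop :=
  ∃ a ∈ captureSet n, P = connectedComponentIn (captureSet n) a

section
open Filter Topology OnePoint

/-- chart at infinity -/
noncomputable def toS (p : ℂ) : RSphere := if p = 0 then ∞ else ((p⁻¹ : ℂ) : RSphere)

theorem toS_zero : toS 0 = ∞ := by simp [toS]
theorem toS_ne {p : ℂ} (h : p ≠ 0) : toS p = ((p⁻¹ : ℂ) : RSphere) := by simp [toS, h]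
theorem toS_inv {z : ℂ} (h : z ≠ 0) : toS z⁻¹ = (z : RSphere) := by simp [toS, h]

/-- inversion of the sphere -/
noncomputable def invS : RSphere → RSphere := fun z =>
  match z with
  | ∞ => ((0 : ℂ) : RSphere)
  | (w : ℂ) => toS w

theorem invS_infty : invS ∞ = ((0 : ℂ) : RSphere) := rfl
theorem invS_coe (w : ℂ) : invS (w : RSphere) = toS w := rfl

theorem invS_invS (z : RSphere) : invS (invS z) = z := by
  induction z using OnePoint.rec with
  | infty => rw [invS_infty, invS_coe, toS_zero]
  | coe w =>
    rw [invS_coe]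
    by_cases h : w = 0
    · subst h; rw [toS_zero, invS_infty]
    · rw [toS_ne h, invS_coe, toS_inv h]

theorem continuous_toS : Continuous toS := by
  rw [continuous_iff_continuousAt]
  intro p
  by_cases h : p = 0
  · subst h
    have h1 : Tendsto toS (𝓝[≠] 0) (𝓝 ∞) := by
      have h2 : Tendsto (fun p : ℂ => ((p⁻¹ : ℂ) : RSphere)) (𝓝[≠] 0) (𝓝 ∞) := by
        have h3 : Tendsto (fun p : ℂ => (p⁻¹ : ℂ)) (𝓝[≠] 0) (coclosedCompact ℂ) := by
          rw [coclosedCompact_eq_cocompact, ← Metric.cobounded_eq_cocompact]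
          exact tendsto_inv₀_nhdsNE_zero
        exact OnePoint.tendsto_coe_infty.comp h3
      refine h2.congr' ?_
      filter_upwards [self_mem_nhdsWithin] with p hp
      rw [toS_ne hp]
    have : ContinuousAt toS 0 := by
      rw [continuousAt_iff_punctured_nhds, toS_zero]; exact h1
    exact this
  · have : toS =ᶠ[𝓝 p] fun p => ((p⁻¹ : ℂ) : RSphere) := by
      filter_upwards [isOpen_ne.mem_nhds h] with q hq
      exact toS_ne hq
    refine ContinuousAt.congr ?_ this.symm
    exact OnePoint.continuous_coe.continuousAt.comp (continuousAt_inv₀ h)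

theorem continuous_invS : Continuous invS := by
  have h0 : ∀ w : ℂ, ContinuousAt invS (w : RSphere) := by
    intro w
    rw [OnePoint.continuousAt_coe]
    exact continuous_toS.continuousAt
  rw [continuous_iff_continuousAt]
  intro z
  induction z using OnePoint.rec with
  | coe w => exact h0 w
  | infty =>
    rw [OnePoint.continuousAt_infty']
    rw [invS_infty, coclosedCompact_eq_cocompact, ← Metric.cobounded_eq_cocompact]
    have h1 : Tendsto (fun w : ℂ => ((w⁻¹ : ℂ) : RSphere)) (Bornology.cobounded ℂ)
        (𝓝 ((0 : ℂ) : RSphere)) :=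
      (OnePoint.continuous_coe.tendsto 0).comp tendsto_inv₀_cobounded
    refine h1.congr' ?_
    filter_upwards [Bornology.eventually_ne_cobounded (0 : ℂ)] with w hw
    rw [Function.comp_apply, invS_coe, toS_ne hw]

noncomputable def invSHomeo : RSphere ≃ₜ RSphere where
  toFun := invS
  invFun := invS
  left_inv := invS_invS
  right_inv := invS_invS
  continuous_toFun := continuous_invS
  continuous_invFun := continuous_invS

theorem isOpenEmbedding_toS : IsOpenEmbedding toS :=
  invSHomeo.isOpenEmbedding.comp OnePoint.isOpenEmbedding_coe

theorem isOpenEmbedding_coeS : IsOpenEmbedding (fun z : ℂ => (z : RSphere)) :=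
  OnePoint.isOpenEmbedding_coe

theorem toS_inj {p q : ℂ} (h : toS p = toS q) : p = q := isOpenEmbedding_toS.injective h

theorem sphere_cases (z : RSphere) : (∃ w : ℂ, z = (w : RSphere)) ∨ (∃ p : ℂ, z = toS p) := by
  induction z using OnePoint.rec with
  | infty => exact Or.inr ⟨0, toS_zero.symm⟩
  | coe w => exact Or.inl ⟨w, rfl⟩

theorem toS_eq_coe {p z : ℂ} : toS p = (z : RSphere) ↔ p ≠ 0 ∧ p * z = 1 := by
  by_cases h : p = 0
  · subst h; rw [toS_zero]; simp
  · rw [toS_ne h]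
    simp only [OnePoint.coe_eq_coe, ne_eq, h, not_false_eq_true, true_and]
    constructor
    · rintro rfl; field_simp
    · intro h2; field_simp; rw [h2]

theorem exists_conn_nhd (z : RSphere) (U : Set RSphere) (hU : U ∈ 𝓝 z) :
    ∃ O : Set RSphere, IsOpen O ∧ IsPreconnected O ∧ z ∈ O ∧ O ⊆ U := by
  have key : ∀ f : ℂ → RSphere, IsOpenEmbedding f → ∀ w, z = f w →
      ∃ O : Set RSphere, IsOpen O ∧ IsPreconnected O ∧ z ∈ O ∧ O ⊆ U := by
    intro f hf w hw
    have h1 : f ⁻¹' U ∈ 𝓝 w := hf.continuous.continuousAt.preimage_mem_nhds (hw ▸ hU)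
    obtain ⟨e, he, hb⟩ := Metric.mem_nhds_iff.1 h1
    refine ⟨f '' Metric.ball w e, hf.isOpenMap _ Metric.isOpen_ball,
      ((convex_ball w e).isPreconnected).image f hf.continuous.continuousOn,
      ⟨w, Metric.mem_ball_self he, hw.symm⟩, ?_⟩
    rintro _ ⟨x, hx, rfl⟩
    exact hb hx
  rcases sphere_cases z with ⟨w, hw⟩ | ⟨p, hp⟩
  · exact key _ isOpenEmbedding_coeS w hw
  · exact key _ isOpenEmbedding_toS p hp

theorem Rhat_infty (a : ℂ) : Rhat a ∞ = ((0 : ℂ) : RSphere) := rfl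

theorem Rhat_coe' (a w : ℂ) : Rhat a (w : RSphere) =
    if w ^ 2 + 2 * w = 0 then ∞ else ((a / (w ^ 2 + 2 * w) : ℂ) : RSphere) := rfl

theorem Rhat_coe_ne (a w : ℂ) (h : w ^ 2 + 2 * w ≠ 0) : Rhat a (w : RSphere) =
    ((a / (w ^ 2 + 2 * w) : ℂ) : RSphere) := by rw [Rhat_coe', if_neg h]

theorem Rhat_coe {a : ℂ} (ha : a ≠ 0) (w : ℂ) :
    Rhat a (w : RSphere) = toS ((w ^ 2 + 2 * w) / a) := by
  rw [Rhat_coe']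
  by_cases h : w ^ 2 + 2 * w = 0
  · simp [h, toS_zero]
  · rw [if_neg h, toS_ne (div_ne_zero h ha), inv_div]

theorem Rhat_toS {a p : ℂ} (hp : 1 + 2 * p ≠ 0) :
    Rhat a (toS p) = ((a * p ^ 2 / (1 + 2 * p) : ℂ) : RSphere) := by
  by_cases h : p = 0
  · subst h; rw [toS_zero, Rhat_infty]; simp
  · rw [toS_ne h, Rhat_coe_ne]
    · congr 1
      have : (p⁻¹) ^ 2 + 2 * p⁻¹ = (1 + 2 * p) / p ^ 2 := by field_simp
      rw [this]; field_simp
    · have : (p⁻¹) ^ 2 + 2 * p⁻¹ = (1 + 2 * p) / p ^ 2 := by field_simp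
      rw [this]; exact div_ne_zero hp (pow_ne_zero _ h)

theorem continuousAt_Rhat2 {a : ℂ} (ha : a ≠ 0) (z : RSphere) :
    ContinuousAt (fun x : ℂ × RSphere => Rhat x.1 x.2) (a, z) := by
  rcases sphere_cases z with ⟨w, hw⟩ | ⟨p, hp⟩
  · have hE : IsOpenEmbedding (Prod.map (id : ℂ → ℂ) (fun z : ℂ => (z : RSphere))) :=
      IsOpenEmbedding.id.prodMap isOpenEmbedding_coeS
    have := hE.continuousAt_iff (g := fun x : ℂ × RSphere => Rhat x.1 x.2) (x := (a, w))
    rw [show (a, z) = Prod.map (id : ℂ → ℂ) (fun z : ℂ => (z : RSphere)) (a, w) by simp [hw],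
      ← this]
    have h1 : ContinuousAt (fun x : ℂ × ℂ => toS ((x.2 ^ 2 + 2 * x.2) / x.1)) (a, w) := by
      apply continuous_toS.continuousAt.comp
      have : ContinuousAt (fun x : ℂ × ℂ => (x.2 ^ 2 + 2 * x.2)) (a, w) := by fun_prop
      exact this.div continuous_fst.continuousAt ha
    refine h1.congr ?_
    have : ∀ᶠ x : ℂ × ℂ in 𝓝 (a, w), x.1 ≠ 0 :=
      continuous_fst.continuousAt.eventually_ne ha
    filter_upwards [this] with x hx
    simp only [Function.comp, Prod.map, id]
    rw [Rhat_coe hx]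
  · by_cases hp0 : p = 0
    · subst hp0
      have hE : IsOpenEmbedding (Prod.map (id : ℂ → ℂ) toS) :=
        IsOpenEmbedding.id.prodMap isOpenEmbedding_toS
      have := hE.continuousAt_iff (g := fun x : ℂ × RSphere => Rhat x.1 x.2) (x := (a, 0))
      rw [show (a, z) = Prod.map (id : ℂ → ℂ) toS (a, 0) by simp [hp], ← this]
      have h1 : ContinuousAt (fun x : ℂ × ℂ =>
          ((x.1 * x.2 ^ 2 / (1 + 2 * x.2) : ℂ) : RSphere)) (a, 0) := by
        apply OnePoint.continuous_coe.continuousAt.comp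
        have h2 : ContinuousAt (fun x : ℂ × ℂ => x.1 * x.2 ^ 2) (a, 0) := by fun_prop
        have h3 : ContinuousAt (fun x : ℂ × ℂ => 1 + 2 * x.2) (a, 0) := by fun_prop
        exact h2.div h3 (by simp)
      refine h1.congr ?_
      have h3 : ContinuousAt (fun x : ℂ × ℂ => 1 + 2 * x.2) (a, 0) := by fun_prop
      filter_upwards [h3.eventually_ne (by simp : (1 + 2 * ((a, 0) : ℂ × ℂ).2) ≠ 0)] with x hx
      simp only [Function.comp, Prod.map, id]
      rw [Rhat_toS hx]
    · rw [toS_ne hp0] at hp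
      have hE : IsOpenEmbedding (Prod.map (id : ℂ → ℂ) (fun z : ℂ => (z : RSphere))) :=
        IsOpenEmbedding.id.prodMap isOpenEmbedding_coeS
      have := hE.continuousAt_iff (g := fun x : ℂ × RSphere => Rhat x.1 x.2) (x := (a, p⁻¹))
      rw [show (a, z) = Prod.map (id : ℂ → ℂ) (fun z : ℂ => (z : RSphere)) (a, p⁻¹) by
        simp [hp], ← this]
      have h1 : ContinuousAt (fun x : ℂ × ℂ => toS ((x.2 ^ 2 + 2 * x.2) / x.1)) (a, p⁻¹) := by
        apply continuous_toS.continuousAt.comp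
        have : ContinuousAt (fun x : ℂ × ℂ => (x.2 ^ 2 + 2 * x.2)) (a, p⁻¹) := by fun_prop
        exact this.div continuous_fst.continuousAt ha
      refine h1.congr ?_
      have : ∀ᶠ x : ℂ × ℂ in 𝓝 (a, p⁻¹), x.1 ≠ 0 :=
        continuous_fst.continuousAt.eventually_ne ha
      filter_upwards [this] with x hx
      simp only [Function.comp, Prod.map, id]
      rw [Rhat_coe hx]

theorem continuousAt_iter {a : ℂ} (ha : a ≠ 0) (z : RSphere) (l : ℕ) :
    ContinuousAt (fun x : ℂ × RSphere => (Rhat x.1)^[l] x.2) (a, z) := by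
  induction l with
  | zero => simpa using continuous_snd.continuousAt
  | succ l ih =>
    simp only [Function.iterate_succ_apply']
    have h1 : ContinuousAt (fun x : ℂ × RSphere => (x.1, (Rhat x.1)^[l] x.2)) (a, z) :=
      continuous_fst.continuousAt.prodMk ih
    exact (continuousAt_Rhat2 ha ((Rhat a)^[l] z)).comp_of_eq h1 rfl

theorem continuous_Rhat {a : ℂ} (ha : a ≠ 0) : Continuous (Rhat a) := by
  rw [continuous_iff_continuousAt]
  intro z
  have h1 : ContinuousAt (fun z : RSphere => (a, z)) z := by fun_prop
  exact (continuousAt_Rhat2 ha z).comp_of_eq h1 rfl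

theorem continuous_iter {a : ℂ} (ha : a ≠ 0) (l : ℕ) : Continuous ((Rhat a)^[l]) :=
  (continuous_Rhat ha).iterate l

theorem continuousAt_iter_param {a : ℂ} (ha : a ≠ 0) (z : RSphere) (l : ℕ) :
    ContinuousAt (fun b : ℂ => (Rhat b)^[l] z) a := by
  have h1 : ContinuousAt (fun b : ℂ => (b, z)) a := by fun_prop
  exact (continuousAt_iter ha z l).comp_of_eq h1 rfl

/-- second iterate in the chart at infinity -/
noncomputable def Tp (a p : ℂ) : ℂ := a * p ^ 4 / (1 + 2 * p) ^ 2 + 2 * p ^ 2 / (1 + 2 * p)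

theorem Rhat2_toS {a p : ℂ} (ha : a ≠ 0) (hp : 1 + 2 * p ≠ 0) :
    (Rhat a)^[2] (toS p) = toS (Tp a p) := by
  rw [Function.iterate_succ_apply', Function.iterate_one, Rhat_toS hp, Rhat_coe ha]
  congr 1
  unfold Tp
  field_simp

theorem one_add_two_norm {p : ℂ} (hp : ‖p‖ ≤ 1 / 10) : 8 / 10 ≤ ‖1 + 2 * p‖ := by
  have h1 : ‖(1 : ℂ)‖ ≤ ‖1 + 2 * p‖ + ‖2 * p‖ := by
    have := norm_sub_le (1 + 2 * p) (2 * p)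
    simpa using this
  rw [norm_mul] at h1
  simp at h1
  linarith

theorem one_add_two_ne {p : ℂ} (hp : ‖p‖ ≤ 1 / 10) : 1 + 2 * p ≠ 0 := by
  intro h
  have := one_add_two_norm hp
  rw [h] at this
  simp at this
  linarith

theorem Tp_bound {a p : ℂ} (hp : ‖p‖ ≤ 1 / 10) (hap : ‖a‖ * ‖p‖ ≤ 1) :
    ‖Tp a p‖ ≤ ‖p‖ / 2 := by
  have hd := one_add_two_norm hp
  have hd2 : (64 : ℝ) / 100 ≤ ‖1 + 2 * p‖ ^ 2 := by nlinarith
  have hx0 := norm_nonneg p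
  unfold Tp
  refine (norm_add_le _ _).trans ?_
  rw [norm_div, norm_div, norm_mul, norm_mul, norm_pow, norm_pow, norm_pow]
  have e1 : ‖a‖ * ‖p‖ ^ 4 / ‖1 + 2 * p‖ ^ 2 ≤ ‖p‖ * (2 / 100) := by
    rw [div_le_iff₀ (by linarith)]
    have : ‖a‖ * ‖p‖ ^ 4 ≤ ‖p‖ * (1 / 100) := by
      have h3 : ‖p‖ ^ 2 ≤ 1 / 100 := by nlinarith
      calc ‖a‖ * ‖p‖ ^ 4 = (‖a‖ * ‖p‖) * (‖p‖ * ‖p‖ ^ 2) := by ring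
        _ ≤ 1 * (‖p‖ * (1 / 100)) := by gcongr
        _ = _ := by ring
    nlinarith
  have e2 : ‖(2 : ℂ)‖ * ‖p‖ ^ 2 / ‖1 + 2 * p‖ ≤ ‖p‖ * (1 / 4) := by
    rw [div_le_iff₀ (by linarith)]
    simp
    nlinarith
  linarith

theorem iter_toS_small {a : ℂ} (ha : a ≠ 0) {p : ℂ} (hp : ‖p‖ ≤ 1 / 10) (hap : ‖a‖ * ‖p‖ ≤ 1)
    (n : ℕ) : ∃ q, (Rhat a)^[2 * n] (toS p) = toS q ∧ ‖q‖ ≤ ‖p‖ / 2 ^ n := by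
  induction n with
  | zero => exact ⟨p, by simp, by simp⟩
  | succ n ih =>
    obtain ⟨q, hq, hqn⟩ := ih
    have h1 : ‖q‖ ≤ ‖p‖ := hqn.trans (div_le_self (norm_nonneg _) (one_le_pow₀ (by norm_num)))
    have h2 : ‖q‖ ≤ 1 / 10 := h1.trans hp
    refine ⟨Tp a q, ?_, ?_⟩
    · rw [show 2 * (n + 1) = 2 + 2 * n by ring, Function.iterate_add_apply, hq,
        Rhat2_toS ha (one_add_two_ne h2)]
    · have h3 := Tp_bound h2 ((mul_le_mul_of_nonneg_left h1 (norm_nonneg a)).trans hap)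
      refine h3.trans ?_
      rw [pow_succ, ← div_div]
      gcongr

theorem tendsto_infty_of_small {a : ℂ} (ha : a ≠ 0) {p : ℂ} (hp : ‖p‖ ≤ 1 / 10)
    (hap : ‖a‖ * ‖p‖ ≤ 1) : Tendsto (fun n => (Rhat a)^[2 * n] (toS p)) atTop (𝓝 ∞) := by
  choose q hq hqn using iter_toS_small ha hp hap
  have h1 : Tendsto q atTop (𝓝 0) := by
    apply squeeze_zero_norm hqn
    have : Tendsto (fun n : ℕ => ‖p‖ * (1 / 2 : ℝ) ^ n) atTop (𝓝 (‖p‖ * 0)) :=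
      (tendsto_pow_atTop_nhds_zero_of_lt_one (by norm_num) (by norm_num)).const_mul _
    simpa [div_eq_mul_inv] using this
  have h2 := (continuous_toS.tendsto 0).comp h1
  rw [toS_zero] at h2
  exact h2.congr (fun n => (hq n).symm)

theorem tendsto_shift {a : ℂ} {z w : RSphere} (m : ℕ)
    (h : Tendsto (fun n => (Rhat a)^[2 * n] ((Rhat a)^[2 * m] z)) atTop (𝓝 w)) :
    Tendsto (fun n => (Rhat a)^[2 * n] z) atTop (𝓝 w) := by
  rw [← tendsto_add_atTop_iff_nat m]
  refine h.congr fun n => ?_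
  rw [← Function.iterate_add_apply]; congr 1; ring_nf

theorem shift_tendsto {a : ℂ} {z w : RSphere} (m : ℕ)
    (h : Tendsto (fun n => (Rhat a)^[2 * n] z) atTop (𝓝 w)) :
    Tendsto (fun n => (Rhat a)^[2 * n] ((Rhat a)^[2 * m] z)) atTop (𝓝 w) := by
  rw [← tendsto_add_atTop_iff_nat m] at h
  refine h.congr fun n => ?_
  rw [← Function.iterate_add_apply]; congr 1; ring_nf

theorem Rhat_zero (a : ℂ) : Rhat a ((0 : ℂ) : RSphere) = ∞ := by
  rw [Rhat_coe']; simp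

def Par : Set ℂ := {a | a ≠ 0 ∧ ‖a‖ < 11}

theorem isOpen_Par : IsOpen Par :=
  isOpen_ne.inter (isOpen_lt continuous_norm continuous_const)

theorem small_ok {a p : ℂ} (ha : a ∈ Par) (hp : ‖p‖ < 1 / 11) : ‖p‖ ≤ 1 / 10 ∧ ‖a‖ * ‖p‖ ≤ 1 := by
  refine ⟨by linarith, ?_⟩
  have := ha.2
  have h0 := norm_nonneg p
  nlinarith

theorem tendsto_of_iter_even {a : ℂ} (ha : a ∈ Par) {z : RSphere} {n : ℕ} {p : ℂ}
    (hp : ‖p‖ < 1 / 11) (h : (Rhat a)^[2 * n] z = toS p) :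
    Tendsto (fun n => (Rhat a)^[2 * n] z) atTop (𝓝 ∞) := by
  apply tendsto_shift n
  rw [h]
  exact tendsto_infty_of_small ha.1 (small_ok ha hp).1 (small_ok ha hp).2

theorem tendsto_of_iter_odd {a : ℂ} (ha : a ∈ Par) {z : RSphere} {n : ℕ} {p : ℂ}
    (hp : ‖p‖ < 1 / 11) (h : (Rhat a)^[2 * n + 1] z = toS p) :
    Tendsto (fun n => (Rhat a)^[2 * n] z) atTop (𝓝 ((0 : ℂ) : RSphere)) := by
  apply tendsto_shift (n + 1)
  have h1 := tendsto_infty_of_small ha.1 (small_ok ha hp).1 (small_ok ha hp).2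
  have h2 := ((continuous_Rhat ha.1).tendsto ∞).comp h1
  rw [Rhat_infty] at h2
  refine h2.congr fun m => ?_
  rw [Function.comp_apply, ← h, ← Function.iterate_succ_apply' (Rhat a),
    ← Function.iterate_add_apply, ← Function.iterate_add_apply]
  congr 1; omega

theorem mem_basin_of_iter {a : ℂ} (ha : a ∈ Par) {z : RSphere} {l : ℕ} {p : ℂ}
    (hp : ‖p‖ < 1 / 11) (h : (Rhat a)^[l] z = toS p) : z ∈ sphereBasin a := by
  rcases Nat.even_or_odd' l with ⟨n, rfl | rfl⟩
  · exact Or.inl (tendsto_of_iter_even ha hp h)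
  · exact Or.inr (tendsto_of_iter_odd ha hp h)

theorem iter_of_tendsto_infty {a : ℂ} {z : RSphere} {e : ℝ} (he : 0 < e)
    (h : Tendsto (fun n => (Rhat a)^[2 * n] z) atTop (𝓝 ∞)) :
    ∃ n p, ‖p‖ < e ∧ (Rhat a)^[2 * n] z = toS p := by
  have h1 : toS '' Metric.ball 0 e ∈ 𝓝 (∞ : RSphere) := by
    apply (isOpenEmbedding_toS.isOpenMap _ Metric.isOpen_ball).mem_nhds
    exact ⟨0, Metric.mem_ball_self he, toS_zero⟩
  obtain ⟨n, p, hp, hn⟩ := (h.eventually h1).exists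
  exact ⟨n, p, by simpa using hp, hn.symm⟩

theorem iter_of_tendsto_zero {a : ℂ} (ha : a ≠ 0) {z : RSphere} {e : ℝ} (he : 0 < e)
    (h : Tendsto (fun n => (Rhat a)^[2 * n] z) atTop (𝓝 ((0 : ℂ) : RSphere))) :
    ∃ n p, ‖p‖ < e ∧ (Rhat a)^[2 * n + 1] z = toS p := by
  have h1 : toS '' Metric.ball 0 e ∈ 𝓝 (∞ : RSphere) := by
    apply (isOpenEmbedding_toS.isOpenMap _ Metric.isOpen_ball).mem_nhds
    exact ⟨0, Metric.mem_ball_self he, toS_zero⟩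
  have h2 := ((continuous_Rhat ha).tendsto ((0 : ℂ) : RSphere)).comp h
  rw [Rhat_zero] at h2
  obtain ⟨n, p, hp, hn⟩ := (h2.eventually h1).exists
  refine ⟨n, p, by simpa using hp, ?_⟩
  rw [hn, Function.comp_apply, Function.iterate_succ_apply']

theorem iter_of_basin {a : ℂ} (ha : a ≠ 0) {z : RSphere} (hz : z ∈ sphereBasin a) {e : ℝ}
    (he : 0 < e) : ∃ l p, ‖p‖ < e ∧ (Rhat a)^[l] z = toS p := by
  rcases hz with h | h
  · obtain ⟨n, p, hp⟩ := iter_of_tendsto_infty he h; exact ⟨_, p, hp⟩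
  · obtain ⟨n, p, hp⟩ := iter_of_tendsto_zero ha he h; exact ⟨_, p, hp⟩

/-- the total basin is open -/
theorem basin_eventually {a : ℂ} (ha : a ∈ Par) {z : RSphere} (hz : z ∈ sphereBasin a) :
    ∀ᶠ x : ℂ × RSphere in 𝓝 (a, z), x.1 ∈ Par ∧ x.2 ∈ sphereBasin x.1 := by
  obtain ⟨l, p, hp, h⟩ := iter_of_basin ha.1 hz (e := 1 / 11) (by norm_num)
  have h1 : toS '' Metric.ball 0 (1 / 11) ∈ 𝓝 ((Rhat a)^[l] z) := by
    apply (isOpenEmbedding_toS.isOpenMap _ Metric.isOpen_ball).mem_nhds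
    exact ⟨p, by simpa using hp, h.symm⟩
  have h2 : ∀ᶠ x : ℂ × RSphere in 𝓝 (a, z), x.1 ∈ Par :=
    continuous_fst.continuousAt.preimage_mem_nhds (isOpen_Par.mem_nhds ha)
  filter_upwards [h2, (continuousAt_iter ha.1 z l).preimage_mem_nhds h1] with x hx1 hx2
  obtain ⟨q, hq, hq2⟩ := hx2
  exact ⟨hx1, mem_basin_of_iter hx1 (by simpa using hq) hq2.symm⟩

theorem isOpen_basin {a : ℂ} (ha : a ∈ Par) : IsOpen (sphereBasin a) := by
  rw [isOpen_iff_mem_nhds]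
  intro z hz
  have h1 : ContinuousAt (fun z : RSphere => (a, z)) z := by fun_prop
  filter_upwards [h1.eventually (basin_eventually ha hz)] with w hw
  exact hw.2

theorem infty_mem_basin {a : ℂ} (ha : a ≠ 0) : (∞ : RSphere) ∈ sphereBasin a := by
  left
  have := tendsto_infty_of_small ha (p := 0) (by simp) (by simp)
  rwa [toS_zero] at this

theorem infty_mem_Ainf {a : ℂ} (ha : a ≠ 0) : (∞ : RSphere) ∈ Ainf a :=
  mem_connectedComponentIn (infty_mem_basin ha)

theorem Ainf_subset (a : ℂ) : Ainf a ⊆ sphereBasin a := connectedComponentIn_subset _ _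

theorem subset_Ainf {a : ℂ} {S : Set RSphere} (hS : IsPreconnected S) (hB : S ⊆ sphereBasin a)
    {x : RSphere} (hx : x ∈ S) (hxA : x ∈ Ainf a) : S ⊆ Ainf a := by
  unfold Ainf at *
  rw [connectedComponentIn_eq hxA]
  exact hS.subset_connectedComponentIn hx hB

theorem toS_mem_Ainf {a : ℂ} (ha : a ≠ 0) {p : ℂ} (hp : ‖p‖ ≤ 1 / 10) (hap : ‖a‖ * ‖p‖ ≤ 1) :
    toS p ∈ Ainf a := by
  have h := subset_Ainf (a := a) (S := toS '' Metric.closedBall 0 ‖p‖)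
    (((convex_closedBall (0 : ℂ) ‖p‖).isPreconnected).image _ continuous_toS.continuousOn)
    (by
      rintro _ ⟨q, hq, rfl⟩
      have hq' : ‖q‖ ≤ ‖p‖ := by simpa using hq
      exact Or.inl (tendsto_infty_of_small ha (hq'.trans hp)
        ((mul_le_mul_of_nonneg_left hq' (norm_nonneg a)).trans hap)))
    (x := ∞) ⟨0, by simp, toS_zero⟩ (infty_mem_Ainf ha)
  exact h ⟨p, by simp, rfl⟩

theorem neg_mem_Ainf_of_large {a : ℂ} (h : 10 ≤ ‖a‖) : ((-a : ℂ) : RSphere) ∈ Ainf a := by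
  have ha : a ≠ 0 := by rintro rfl; simp at h; linarith
  rw [← toS_inv (neg_ne_zero.2 ha)]
  have hpos : 0 < ‖a‖ := norm_pos_iff.2 ha
  apply toS_mem_Ainf ha
  · rw [norm_inv, norm_neg, one_div]; exact inv_anti₀ (by norm_num) h
  · rw [norm_inv, norm_neg, mul_inv_cancel₀ hpos.ne']

noncomputable def crit (a : ℂ) (k : ℕ) : RSphere := (Rhat a)^[k] ((-1 : ℂ) : RSphere)

theorem crit_zero (a : ℂ) : crit a 0 = ((-1 : ℂ) : RSphere) := rfl
theorem crit_succ (a : ℂ) (k : ℕ) : crit a (k + 1) = Rhat a (crit a k) := by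
  unfold crit; rw [Function.iterate_succ_apply']
theorem crit_one (a : ℂ) : crit a 1 = ((-a : ℂ) : RSphere) := by
  rw [crit_succ, crit_zero, Rhat_coe_ne _ _ (by norm_num)]
  congr 1; ring
theorem crit_add (a : ℂ) (k l : ℕ) : (Rhat a)^[l] (crit a k) = crit a (k + l) := by
  unfold crit; rw [← Function.iterate_add_apply, add_comm]

theorem continuousAt_crit {a : ℂ} (ha : a ≠ 0) (k : ℕ) : ContinuousAt (fun b => crit b k) a :=
  continuousAt_iter_param ha _ k

theorem captureSet_bound {n : ℕ} (hn : 2 ≤ n) {a : ℂ} (ha : a ∈ captureSet n) : ‖a‖ < 10 := by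
  by_contra h
  push Not at h
  apply ha.2.2 1 (by omega)
  have := neg_mem_Ainf_of_large h
  rwa [← crit_one] at this

theorem captureSet_Par {n : ℕ} (hn : 2 ≤ n) {a : ℂ} (ha : a ∈ captureSet n) : a ∈ Par :=
  ⟨ha.1, (captureSet_bound hn ha).trans (by norm_num)⟩

end

section
open Filter Topology OnePoint

theorem norm_fderiv_le_of_ball {E : Type*} [NormedAddCommGroup E] [NormedSpace ℂ E] {F : E → ℂ}
    {x : E} {R M : ℝ} (hR : 0 < R) (hM : 0 ≤ M) (hF : DifferentiableOn ℂ F (Metric.ball x R))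
    (hb : ∀ y ∈ Metric.ball x R, ‖F y‖ ≤ M) : ‖fderiv ℂ F x‖ ≤ M / R := by
  apply ContinuousLinearMap.opNorm_le_bound _ (by positivity)
  intro v
  by_cases hv : v = 0
  · simp [hv]
  have hvn : 0 < ‖v‖ := norm_pos_iff.2 hv
  have hx : DifferentiableAt ℂ F x :=
    hF.differentiableAt (Metric.ball_mem_nhds x hR)
  set H : ℂ → ℂ := fun t => F (x + t • v) with hH
  have hmem : ∀ t : ℂ, ‖t‖ < R / ‖v‖ → x + t • v ∈ Metric.ball x R := by
    intro t ht
    rw [mem_ball_iff_norm, add_sub_cancel_left, norm_smul]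
    rwa [lt_div_iff₀ hvn] at ht
  have hd : deriv H 0 = fderiv ℂ F x v := by
    have h1 : HasDerivAt (fun t : ℂ => x + t • v) v 0 := by
      simpa using ((hasDerivAt_id (0 : ℂ)).smul_const v).const_add x
    have h2 : HasFDerivAt F (fderiv ℂ F x) (x + (0 : ℂ) • v) := by simpa using hx.hasFDerivAt
    exact (h2.comp_hasDerivAt (0 : ℂ) h1).deriv
  rw [← hd]
  have key : ∀ q, 0 < q → q < R / ‖v‖ → ‖deriv H 0‖ ≤ M / q := by
    intro q hq hq2
    apply Complex.norm_deriv_le_of_forall_mem_sphere_norm_le hq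
    · apply DifferentiableOn.diffContOnCl
      intro t ht
      rw [closure_ball _ hq.ne'] at ht
      have ht2 : ‖t‖ < R / ‖v‖ := lt_of_le_of_lt (by simpa using ht) hq2
      have h3 : DifferentiableAt ℂ F (x + t • v) :=
        hF.differentiableAt (Metric.isOpen_ball.mem_nhds (hmem t ht2))
      have h4 : DifferentiableAt ℂ (fun t : ℂ => x + t • v) t := by fun_prop
      exact (h3.comp t h4).differentiableWithinAt
    · intro t ht
      have : ‖t‖ = q := by simpa using ht
      exact hb _ (hmem t (by rw [this]; exact hq2))
  have h5 : Tendsto (fun q : ℝ => M / q) (𝓝[<] (R / ‖v‖)) (𝓝 (M / (R / ‖v‖))) := by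
    apply Tendsto.mono_left _ nhdsWithin_le_nhds
    exact tendsto_const_nhds.div tendsto_id (by positivity)
  have h6 : ‖deriv H 0‖ ≤ M / (R / ‖v‖) := by
    apply ge_of_tendsto h5
    have hpos : 0 < R / ‖v‖ := by positivity
    filter_upwards [Ioo_mem_nhdsLT hpos] with q hq
    exact key q hq.1 hq.2
  refine h6.trans (le_of_eq ?_)
  field_simp

theorem diffAt_of_unif {E : Type*} [NormedAddCommGroup E] [NormedSpace ℂ E]
    {f : ℕ → E → ℂ} {g : E → ℂ} {x : E} {R : ℝ} (hR : 0 < R)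
    (hf : ∀ n, DifferentiableOn ℂ (f n) (Metric.ball x R))
    (h : TendstoUniformlyOn f g atTop (Metric.ball x R)) : DifferentiableAt ℂ g x := by
  have hR2 : 0 < R / 2 := by positivity
  have hsub : ∀ y ∈ Metric.ball x (R / 2), Metric.ball y (R / 2) ⊆ Metric.ball x R := by
    intro y hy
    apply Metric.ball_subset_ball'
    have := Metric.mem_ball.1 hy
    linarith
  have hsub2 : Metric.ball x (R / 2) ⊆ Metric.ball x R := Metric.ball_subset_ball (by linarith)
  have hdiff : ∀ n, ∀ y ∈ Metric.ball x (R / 2), DifferentiableAt ℂ (f n) y := fun n y hy =>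
    (hf n).differentiableAt (Metric.isOpen_ball.mem_nhds (hsub2 hy))
  have hC : UniformCauchySeqOn (fun n => fderiv ℂ (f n)) atTop (Metric.ball x (R / 2)) := by
    rw [Metric.uniformCauchySeqOn_iff]
    intro e he
    have h1 := Metric.uniformCauchySeqOn_iff.1 h.uniformCauchySeqOn (e * (R / 2) / 2) (by positivity)
    obtain ⟨N, hN⟩ := h1
    refine ⟨N, fun m hm n hn y hy => ?_⟩
    have h2 : ‖fderiv ℂ (fun z => f m z - f n z) y‖ ≤ (e * (R / 2) / 2) / (R / 2) := by
      apply norm_fderiv_le_of_ball hR2 (by positivity)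
      · exact ((hf m).mono (hsub y hy)).sub ((hf n).mono (hsub y hy))
      · intro z hz
        have := hN m hm n hn z (hsub y hy hz)
        rw [dist_eq_norm] at this
        exact this.le
    rw [dist_eq_norm, ← fderiv_fun_sub (hdiff m y hy) (hdiff n y hy)]
    refine h2.trans_lt ?_
    field_simp
    linarith
  have hex : ∀ y ∈ Metric.ball x (R / 2), ∃ L, Tendsto (fun n => fderiv ℂ (f n) y) atTop (𝓝 L) :=
    fun y hy => cauchySeq_tendsto_of_complete (hC.cauchySeq hy)
  choose! g' hg' using hex
  have hu := hC.tendstoUniformlyOn_of_tendsto hg'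
  exact (hasFDerivAt_of_tendstoUniformlyOn Metric.isOpen_ball hu
    (fun n y hy => (hdiff n y hy).hasFDerivAt)
    (fun y hy => h.tendsto_at (hsub2 hy)) (Metric.mem_ball_self hR2)).differentiableAt

theorem fderiv_apply_differentiableAt {E : Type*} [NormedAddCommGroup E] [NormedSpace ℂ E]
    {F : E → ℂ} {U : Set E} (hU : IsOpen U) (hF : DifferentiableOn ℂ F U) (v : E) {x : E}
    (hx : x ∈ U) : DifferentiableAt ℂ (fun y => fderiv ℂ F y v) x := by
  -- a ball on which F is bounded
  obtain ⟨R, hR, M, hM, hball, hb⟩ : ∃ R > 0, ∃ M ≥ 0, Metric.ball x (4 * R) ⊆ U ∧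
      ∀ y ∈ Metric.ball x (4 * R), ‖F y‖ ≤ M := by
    have hc : ContinuousAt F x := (hF.differentiableAt (hU.mem_nhds hx)).continuousAt
    have h1 : ∀ᶠ y in 𝓝 x, y ∈ U ∧ ‖F y‖ < ‖F x‖ + 1 :=
      (hU.eventually_mem hx).and
        (hc.norm.eventually (gt_mem_nhds (by simp : ‖F x‖ < ‖F x‖ + 1)))
    obtain ⟨e, he, hsub⟩ := Metric.mem_nhds_iff.1 h1
    refine ⟨e / 4, by positivity, ‖F x‖ + 1, by positivity, ?_, ?_⟩
    · intro y hy; exact (hsub (by convert hy using 2; ring)).1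
    · intro y hy; exact (hsub (by convert hy using 2; ring)).2.le
  have hdiff : ∀ y ∈ Metric.ball x (4 * R), DifferentiableAt ℂ F y := fun y hy =>
    hF.differentiableAt (hU.mem_nhds (hball hy))
  have hbd1 : ∀ y ∈ Metric.ball x (3 * R), ‖fderiv ℂ F y‖ ≤ M / R := by
    intro y hy
    have hs : Metric.ball y R ⊆ Metric.ball x (4 * R) := by
      apply Metric.ball_subset_ball'; have := Metric.mem_ball.1 hy; linarith
    exact norm_fderiv_le_of_ball hR hM (hF.mono (hs.trans hball)) fun z hz => hb z (hs hz)
  have hlip : ∀ y ∈ Metric.ball x (3 * R), ∀ z ∈ Metric.ball x (3 * R),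
      ‖F z - F y‖ ≤ M / R * ‖z - y‖ := by
    intro y hy z hz
    apply Convex.norm_image_sub_le_of_norm_fderiv_le (𝕜 := ℂ) (s := Metric.ball x (3 * R)) _ hbd1
      (convex_ball _ _) hy hz
    intro w hw
    exact hdiff w (Metric.ball_subset_ball (by linarith) hw)
  have hbd2 : ∀ y ∈ Metric.ball x R, ∀ h : E, ‖h‖ < R →
      ‖fderiv ℂ F (y + h) - fderiv ℂ F y‖ ≤ M / R * ‖h‖ / R := by
    intro y hy h hh
    have hs : ∀ z ∈ Metric.ball y R, z ∈ Metric.ball x (3 * R) ∧ z + h ∈ Metric.ball x (3 * R) := by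
      intro z hz
      rw [mem_ball_iff_norm] at hz hy
      constructor
      · rw [mem_ball_iff_norm, show z - x = (z - y) + (y - x) by abel]
        have := norm_add_le (z - y) (y - x); linarith
      · rw [mem_ball_iff_norm, show z + h - x = (z - y) + (y - x) + h by abel]
        have := norm_add_le (z - y) (y - x)
        have := norm_add_le ((z - y) + (y - x)) h; linarith
    have hs3 : Metric.ball x (3 * R) ⊆ Metric.ball x (4 * R) :=
      Metric.ball_subset_ball (by linarith)
    have hshift : ∀ z ∈ Metric.ball y R, HasFDerivAt (fun z => F (z + h)) (fderiv ℂ F (z + h)) z := by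
      intro z hz
      exact (hasFDerivAt_comp_add_right h).2 (hdiff _ (hs3 (hs z hz).2)).hasFDerivAt
    have hyy := Metric.mem_ball_self (x := y) hR
    have e1 : fderiv ℂ (fun z => F (z + h) - F z) y = fderiv ℂ F (y + h) - fderiv ℂ F y :=
      ((hshift y hyy).sub (hdiff y (hs3 (hs y hyy).1)).hasFDerivAt).fderiv
    rw [← e1]
    apply norm_fderiv_le_of_ball hR (by positivity)
    · intro z hz
      exact ((hshift z hz).sub
        (hdiff z (hs3 (hs z hz).1)).hasFDerivAt).differentiableAt.differentiableWithinAt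
    · intro z hz
      have := hlip z (hs z hz).1 (z + h) (hs z hz).2
      simpa using this
  -- difference quotients
  set d : ℕ → ℂ := fun k => ((k : ℂ) + 1)⁻¹ with hd
  have hdn : ∀ k, ‖d k‖ = ((k : ℝ) + 1)⁻¹ := by
    intro k
    rw [hd]; simp only [norm_inv]
    rw [show ((k : ℂ) + 1) = ((k + 1 : ℕ) : ℂ) by push_cast; rfl, Complex.norm_natCast]
    push_cast; rfl
  have hd0 : Tendsto (fun k => ‖d k‖ * ‖v‖) atTop (𝓝 0) := by
    have h0 : Tendsto (fun k => ‖d k‖) atTop (𝓝 0) := by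
      simp only [hdn]
      exact tendsto_inv_atTop_zero.comp (tendsto_atTop_add_const_right _ _ tendsto_natCast_atTop_atTop)
    simpa using h0.mul_const ‖v‖
  obtain ⟨K, hK⟩ := (hd0.eventually (gt_mem_nhds hR)).exists_forall_of_atTop
  have hmem : ∀ y ∈ Metric.ball x R, ∀ k, y + d (k + K) • v ∈ Metric.ball x (4 * R) ∧
      ‖d (k + K) • v‖ < R := by
    intro y hy k
    have h1 : ‖d (k + K) • v‖ < R := by rw [norm_smul]; exact hK _ (by omega)
    refine ⟨?_, h1⟩
    rw [mem_ball_iff_norm] at hy ⊢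
    rw [show y + d (k + K) • v - x = (y - x) + d (k + K) • v by abel]
    have := norm_add_le (y - x) (d (k + K) • v); linarith
  apply diffAt_of_unif (f := fun k y => (d (k + K))⁻¹ * (F (y + d (k + K) • v) - F y)) hR
  · intro k y hy
    have h1 : DifferentiableAt ℂ (fun y => F (y + d (k + K) • v)) y :=
      ((hasFDerivAt_comp_add_right _).2 (hdiff _ (hmem y hy k).1).hasFDerivAt).differentiableAt
    have h2 := hdiff y (Metric.ball_subset_ball (by linarith) hy)
    exact ((h1.sub h2).const_mul _).differentiableWithinAt
  · rw [Metric.tendstoUniformlyOn_iff]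
    intro e he
    have h3 : Tendsto (fun k => M / R / R * ‖v‖ * (‖d (k + K)‖ * ‖v‖)) atTop (𝓝 0) := by
      have := (hd0.comp (tendsto_add_atTop_nat K)).const_mul (M / R / R * ‖v‖)
      simpa using this
    filter_upwards [h3.eventually (gt_mem_nhds he)] with k hk y hy
    set h := d (k + K) • v with hh
    have hdne : d (k + K) ≠ 0 := by
      rw [← norm_pos_iff, hdn]; positivity
    have h4 : ‖F (y + h) - F y - fderiv ℂ F y (y + h - y)‖ ≤ M / R * ‖h‖ / R * ‖y + h - y‖ := by
      apply Convex.norm_image_sub_le_of_norm_fderiv_le' (𝕜 := ℂ) (s := Metric.closedBall y ‖h‖)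
        _ _ (convex_closedBall _ _) (by simp) (by simp)
      · intro z hz
        apply hdiff
        rw [mem_closedBall_iff_norm] at hz
        rw [mem_ball_iff_norm] at hy ⊢
        have := (hmem y (by rwa [mem_ball_iff_norm]) k).2
        rw [show z - x = (z - y) + (y - x) by abel]
        have := norm_add_le (z - y) (y - x); linarith
      · intro z hz
        rw [mem_closedBall_iff_norm] at hz
        have h5 := hbd2 y hy (z - y) (hz.trans_lt (hmem y hy k).2)
        rw [add_sub_cancel] at h5
        refine h5.trans ?_
        gcongr
    rw [add_sub_cancel_left] at h4
    rw [dist_eq_norm, show fderiv ℂ F y v - (d (k + K))⁻¹ * (F (y + h) - F y)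
      = -((d (k + K))⁻¹ * (F (y + h) - F y - fderiv ℂ F y h)) by
        rw [hh, _root_.map_smul, smul_eq_mul]; field_simp; ring]
    rw [norm_neg, norm_mul, norm_inv]
    have h6 : ‖h‖ = ‖d (k + K)‖ * ‖v‖ := by rw [hh, norm_smul]
    rw [h6] at h4
    have hdpos : 0 < ‖d (k + K)‖ := norm_pos_iff.2 hdne
    calc ‖d (k + K)‖⁻¹ * ‖F (y + h) - F y - fderiv ℂ F y h‖
        ≤ ‖d (k + K)‖⁻¹ * (M / R * (‖d (k + K)‖ * ‖v‖) / R * (‖d (k + K)‖ * ‖v‖)) := by gcongr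
      _ = M / R / R * ‖v‖ * (‖d (k + K)‖ * ‖v‖) := by field_simp
      _ < e := hk

/-- continuous square roots of differentiable functions are differentiable -/
theorem differentiableAt_of_sq {E : Type*} [NormedAddCommGroup E] [NormedSpace ℂ E] {f h : E → ℂ}
    {x : E} (hc : ContinuousAt f x) (h0 : f x ≠ 0) (hh : DifferentiableAt ℂ h x)
    (he : ∀ᶠ y in 𝓝 x, f y ^ 2 = h y) : DifferentiableAt ℂ f x := by
  have hx : f x ^ 2 = h x := he.self_of_nhds
  -- local sqrt
  have hh0 : h x ≠ 0 := by rw [← hx]; exact pow_ne_zero _ h0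
  set k : E → ℂ := fun y => f x * ((h x)⁻¹ * h y) ^ ((1 : ℂ) / 2) with hk
  have hkd : DifferentiableAt ℂ k x := by
    apply DifferentiableAt.const_mul
    apply DifferentiableAt.cpow (hh.const_mul _) (differentiableAt_const _)
    rw [inv_mul_cancel₀ hh0]; exact Complex.one_mem_slitPlane
  have hkx : k x = f x := by simp [hk, hh0]
  have hk2 : ∀ y, k y ^ 2 = h y := by
    intro y
    rw [hk]; simp only [mul_pow]
    rw [← Complex.cpow_nat_mul]
    norm_num
    rw [hx]; field_simp
  have hsum : ∀ᶠ y in 𝓝 x, f y + k y ≠ 0 := by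
    have : ContinuousAt (fun y => f y + k y) x := hc.add hkd.continuousAt
    apply this.eventually_ne
    rw [hkx, ← two_mul]; exact mul_ne_zero two_ne_zero h0
  apply hkd.congr_of_eventuallyEq
  filter_upwards [he, hsum] with y h1 h2
  have h3 : (f y + k y) * (f y - k y) = 0 := by
    have := hk2 y
    linear_combination h1 - this
  rcases mul_eq_zero.1 h3 with h4 | h4
  · exact absurd h4 h2
  · exact sub_eq_zero.1 h4

end

section
open Filter Topology OnePoint

theorem diffAt_div {E : Type*} [NormedAddCommGroup E] [NormedSpace ℂ E] {f g : E → ℂ} {x : E}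
    (hf : DifferentiableAt ℂ f x) (hg : DifferentiableAt ℂ g x) (h : g x ≠ 0) :
    DifferentiableAt ℂ (fun y => f y / g y) x := by
  simp only [div_eq_mul_inv]
  exact hf.mul (DifferentiableAt.comp x (differentiableAt_inv h) hg)

noncomputable def csq (z : ℂ) : ℂ := z ^ ((1 : ℂ) / 2)

theorem csq_sq (z : ℂ) : csq z ^ 2 = z := by
  unfold csq
  rw [← Complex.cpow_nat_mul]; norm_num

theorem csq_re_nonneg (z : ℂ) : 0 ≤ (csq z).re := by
  unfold csq
  by_cases h : z = 0
  · subst h; simp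
  · rw [Complex.cpow_def_of_ne_zero h, Complex.exp_re]
    apply mul_nonneg (Real.exp_pos _).le
    apply Real.cos_nonneg_of_mem_Icc
    have h1 : (Complex.log z * (1 / 2)).im = z.arg / 2 := by
      simp [Complex.mul_im, Complex.log_im]; ring
    rw [h1]
    have := Complex.arg_le_pi z
    have := Complex.neg_pi_lt_arg z
    constructor <;> linarith

theorem csq_re_ge {z : ℂ} {q : ℝ} (hq : 0 ≤ q) (h : q ^ 2 ≤ z.re) : q ≤ (csq z).re := by
  have h0 := csq_re_nonneg z
  have h1 : (csq z ^ 2).re = z.re := by rw [csq_sq]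
  rw [pow_two, Complex.mul_re] at h1
  have h2 : q ^ 2 ≤ (csq z).re ^ 2 := by nlinarith [mul_self_nonneg (csq z).im]
  exact (sq_le_sq₀ hq h0).1 h2

theorem csq_four : csq 4 = 2 := by
  have h1 : (csq 4 - 2) * (csq 4 + 2) = 0 := by linear_combination csq_sq 4
  rcases mul_eq_zero.1 h1 with h | h
  · exact sub_eq_zero.1 h
  · have := csq_re_nonneg 4
    rw [eq_neg_of_add_eq_zero_left h] at this
    norm_num at this

theorem csq_one : csq 1 = 1 := by unfold csq; simp

theorem differentiableAt_csq {E : Type*} [NormedAddCommGroup E] [NormedSpace ℂ E] {f : E → ℂ}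
    {x : E} (hf : DifferentiableAt ℂ f x) (h : 0 < (f x).re) :
    DifferentiableAt ℂ (fun y => csq (f y)) x := by
  unfold csq
  exact DifferentiableAt.cpow hf (differentiableAt_const _) (Or.inl h)

theorem norm_ge_of_re {z : ℂ} {q : ℝ} (h : q ≤ z.re) : q ≤ ‖z‖ :=
  h.trans (Complex.re_le_norm z)

theorem re_ge_of_norm_sub {z w : ℂ} {e : ℝ} (h : ‖z - w‖ ≤ e) : w.re - e ≤ z.re := by
  have h1 := (abs_le.1 (Complex.abs_re_le_norm (z - w))).1
  rw [Complex.sub_re] at h1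
  linarith

noncomputable def rhoP (a S x : ℂ) : ℂ := csq (1 + a * S / (x - S))
noncomputable def Qf (a S x : ℂ) : ℂ := S + (x - S) * (1 + rhoP a S x)
noncomputable def Kf (a S x : ℂ) : ℂ := csq (Qf a S x)

theorem xS_norm {S x : ℂ} (hS : ‖S‖ ≤ 1 / 10000) (hx : ‖x - 2‖ ≤ 1 / 2) :
    7 / 5 ≤ ‖x - S‖ ∧ ‖x - S‖ ≤ 2.6 := by
  have h1 : ‖(2 : ℂ)‖ = 2 := by simp
  have e1 : x - S = (x - 2) - S + 2 := by ring
  have e2 : (2 : ℂ) = (x - S) - ((x - 2) - S) := by ring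
  have h2 := norm_sub_le (x - 2) S
  constructor
  · have := norm_sub_le (x - S) ((x - 2) - S)
    rw [← e2, h1] at this
    linarith
  · rw [e1]
    have := norm_add_le ((x - 2) - S) 2
    linarith

theorem rho_arg {a S x : ℂ} (ha : ‖a‖ < 11) (hS : ‖S‖ ≤ 1 / 10000) (hx : ‖x - 2‖ ≤ 1 / 2) :
    ‖a * S / (x - S)‖ ≤ 1 / 1000 := by
  have h1 := (xS_norm hS hx).1
  rw [norm_div, norm_mul, div_le_iff₀ (by linarith)]
  have h2 : ‖a‖ * ‖S‖ ≤ 11 * (1 / 10000) := by gcongr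
  linarith

theorem rho_arg_re {a S x : ℂ} (ha : ‖a‖ < 11) (hS : ‖S‖ ≤ 1 / 10000) (hx : ‖x - 2‖ ≤ 1 / 2) :
    0.999 ≤ (1 + a * S / (x - S)).re := by
  have := re_ge_of_norm_sub (z := 1 + a * S / (x - S)) (w := 1) (e := 1 / 1000)
    (by simpa using rho_arg ha hS hx)
  norm_num at this ⊢
  linarith

theorem rho_re {a S x : ℂ} (ha : ‖a‖ < 11) (hS : ‖S‖ ≤ 1 / 10000) (hx : ‖x - 2‖ ≤ 1 / 2) :
    0.99 ≤ (rhoP a S x).re := by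
  apply csq_re_ge (by norm_num)
  have := rho_arg_re ha hS hx
  norm_num at this ⊢
  linarith

theorem rho_near {a S x : ℂ} (ha : ‖a‖ < 11) (hS : ‖S‖ ≤ 1 / 10000) (hx : ‖x - 2‖ ≤ 1 / 2) :
    ‖rhoP a S x - 1‖ ≤ 1 / 1000 := by
  have h1 := rho_re ha hS hx
  have h2 : (rhoP a S x - 1) * (rhoP a S x + 1) = a * S / (x - S) := by
    have : rhoP a S x ^ 2 = 1 + a * S / (x - S) := csq_sq _
    linear_combination this
  have h3 : 1.99 ≤ ‖rhoP a S x + 1‖ := norm_ge_of_re (by simp; linarith)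
  have h4 := rho_arg ha hS hx
  rw [← h2, norm_mul] at h4
  nlinarith [norm_nonneg (rhoP a S x - 1)]

theorem Qf_near {a S x : ℂ} (ha : ‖a‖ < 11) (hS : ‖S‖ ≤ 1 / 10000) (hx : ‖x - 2‖ ≤ 1 / 2) :
    ‖Qf a S x - 2 * x‖ ≤ 0.003 := by
  have e : Qf a S x - 2 * x = (x - S) * (rhoP a S x - 1) - S := by unfold Qf; ring
  rw [e]
  have h1 := norm_sub_le ((x - S) * (rhoP a S x - 1)) S
  rw [norm_mul] at h1
  have h2 : ‖x - S‖ * ‖rhoP a S x - 1‖ ≤ 2.6 * (1 / 1000) := by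
    have := rho_near ha hS hx
    have := (xS_norm hS hx).2
    gcongr
  linarith

theorem Qf_re {a S x : ℂ} (ha : ‖a‖ < 11) (hS : ‖S‖ ≤ 1 / 10000) (hx : ‖x - 2‖ ≤ 1 / 2) :
    2.997 ≤ (Qf a S x).re := by
  have h1 := re_ge_of_norm_sub (Qf_near ha hS hx)
  have h2 := re_ge_of_norm_sub hx
  simp at h1 h2
  norm_num at h2 h1 ⊢
  linarith

theorem Kf_re {a S x : ℂ} (ha : ‖a‖ < 11) (hS : ‖S‖ ≤ 1 / 10000) (hx : ‖x - 2‖ ≤ 1 / 2) :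
    1.73 ≤ (Kf a S x).re := by
  apply csq_re_ge (by norm_num)
  have := Qf_re ha hS hx
  norm_num at this ⊢
  linarith

theorem Kf_near {a S x : ℂ} (ha : ‖a‖ < 11) (hS : ‖S‖ ≤ 1 / 10000) (hx : ‖x - 2‖ ≤ 1 / 2) :
    ‖Kf a S x - 2‖ ≤ 1 / 2 := by
  have h2 : (Kf a S x - 2) * (Kf a S x + 2) = (Qf a S x - 2 * x) + 2 * (x - 2) := by
    have : Kf a S x ^ 2 = Qf a S x := csq_sq _
    linear_combination this
  have h1 := Kf_re ha hS hx
  have h3 : 3.73 ≤ ‖Kf a S x + 2‖ := norm_ge_of_re (by simp; linarith)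
  have h4 : ‖(Kf a S x - 2) * (Kf a S x + 2)‖ ≤ 0.003 + 2 * (1 / 2) := by
    rw [h2]
    refine (norm_add_le _ _).trans (add_le_add (Qf_near ha hS hx) ?_)
    rw [norm_mul]; simp; linarith
  rw [norm_mul] at h4
  nlinarith [norm_nonneg (Kf a S x - 2)]

theorem Kf_lip {a S x y : ℂ} (ha : ‖a‖ < 11) (hS : ‖S‖ ≤ 1 / 10000) (hx : ‖x - 2‖ ≤ 1 / 2)
    (hy : ‖y - 2‖ ≤ 1 / 2) : ‖Kf a S x - Kf a S y‖ ≤ 3 / 4 * ‖x - y‖ := by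
  have hxs := (xS_norm hS hx).1
  have hys := (xS_norm hS hy).1
  have hxs0 : x - S ≠ 0 := norm_pos_iff.1 (by linarith)
  have hys0 : y - S ≠ 0 := norm_pos_iff.1 (by linarith)
  have r1 : (rhoP a S x - rhoP a S y) * (rhoP a S x + rhoP a S y)
      = a * S * (y - x) / ((x - S) * (y - S)) := by
    have e1 : rhoP a S x ^ 2 = 1 + a * S / (x - S) := csq_sq _
    have e2 : rhoP a S y ^ 2 = 1 + a * S / (y - S) := csq_sq _
    have e3 : a * S * (y - x) / ((x - S) * (y - S)) = a * S / (x - S) - a * S / (y - S) := by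
      field_simp; ring
    rw [e3]
    linear_combination e1 - e2
  have hr : 1.98 ≤ ‖rhoP a S x + rhoP a S y‖ := by
    apply norm_ge_of_re
    have h1 := rho_re ha hS hx
    have h2 := rho_re ha hS hy
    rw [Complex.add_re]; norm_num at h1 h2 ⊢; linarith
  have hd0 := norm_nonneg (x - y)
  have r2 : ‖y - S‖ * ‖rhoP a S x - rhoP a S y‖ ≤ 0.001 * ‖x - y‖ := by
    have h1 : ‖y - S‖ * ‖rhoP a S x - rhoP a S y‖ * ‖rhoP a S x + rhoP a S y‖
        = ‖a‖ * ‖S‖ * ‖x - y‖ / ‖x - S‖ := by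
      rw [mul_assoc, ← norm_mul, r1, norm_div, norm_mul, norm_mul, norm_mul, norm_sub_rev y x]
      have : ‖y - S‖ ≠ 0 := by linarith
      have : ‖x - S‖ ≠ 0 := by linarith
      field_simp
    have h2 : ‖a‖ * ‖S‖ * ‖x - y‖ / ‖x - S‖ ≤ 0.0011 * ‖x - y‖ / 1.4 := by
      have : ‖a‖ * ‖S‖ ≤ 11 * (1 / 10000) := by gcongr
      have h14 : (1.4 : ℝ) ≤ ‖x - S‖ := by norm_num at hxs ⊢; linarith
      gcongr
      linarith
    have h3 : 0 ≤ ‖y - S‖ * ‖rhoP a S x - rhoP a S y‖ := by positivity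
    have h4 : ‖y - S‖ * ‖rhoP a S x - rhoP a S y‖ * 1.98 ≤ 0.0011 * ‖x - y‖ / 1.4 := by
      calc _ ≤ ‖y - S‖ * ‖rhoP a S x - rhoP a S y‖ * ‖rhoP a S x + rhoP a S y‖ := by gcongr
        _ ≤ _ := by rw [h1]; exact h2
    norm_num at h4 ⊢
    linarith
  have q1 : ‖Qf a S x - Qf a S y‖ ≤ 2.002 * ‖x - y‖ := by
    have e : Qf a S x - Qf a S y = (x - y) * (1 + rhoP a S x) + (y - S) * (rhoP a S x - rhoP a S y) := by
      unfold Qf; ring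
    rw [e]
    refine (norm_add_le _ _).trans ?_
    rw [norm_mul, norm_mul]
    have h1 : ‖1 + rhoP a S x‖ ≤ 2.001 := by
      have h2 := norm_add_le (2 : ℂ) (rhoP a S x - 1)
      rw [show (2 : ℂ) + (rhoP a S x - 1) = 1 + rhoP a S x by ring] at h2
      have h3 := rho_near ha hS hx
      simp at h2
      norm_num at h2 h3 ⊢; linarith
    nlinarith
  have k1 : (Kf a S x - Kf a S y) * (Kf a S x + Kf a S y) = Qf a S x - Qf a S y := by
    have e1 : Kf a S x ^ 2 = Qf a S x := csq_sq _
    have e2 : Kf a S y ^ 2 = Qf a S y := csq_sq _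
    linear_combination e1 - e2
  have hk : 3.46 ≤ ‖Kf a S x + Kf a S y‖ := by
    apply norm_ge_of_re
    have h1 := Kf_re ha hS hx
    have h2 := Kf_re ha hS hy
    rw [Complex.add_re]; norm_num at h1 h2 ⊢; linarith
  rw [← k1, norm_mul] at q1
  have : ‖Kf a S x - Kf a S y‖ * 3.46 ≤ 2.002 * ‖x - y‖ := by
    refine le_trans ?_ q1
    gcongr
  norm_num at this ⊢
  linarith

/-- approximations of the local Böttcher data -/
noncomputable def sg : ℕ → ℂ → ℂ → ℂ
  | 0 => fun _ _ => 2
  | n + 1 => fun a s => Kf a (s ^ 2) (sg n a (s ^ 2))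

theorem sq_small {s : ℂ} (hs : ‖s‖ ≤ 1 / 100) : ‖s ^ 2‖ ≤ 1 / 10000 ∧ ‖s ^ 2‖ ≤ 1 / 100 := by
  rw [norm_pow]
  have := norm_nonneg s
  constructor <;> nlinarith

theorem sg_near {a : ℂ} (ha : ‖a‖ < 11) (n : ℕ) :
    ∀ {s : ℂ}, ‖s‖ ≤ 1 / 100 → ‖sg n a s - 2‖ ≤ 1 / 2 := by
  induction n with
  | zero => intro s hs; simp [sg]
  | succ n ih => intro s hs; exact Kf_near ha (sq_small hs).1 (ih (sq_small hs).2)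

theorem sg_step {a : ℂ} (ha : ‖a‖ < 11) (n : ℕ) :
    ∀ {s : ℂ}, ‖s‖ ≤ 1 / 100 → dist (sg n a s) (sg (n + 1) a s) ≤ 1 * (3 / 4) ^ n := by
  induction n with
  | zero =>
    intro s hs
    have := sg_near ha 1 hs
    rw [dist_comm, dist_eq_norm]
    simp [sg] at this ⊢
    linarith
  | succ n ih =>
    intro s hs
    have h1 := Kf_lip ha (sq_small hs).1 (sg_near ha n (sq_small hs).2)
      (sg_near ha (n + 1) (sq_small hs).2)
    have h2 := ih (sq_small hs).2
    rw [dist_eq_norm] at h2 ⊢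
    have h3 : ‖sg (n + 1) a s - sg (n + 1 + 1) a s‖ ≤ 3 / 4 * (1 * (3 / 4) ^ n) :=
      h1.trans (by gcongr)
    refine h3.trans (le_of_eq ?_)
    rw [pow_succ]; ring

theorem sg_exists {a s : ℂ} (ha : ‖a‖ < 11) (hs : ‖s‖ ≤ 1 / 100) :
    ∃ x, Tendsto (fun n => sg n a s) atTop (𝓝 x) :=
  cauchySeq_tendsto_of_complete
    (cauchySeq_of_le_geometric (3 / 4) 1 (by norm_num) fun n => sg_step ha n hs)

open Classical in
noncomputable def sig0 (a s : ℂ) : ℂ :=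
  if h : ∃ x, Tendsto (fun n => sg n a s) atTop (𝓝 x) then h.choose else 0

theorem sig0_tendsto {a s : ℂ} (ha : ‖a‖ < 11) (hs : ‖s‖ ≤ 1 / 100) :
    Tendsto (fun n => sg n a s) atTop (𝓝 (sig0 a s)) := by
  unfold sig0
  rw [dif_pos (sg_exists ha hs)]
  exact (sg_exists ha hs).choose_spec

theorem sig0_near {a s : ℂ} (ha : ‖a‖ < 11) (hs : ‖s‖ ≤ 1 / 100) : ‖sig0 a s - 2‖ ≤ 1 / 2 :=
  le_of_tendsto ((sig0_tendsto ha hs).sub_const 2).norm (Eventually.of_forall fun n => sg_near ha n hs)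

theorem sig0_eq {a s : ℂ} (ha : ‖a‖ < 11) (hs : ‖s‖ ≤ 1 / 100) :
    sig0 a s = Kf a (s ^ 2) (sig0 a (s ^ 2)) := by
  have h1 := sig0_tendsto ha (sq_small hs).2
  have h2 : Tendsto (fun n => sg (n + 1) a s) atTop (𝓝 (Kf a (s ^ 2) (sig0 a (s ^ 2)))) := by
    rw [tendsto_iff_norm_sub_tendsto_zero] at h1 ⊢
    have h3 := h1.const_mul (3 / 4)
    rw [mul_zero] at h3
    refine squeeze_zero (fun n => norm_nonneg _) (fun n => ?_) h3
    exact Kf_lip ha (sq_small hs).1 (sg_near ha n (sq_small hs).2) (sig0_near ha (sq_small hs).2)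
  exact tendsto_nhds_unique ((tendsto_add_atTop_iff_nat 1).2 (sig0_tendsto ha hs)) h2

theorem Kf_zero_two (a : ℂ) : Kf a 0 2 = 2 := by
  unfold Kf Qf rhoP
  simp [csq_one]
  norm_num [csq_four]

theorem sg_zero (a : ℂ) (n : ℕ) : sg n a 0 = 2 := by
  induction n with
  | zero => rfl
  | succ n ih => simp [sg, ih, Kf_zero_two]

theorem sig0_zero {a : ℂ} (ha : ‖a‖ < 11) : sig0 a 0 = 2 := by
  have h := sig0_tendsto ha (s := 0) (by simp)
  simp only [sg_zero] at h
  exact tendsto_nhds_unique h tendsto_const_nhds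

def Dom0 : Set (ℂ × ℂ) := {x | ‖x.1‖ < 11 ∧ ‖x.2‖ < 1 / 100}

theorem isOpen_Dom0 : IsOpen Dom0 :=
  (isOpen_lt continuous_fst.norm continuous_const).inter
    (isOpen_lt continuous_snd.norm continuous_const)

theorem rhoP_diff {x : ℂ × ℂ} {T h : ℂ × ℂ → ℂ} (ha : ‖x.1‖ < 11) (hS : ‖T x‖ ≤ 1 / 10000)
    (hx : ‖h x - 2‖ ≤ 1 / 2) (hT : DifferentiableAt ℂ T x) (hh : DifferentiableAt ℂ h x) :
    DifferentiableAt ℂ (fun y => rhoP y.1 (T y) (h y)) x := by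
  apply differentiableAt_csq
  · have hne : h x - T x ≠ 0 := norm_pos_iff.1 (by linarith [(xS_norm hS hx).1])
    have h1 : DifferentiableAt ℂ (fun y : ℂ × ℂ => y.1 * T y) x := differentiableAt_fst.mul hT
    exact (diffAt_div h1 (hh.sub hT) hne).const_add 1
  · have := rho_arg_re ha hS hx
    exact lt_of_lt_of_le (by norm_num) this

theorem Kf_diff {x : ℂ × ℂ} {T h : ℂ × ℂ → ℂ} (ha : ‖x.1‖ < 11) (hS : ‖T x‖ ≤ 1 / 10000)
    (hx : ‖h x - 2‖ ≤ 1 / 2) (hT : DifferentiableAt ℂ T x) (hh : DifferentiableAt ℂ h x) :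
    DifferentiableAt ℂ (fun y => Kf y.1 (T y) (h y)) x := by
  apply differentiableAt_csq
  · exact hT.add ((hh.sub hT).mul ((rhoP_diff ha hS hx hT hh).const_add 1))
  · have := Qf_re ha hS hx
    exact lt_of_lt_of_le (by norm_num) this

theorem sg_diff (n : ℕ) : DifferentiableOn ℂ (fun x : ℂ × ℂ => sg n x.1 x.2) Dom0 := by
  induction n with
  | zero => exact differentiableOn_const _
  | succ n ih =>
    intro x hx
    apply DifferentiableAt.differentiableWithinAt
    have hs := sq_small hx.2.le
    have hT : DifferentiableAt ℂ (fun y : ℂ × ℂ => y.2 ^ 2) x := by fun_prop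
    apply Kf_diff (T := fun y => y.2 ^ 2) (h := fun y => sg n y.1 (y.2 ^ 2)) hx.1 hs.1
      (sg_near hx.1 n hs.2) hT
    have hmem : ((x.1, x.2 ^ 2) : ℂ × ℂ) ∈ Dom0 :=
      ⟨hx.1, lt_of_le_of_lt hs.1 (by norm_num)⟩
    have h1 := ih.differentiableAt (isOpen_Dom0.mem_nhds hmem)
    have h2 : DifferentiableAt ℂ (fun y : ℂ × ℂ => (y.1, y.2 ^ 2)) x := by fun_prop
    exact DifferentiableAt.comp x h1 h2

theorem sig0_diff : DifferentiableOn ℂ (fun x : ℂ × ℂ => sig0 x.1 x.2) Dom0 := by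
  intro x hx
  apply DifferentiableAt.differentiableWithinAt
  obtain ⟨R, hR, hsub⟩ := Metric.isOpen_iff.1 isOpen_Dom0 x hx
  apply diffAt_of_unif hR (f := fun n x => sg n x.1 x.2) fun n => (sg_diff n).mono hsub
  rw [Metric.tendstoUniformlyOn_iff]
  intro e he
  have h1 : Tendsto (fun n : ℕ => 1 * (3 / 4 : ℝ) ^ n / (1 - 3 / 4)) atTop (𝓝 0) := by
    have := (tendsto_pow_atTop_nhds_zero_of_lt_one (r := (3 / 4 : ℝ)) (by norm_num)
      (by norm_num)).const_mul 1 |>.div_const (1 - 3 / 4)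
    simpa using this
  filter_upwards [h1.eventually (gt_mem_nhds he)] with n hn y hy
  have hy2 := hsub hy
  rw [dist_comm]
  exact (dist_le_of_le_geometric_of_tendsto (3 / 4) 1 (by norm_num)
    (fun n => sg_step hy2.1 n hy2.2.le) (sig0_tendsto hy2.1 hy2.2.le) n).trans_lt hn

noncomputable def rho0 (a S : ℂ) : ℂ := rhoP a S (sig0 a S)

theorem rho0_diff {x : ℂ × ℂ} (h1 : ‖x.1‖ < 11) (h2 : ‖x.2‖ ≤ 1 / 10000) :
    DifferentiableAt ℂ (fun x : ℂ × ℂ => rho0 x.1 x.2) x := by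
  have hmem : x ∈ Dom0 := ⟨h1, by linarith⟩
  exact rhoP_diff (T := fun y => y.2) (h := fun y => sig0 y.1 y.2) h1 h2
    (sig0_near h1 (by linarith)) differentiableAt_snd
    (sig0_diff.differentiableAt (isOpen_Dom0.mem_nhds hmem))

theorem rho0_sq {a S : ℂ} (ha : ‖a‖ < 11) (hS : ‖S‖ ≤ 1 / 10000) :
    rho0 a S ^ 2 * (sig0 a S - S) = (sig0 a S - S) + a * S := by
  have h1 := (xS_norm hS (sig0_near ha (by linarith : ‖S‖ ≤ 1 / 100))).1
  have h0 : sig0 a S - S ≠ 0 := norm_pos_iff.1 (by linarith)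
  unfold rho0 rhoP
  rw [csq_sq]
  field_simp

theorem sig0_sq {a s : ℂ} (ha : ‖a‖ < 11) (hs : ‖s‖ ≤ 1 / 100) :
    sig0 a s ^ 2 = s ^ 2 + (sig0 a (s ^ 2) - s ^ 2) * (1 + rho0 a (s ^ 2)) := by
  conv_lhs => rw [sig0_eq ha hs]
  exact csq_sq _

theorem rho0_near {a S : ℂ} (ha : ‖a‖ < 11) (hS : ‖S‖ ≤ 1 / 10000) : ‖rho0 a S - 1‖ ≤ 1 / 1000 :=
  rho_near ha hS (sig0_near ha (by linarith))

theorem rho0_zero {a : ℂ} : rho0 a 0 = 1 := by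
  unfold rho0 rhoP; simp [csq_one]

theorem sig0_lip {a s t : ℂ} (ha : ‖a‖ < 11) (hs : ‖s‖ ≤ 1 / 200) (ht : ‖t‖ ≤ 1 / 200) :
    ‖sig0 a s - sig0 a t‖ ≤ 101 * ‖s - t‖ := by
  have hd : ∀ x : ℂ, ‖x‖ < 1 / 100 → DifferentiableAt ℂ (fun x => sig0 a x) x := by
    intro x hx
    have hmem : ((a, x) : ℂ × ℂ) ∈ Dom0 := ⟨ha, hx⟩
    have h1 := sig0_diff.differentiableAt (isOpen_Dom0.mem_nhds hmem)
    have h2 : DifferentiableAt ℂ (fun y : ℂ => (a, y)) x := by fun_prop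
    exact DifferentiableAt.comp x h1 h2
  have hb : ∀ x ∈ Metric.closedBall (0 : ℂ) (1 / 200), ‖fderiv ℂ (fun x => sig0 a x) x‖ ≤ 101 := by
    intro x hx
    have hx' : ‖x‖ ≤ 1 / 200 := by simpa using hx
    have hsub : ∀ y ∈ Metric.ball x (1 / 200), ‖y‖ < 1 / 100 := by
      intro y hy
      rw [mem_ball_iff_norm] at hy
      have := norm_add_le (y - x) x
      rw [sub_add_cancel] at this
      linarith
    have h1 : ‖fderiv ℂ (fun x => sig0 a x - 2) x‖ ≤ (1 / 2) / (1 / 200) := by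
      apply norm_fderiv_le_of_ball (by norm_num) (by norm_num)
      · intro y hy
        exact ((hd y (hsub y hy)).sub_const 2).differentiableWithinAt
      · intro y hy
        exact sig0_near ha (hsub y hy).le
    rw [fderiv_sub_const] at h1
    norm_num at h1
    linarith
  have := Convex.norm_image_sub_le_of_norm_fderiv_le (𝕜 := ℂ) (f := fun x => sig0 a x)
    (s := Metric.closedBall (0 : ℂ) (1 / 200)) (x := t) (y := s) (C := 101)
    (fun x hx => hd x (lt_of_le_of_lt (by simpa using hx) (by norm_num))) hb
    (convex_closedBall _ _) (by simpa using ht) (by simpa using hs)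
  exact this

theorem sig0_norm {a s : ℂ} (ha : ‖a‖ < 11) (hs : ‖s‖ ≤ 1 / 100) :
    3 / 2 ≤ ‖sig0 a s‖ ∧ ‖sig0 a s‖ ≤ 5 / 2 := by
  have h := sig0_near ha hs
  have h2 : ‖(2 : ℂ)‖ = 2 := by simp
  constructor
  · have := norm_sub_le (sig0 a s) (sig0 a s - 2)
    rw [sub_sub_cancel, h2] at this; linarith
  · have := norm_add_le (sig0 a s - 2) 2
    rw [sub_add_cancel, h2] at this; linarith

theorem sig0_inj {a s t : ℂ} (ha : ‖a‖ < 11) (hs : ‖s‖ ≤ 1 / 200) (ht : ‖t‖ ≤ 1 / 200)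
    (h : s * sig0 a t = t * sig0 a s) : s = t := by
  have h1 : (s - t) * sig0 a t = t * (sig0 a s - sig0 a t) := by linear_combination h
  have h2 := congrArg norm h1
  rw [norm_mul, norm_mul] at h2
  have h3 := sig0_lip ha hs ht
  have h4 := (sig0_norm ha (s := t) (by linarith)).1
  have h5 : ‖t‖ * ‖sig0 a s - sig0 a t‖ ≤ 1 / 200 * (101 * ‖s - t‖) := by gcongr
  have h6 : ‖s - t‖ ≤ 0 := by nlinarith [norm_nonneg (s - t)]
  exact sub_eq_zero.1 (norm_le_zero_iff.1 h6)

theorem sig0_surj {a p : ℂ} (ha : ‖a‖ < 11) (hp : ‖p‖ ≤ 1 / 2000) :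
    ∃ s, ‖s‖ < 1 / 200 ∧ s * (1 + p) = p * sig0 a s := by
  have h1p : 1999 / 2000 ≤ ‖1 + p‖ := by
    have := norm_sub_le (1 + p) p
    simp at this; linarith
  have hne : 1 + p ≠ 0 := norm_pos_iff.1 (by linarith)
  set e := p / (1 + p) with he
  have hen : ‖e‖ ≤ 1 / 1999 := by
    rw [he, norm_div, div_le_iff₀ (by linarith)]; linarith
  have hmaps : ∀ s, ‖s‖ ≤ 1 / 200 → ‖e * sig0 a s‖ < 1 / 200 := by
    intro s hs
    rw [norm_mul]
    have := (sig0_norm ha (s := s) (by linarith)).2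
    calc ‖e‖ * ‖sig0 a s‖ ≤ 1 / 1999 * (5 / 2) := by gcongr
      _ < _ := by norm_num
  have hM : Set.MapsTo (fun s => e * sig0 a s) (Metric.closedBall 0 (1 / 200))
      (Metric.closedBall 0 (1 / 200)) := by
    intro s hs
    simpa using (hmaps s (by simpa using hs)).le
  have hcomplete : IsComplete (Metric.closedBall (0 : ℂ) (1 / 200)) :=
    Metric.isClosed_closedBall.isComplete
  have hcontr : ContractingWith (1 / 2) (hM.restrict _ _ _) := by
    refine ⟨by rw [← NNReal.coe_lt_coe]; norm_num, ?_⟩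
    apply LipschitzWith.of_dist_le_mul
    intro x y
    rw [Subtype.dist_eq, Subtype.dist_eq, dist_eq_norm, dist_eq_norm]
    have hx : ‖(x : ℂ)‖ ≤ 1 / 200 := by simpa using x.2
    have hy : ‖(y : ℂ)‖ ≤ 1 / 200 := by simpa using y.2
    simp only [Set.MapsTo.val_restrict_apply]
    rw [← mul_sub, norm_mul]
    have := sig0_lip ha hx hy
    calc ‖e‖ * ‖sig0 a x - sig0 a y‖ ≤ 1 / 1999 * (101 * ‖(x : ℂ) - y‖) := by gcongr
      _ ≤ _ := by
        push_cast
        nlinarith [norm_nonneg ((x : ℂ) - y)]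
  obtain ⟨s, hs, hfix, -⟩ := hcontr.exists_fixedPoint' hcomplete hM (x := 0) (by simp)
    (edist_ne_top _ _)
  have hs' : ‖s‖ ≤ 1 / 200 := by simpa using hs
  have hfix' : e * sig0 a s = s := hfix
  refine ⟨s, ?_, ?_⟩
  · rw [← hfix']; exact hmaps s hs'
  · have h7 : s = p / (1 + p) * sig0 a s := hfix'.symm
    conv_lhs => rw [h7]
    field_simp

end

section
open Filter Topology OnePoint

theorem exists_sqrt_lift {V : Set ℂ} {r : ℝ} {h : ℂ → ℂ → ℂ} {e : ℂ}
    (hc : ContinuousOn (fun x : ℂ × ℂ => h x.1 x.2) (V ×ˢ Metric.closedBall 0 r))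
    (hne : ∀ a ∈ V, ∀ s, ‖s‖ ≤ r → h a s ≠ 0) (he : ∀ a ∈ V, h a 0 = e ^ 2) (he0 : e ≠ 0) :
    ∃ σ : ℂ → ℂ → ℂ, ContinuousOn (fun x : ℂ × ℂ => σ x.1 x.2) (V ×ˢ Metric.closedBall 0 r) ∧
      (∀ a ∈ V, ∀ s, ‖s‖ ≤ r → σ a s ^ 2 = h a s) ∧ ∀ a ∈ V, 0 ≤ r → σ a 0 = e := by
  classical
  have hmem : ∀ (t : unitInterval) (x : ↥(V ×ˢ Metric.closedBall (0 : ℂ) r)), ((x.1.1, (t : ℂ) * x.1.2) : ℂ × ℂ) ∈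
      V ×ˢ Metric.closedBall (0 : ℂ) r := by
    intro t x
    refine ⟨x.2.1, ?_⟩
    have h1 : ‖x.1.2‖ ≤ r := by simpa using x.2.2
    have h2 : ‖((t : ℝ) : ℂ) * x.1.2‖ ≤ r := by
      rw [norm_mul, Complex.norm_real, Real.norm_of_nonneg t.2.1]
      exact (mul_le_of_le_one_left (norm_nonneg _) t.2.2).trans h1
    simpa using h2
  have hnz : ∀ (t : unitInterval) (x : ↥(V ×ˢ Metric.closedBall (0 : ℂ) r)), h x.1.1 ((t : ℂ) * x.1.2) ≠ 0 := by
    intro t x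
    exact hne _ (hmem t x).1 _ (by simpa using (hmem t x).2)
  let H : C(unitInterval × ↥(V ×ˢ Metric.closedBall (0 : ℂ) r), {x : ℂ // x ≠ 0}) :=
    ⟨fun x => ⟨h x.2.1.1 ((x.1 : ℂ) * x.2.1.2), hnz x.1 x.2⟩, by
      apply Continuous.subtype_mk
      have h1 : Continuous (fun x : unitInterval × ↥(V ×ˢ Metric.closedBall (0 : ℂ) r) =>
          ((x.2.1.1, (x.1 : ℂ) * x.2.1.2) : ℂ × ℂ)) := by fun_prop
      exact hc.comp_continuous h1 fun x => hmem x.1 x.2⟩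
  have cov := isCoveringMap_npow (𝕜 := ℂ) 2 (by norm_num)
  let f : C(↥(V ×ˢ Metric.closedBall (0 : ℂ) r), {x : ℂ // x ≠ 0}) := ⟨fun _ => ⟨e, he0⟩, continuous_const⟩
  have H0 : ∀ x : ↥(V ×ˢ Metric.closedBall (0 : ℂ) r), H (0, x) = (fun x : {x : ℂ // x ≠ 0} =>
      (⟨x ^ 2, pow_ne_zero 2 x.2⟩ : {x : ℂ // x ≠ 0})) (f x) := by
    intro x
    apply Subtype.ext
    change h x.1.1 (((0 : unitInterval) : ℝ) * x.1.2) = e ^ 2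
    rw [← he x.1.1 x.2.1]
    simp
  let G := cov.liftHomotopy H f H0
  have hG := cov.liftHomotopy_lifts H f H0
  have hG0 := cov.liftHomotopy_zero H f H0
  have hGs : ∀ t x, ((G (t, x) : {x : ℂ // x ≠ 0}) : ℂ) ^ 2 = h x.1.1 ((t : ℂ) * x.1.2) := by
    intro t x
    have := congrArg Subtype.val (congrFun hG (t, x))
    exact this
  refine ⟨fun a s => if hx : ((a, s) : ℂ × ℂ) ∈ V ×ˢ Metric.closedBall (0 : ℂ) r then
    ((G (1, ⟨(a, s), hx⟩) : {x : ℂ // x ≠ 0}) : ℂ) else 0, ?_, ?_, ?_⟩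
  · rw [continuousOn_iff_continuous_domRestrict]
    have h1 : Continuous (fun x : ↥(V ×ˢ Metric.closedBall (0 : ℂ) r) => ((G (1, x) : {x : ℂ // x ≠ 0}) : ℂ)) := by fun_prop
    refine h1.congr fun x => ?_
    have hx : ((x.1.1, x.1.2) : ℂ × ℂ) ∈ V ×ˢ Metric.closedBall (0 : ℂ) r := x.2
    simp only [Set.domRestrict_apply]
    rw [dif_pos hx]
  · intro a ha s hs
    have hx : ((a, s) : ℂ × ℂ) ∈ V ×ˢ Metric.closedBall (0 : ℂ) r := ⟨ha, by simpa using hs⟩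
    simp only
    rw [dif_pos hx, hGs]
    simp
  · intro a ha hr
    have hx : ((a, 0) : ℂ × ℂ) ∈ V ×ˢ Metric.closedBall (0 : ℂ) r := ⟨ha, by simpa using hr⟩
    simp only
    rw [dif_pos hx]
    -- constant along t
    have h2 : ∀ t, ((G (t, ⟨(a, 0), hx⟩) : {x : ℂ // x ≠ 0}) : ℂ) ^ 2 = e ^ 2 := by
      intro t; rw [hGs, ← he a ha]; simp
    have h3 := (isPreconnected_univ (α := unitInterval)).eq_of_sq_eq
      (f := fun t => ((G (t, ⟨(a, 0), hx⟩) : {x : ℂ // x ≠ 0}) : ℂ)) (g := fun _ => e)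
      (by apply Continuous.continuousOn; fun_prop) continuousOn_const
      (fun t _ => by simpa using h2 t) (fun _ => he0) (y := 0) (Set.mem_univ _)
      (by
        have := hG0 ⟨(a, 0), hx⟩
        have := congrArg Subtype.val this
        exact this)
    exact h3 (Set.mem_univ 1)

theorem sqrt_unique {r : ℝ} (hr : 0 ≤ r) {f g : ℂ → ℂ}
    (hf : ContinuousOn f (Metric.closedBall 0 r)) (hg : ContinuousOn g (Metric.closedBall 0 r))
    (hsq : ∀ s, ‖s‖ ≤ r → f s ^ 2 = g s ^ 2) (hg0 : ∀ s, ‖s‖ ≤ r → g s ≠ 0) (h0 : f 0 = g 0) :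
    ∀ s, ‖s‖ ≤ r → f s = g s := by
  intro s hs
  have := (convex_closedBall (0 : ℂ) r).isPreconnected.eq_of_sq_eq hf hg
    (fun x hx => hsq x (by simpa using hx)) (fun {x} hx => hg0 x (by simpa using hx)) (y := 0)
    (by simpa using hr) h0
  exact this (by simpa using hs)

theorem isOpen_forall_ne {V K : Set ℂ} (hV : IsOpen V) (hK : IsCompact K) {f : ℂ → ℂ → ℂ}
    (hf : ContinuousOn (fun x : ℂ × ℂ => f x.1 x.2) (V ×ˢ K)) :
    IsOpen {a | a ∈ V ∧ ∀ s ∈ K, f a s ≠ 0} := by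
  rw [isOpen_iff_mem_nhds]
  rintro a ⟨ha, h⟩
  have h1 : ∀ᶠ b in 𝓝 a, ∀ s ∈ K, (b ∈ V ∧ s ∈ K) → f b s ≠ 0 := by
    apply hK.eventually_forall_of_forall_eventually
    intro s hs
    have h2 := hf (a, s) ⟨ha, hs⟩
    have h3 := h2.eventually_ne (h s hs)
    rw [eventually_nhdsWithin_iff] at h3
    filter_upwards [h3] with x hx hx2
    exact hx hx2
  filter_upwards [h1, hV.mem_nhds ha] with b hb hbV
  exact ⟨hbV, fun s hs => hb s hs ⟨hbV, hs⟩⟩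

structure Lev where
  V : Set ℂ
  σ : ℂ → ℂ → ℂ
  ρ : ℂ → ℂ → ℂ

structure IsLev (r : ℝ) (L : Lev) : Prop where
  isOpen : IsOpen L.V
  sub : L.V ⊆ Par
  σc : ContinuousOn (fun x : ℂ × ℂ => L.σ x.1 x.2) (L.V ×ˢ Metric.closedBall 0 r)
  ρc : ContinuousOn (fun x : ℂ × ℂ => L.ρ x.1 x.2) (L.V ×ˢ Metric.closedBall 0 (r ^ 2))
  σd : DifferentiableOn ℂ (fun x : ℂ × ℂ => L.σ x.1 x.2) (L.V ×ˢ Metric.ball 0 r)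
  ρd : DifferentiableOn ℂ (fun x : ℂ × ℂ => L.ρ x.1 x.2) (L.V ×ˢ Metric.ball 0 (r ^ 2))
  σ0 : ∀ a ∈ L.V, L.σ a 0 = 2
  ρ0 : ∀ a ∈ L.V, L.ρ a 0 = 1
  σne : ∀ a ∈ L.V, ∀ s, ‖s‖ ≤ r → L.σ a s - s ≠ 0
  σne0 : ∀ a ∈ L.V, ∀ s, ‖s‖ ≤ r → L.σ a s ≠ 0
  ρne0 : ∀ a ∈ L.V, ∀ s, ‖s‖ ≤ r ^ 2 → L.ρ a s ≠ 0
  ρsq : ∀ a ∈ L.V, ∀ S, ‖S‖ ≤ r ^ 2 → L.ρ a S ^ 2 * (L.σ a S - S) = (L.σ a S - S) + a * S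
  σsq : ∀ a ∈ L.V, ∀ s, ‖s‖ ≤ r →
    L.σ a s ^ 2 = s ^ 2 + (L.σ a (s ^ 2) - s ^ 2) * (1 + L.ρ a (s ^ 2))
  inj : ∀ a ∈ L.V, ∀ s t, ‖s‖ ≤ r → ‖t‖ ≤ r → s * L.σ a t = t * L.σ a s → s = t

structure LevRel (r : ℝ) (L L' : Lev) : Prop where
  sub : L'.V ⊆ L.V
  σeq : ∀ a ∈ L'.V, ∀ s, ‖s‖ ≤ r ^ 2 → L'.σ a s = L.σ a s
  ρeq : ∀ a ∈ L'.V, ∀ s, ‖s‖ ≤ (r ^ 2) ^ 2 → L'.ρ a s = L.ρ a s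
  dich : ∀ a ∈ L.V, a ∉ L'.V → (∃ S, ‖S‖ ≤ r ^ 2 ∧ (L.σ a S - S) + a * S = 0) ∨
    (∃ ρ' : ℂ → ℂ, ContinuousOn ρ' (Metric.closedBall 0 (r ^ 2)) ∧ ρ' 0 = 1 ∧
      (∀ S, ‖S‖ ≤ r ^ 2 → ρ' S ^ 2 * (L.σ a S - S) = (L.σ a S - S) + a * S) ∧
      ∃ S, ‖S‖ ≤ r ^ 2 ∧ S + (L.σ a S - S) * (1 + ρ' S) = 0)

theorem rho_ne_neg_one {a S σ ρ : ℂ} (ha : a ≠ 0) (h : ρ ^ 2 * (σ - S) = (σ - S) + a * S)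
    (h0 : S = 0 → ρ = 1) : 1 + ρ ≠ 0 := by
  intro h1
  have h2 : ρ = -1 := by linear_combination h1
  rw [h2] at h
  have h3 : a * S = 0 := by linear_combination -h
  rcases mul_eq_zero.1 h3 with h4 | h4
  · exact ha h4
  · rw [h0 h4] at h2; norm_num at h2

theorem lev_step {r : ℝ} (hr0 : 0 < r) (hr1 : r < 1) {L : Lev} (hL : IsLev (r ^ 2) L) :
    ∃ L', IsLev r L' ∧ LevRel r L L' := by
  have hr2 : 0 < r ^ 2 := by positivity
  have hr21 : r ^ 2 ≤ r := by nlinarith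
  have hr42 : (r ^ 2) ^ 2 ≤ r ^ 2 := by nlinarith
  have hball : Metric.closedBall (0 : ℂ) ((r ^ 2) ^ 2) ⊆ Metric.closedBall (0 : ℂ) (r ^ 2) :=
    Metric.closedBall_subset_closedBall hr42
  set V1 : Set ℂ := {a | a ∈ L.V ∧ ∀ S ∈ Metric.closedBall (0 : ℂ) (r ^ 2),
    (L.σ a S - S) + a * S ≠ 0} with hV1
  have c1 : ContinuousOn (fun x : ℂ × ℂ => (L.σ x.1 x.2 - x.2) + x.1 * x.2)
      (L.V ×ˢ Metric.closedBall 0 (r ^ 2)) :=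
    (hL.σc.sub continuousOn_snd).add (continuousOn_fst.mul continuousOn_snd)
  have hV1o : IsOpen V1 := isOpen_forall_ne hL.isOpen (isCompact_closedBall _ _)
    (f := fun a S => (L.σ a S - S) + a * S) c1
  have hV1s : V1 ⊆ L.V := fun a ha => ha.1
  have hpm : V1 ×ˢ Metric.closedBall (0 : ℂ) (r ^ 2) ⊆ L.V ×ˢ Metric.closedBall 0 (r ^ 2) :=
    Set.prod_mono hV1s le_rfl
  obtain ⟨ρ', hρc, hρsq', hρ0⟩ := exists_sqrt_lift (V := V1) (r := r ^ 2) (e := 1)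
    (h := fun a S => ((L.σ a S - S) + a * S) / (L.σ a S - S))
    ((c1.mono hpm).div ((hL.σc.sub continuousOn_snd).mono hpm)
      fun x hx => hL.σne _ (hV1s hx.1) _ (by simpa using hx.2))
    (fun a ha S hS => div_ne_zero (ha.2 S (by simpa using hS)) (hL.σne a ha.1 S hS))
    (fun a ha => by simp [hL.σ0 a ha.1]) one_ne_zero
  replace hρ0 : ∀ a ∈ V1, ρ' a 0 = 1 := fun a ha => hρ0 a ha hr2.le
  have hρsq : ∀ a ∈ V1, ∀ S, ‖S‖ ≤ r ^ 2 →
      ρ' a S ^ 2 * (L.σ a S - S) = (L.σ a S - S) + a * S := by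
    intro a ha S hS
    rw [hρsq' a ha S hS]
    exact div_mul_cancel₀ _ (hL.σne a ha.1 S hS)
  have hρne : ∀ a ∈ V1, ∀ S, ‖S‖ ≤ r ^ 2 → ρ' a S ≠ 0 := by
    intro a ha S hS h
    have := hρsq a ha S hS
    rw [h] at this
    apply ha.2 S (by simpa using hS)
    rw [← this]; ring
  have slice : ∀ {f : ℂ → ℂ → ℂ} {W : Set ℂ} {q : ℝ} {a : ℂ}, a ∈ W →
      ContinuousOn (fun x : ℂ × ℂ => f x.1 x.2) (W ×ˢ Metric.closedBall 0 q) →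
      ContinuousOn (f a) (Metric.closedBall 0 q) := by
    intro f W q a ha hf
    have : ContinuousOn (fun s : ℂ => ((a, s) : ℂ × ℂ)) (Metric.closedBall 0 q) := by fun_prop
    exact hf.comp this fun s hs => ⟨ha, hs⟩
  have hρeq : ∀ a ∈ V1, ∀ s, ‖s‖ ≤ (r ^ 2) ^ 2 → ρ' a s = L.ρ a s := by
    intro a ha
    apply sqrt_unique (by positivity) ((slice ha hρc).mono hball) (slice ha.1 hL.ρc)
    · intro s hs
      have h1 := hρsq a ha s (hs.trans hr42)
      rw [← hL.ρsq a ha.1 s hs] at h1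
      exact mul_right_cancel₀ (hL.σne a ha.1 s (hs.trans hr42)) h1
    · exact hL.ρne0 a ha.1
    · rw [hρ0 a ha, hL.ρ0 a ha.1]
  set V2 : Set ℂ := {a | a ∈ V1 ∧ ∀ S ∈ Metric.closedBall (0 : ℂ) (r ^ 2),
    S + (L.σ a S - S) * (1 + ρ' a S) ≠ 0} with hV2
  have c2 : ContinuousOn (fun x : ℂ × ℂ => x.2 + (L.σ x.1 x.2 - x.2) * (1 + ρ' x.1 x.2))
      (V1 ×ˢ Metric.closedBall 0 (r ^ 2)) :=
    continuousOn_snd.add (((hL.σc.mono hpm).sub continuousOn_snd).mul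
      (continuousOn_const.add hρc))
  have hV2o : IsOpen V2 := isOpen_forall_ne hV1o (isCompact_closedBall _ _)
    (f := fun a S => S + (L.σ a S - S) * (1 + ρ' a S)) c2
  have hV2s : V2 ⊆ V1 := fun a ha => ha.1
  have hsqn : ∀ {s : ℂ}, ‖s‖ ≤ r → ‖s ^ 2‖ ≤ r ^ 2 := by
    intro s hs; rw [norm_pow]; gcongr
  obtain ⟨σ', hσc, hσsq', hσ0⟩ := exists_sqrt_lift (V := V2) (r := r) (e := 2)
    (h := fun a s => s ^ 2 + (L.σ a (s ^ 2) - s ^ 2) * (1 + ρ' a (s ^ 2)))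
    (by
      have c3 : ContinuousOn (fun x : ℂ × ℂ => ((x.1, x.2 ^ 2) : ℂ × ℂ))
        (V2 ×ˢ Metric.closedBall 0 r) := by fun_prop
      exact c2.comp c3 fun x hx => ⟨hV2s hx.1, by
        have h3 : ‖x.2‖ ≤ r := by simpa using hx.2
        exact mem_closedBall_zero_iff.2 (hsqn h3)⟩)
    (fun a ha s hs => ha.2 (s ^ 2) (mem_closedBall_zero_iff.2 (hsqn hs)))
    (fun a ha => by simp [hL.σ0 a ha.1.1, hρ0 a ha.1]; norm_num) two_ne_zero
  replace hσ0 : ∀ a ∈ V2, σ' a 0 = 2 := fun a ha => hσ0 a ha hr0.le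
  have hσne0 : ∀ a ∈ V2, ∀ s, ‖s‖ ≤ r → σ' a s ≠ 0 := by
    intro a ha s hs h
    have := hσsq' a ha s hs
    rw [h] at this
    apply ha.2 (s ^ 2) (mem_closedBall_zero_iff.2 (hsqn hs))
    rw [← this]; ring
  have hσeq : ∀ a ∈ V2, ∀ s, ‖s‖ ≤ r ^ 2 → σ' a s = L.σ a s := by
    intro a ha
    apply sqrt_unique hr2.le
      ((slice ha hσc).mono (Metric.closedBall_subset_closedBall hr21)) (slice ha.1.1 hL.σc)
    · intro s hs
      have h4 : ‖s ^ 2‖ ≤ (r ^ 2) ^ 2 := by rw [norm_pow]; gcongr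
      rw [hσsq' a ha s (hs.trans hr21), hL.σsq a ha.1.1 s hs, hρeq a ha.1 (s ^ 2) h4]
    · exact hL.σne0 a ha.1.1
    · rw [hσ0 a ha, hL.σ0 a ha.1.1]
  have hσeven : ∀ a ∈ V2, ∀ s, ‖s‖ ≤ r → σ' a (-s) = σ' a s := by
    intro a ha
    apply sqrt_unique hr0.le (f := fun s => σ' a (-s)) _ (slice ha hσc)
    · intro s hs
      rw [hσsq' a ha s hs, hσsq' a ha (-s) (by simpa using hs)]
      simp
    · exact hσne0 a ha
    · simp
    · have : ContinuousOn (fun s : ℂ => -s) (Metric.closedBall 0 r) := by fun_prop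
      exact (slice ha hσc).comp this fun s hs => by simpa using hs
  have h1ρ : ∀ a ∈ V1, ∀ S, ‖S‖ ≤ r ^ 2 → 1 + ρ' a S ≠ 0 := fun a ha S hS =>
    rho_ne_neg_one (hL.sub ha.1).1 (hρsq a ha S hS) (by rintro rfl; exact hρ0 a ha)
  have hσne : ∀ a ∈ V2, ∀ s, ‖s‖ ≤ r → σ' a s - s ≠ 0 := by
    intro a ha s hs h
    have h1 := hσsq' a ha s hs
    rw [sub_eq_zero.1 h] at h1
    have h2 : (L.σ a (s ^ 2) - s ^ 2) * (1 + ρ' a (s ^ 2)) = 0 := by linear_combination -h1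
    rcases mul_eq_zero.1 h2 with h3 | h3
    · exact hL.σne a ha.1.1 _ (hsqn hs) h3
    · exact h1ρ a ha.1 _ (hsqn hs) h3
  have hinj : ∀ a ∈ V2, ∀ s t, ‖s‖ ≤ r → ‖t‖ ≤ r → s * σ' a t = t * σ' a s → s = t := by
    intro a ha s t hs ht hst
    have ha0 : a ≠ 0 := (hL.sub ha.1.1).1
    have hS := hsqn hs
    have hT := hsqn ht
    have e1 := hσsq' a ha s hs
    have e2 := hσsq' a ha t ht
    have f1 := hρsq a ha.1 _ hS
    have f2 := hρsq a ha.1 _ hT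
    have n1 := hL.σne a ha.1.1 _ hS
    have n2 := hL.σne a ha.1.1 _ hT
    have m1 := h1ρ a ha.1 _ hS
    have m2 := h1ρ a ha.1 _ hT
    have key := hL.inj a ha.1.1 (s ^ 2) (t ^ 2) hS hT
    set S := s ^ 2 with hSdef
    set T := t ^ 2 with hTdef
    have g1 : S * ((L.σ a T - T) * (1 + ρ' a T)) = T * ((L.σ a S - S) * (1 + ρ' a S)) := by
      have : S * σ' a t ^ 2 = T * σ' a s ^ 2 := by
        rw [hSdef, hTdef, ← mul_pow, ← mul_pow, hst]
      rw [e1, e2] at this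
      linear_combination this
    have g2 : (ρ' a S - 1) * ((1 + ρ' a S) * (L.σ a S - S)) = a * S := by linear_combination f1
    have g3 : (ρ' a T - 1) * ((1 + ρ' a T) * (L.σ a T - T)) = a * T := by linear_combination f2
    have g4 : ρ' a S = ρ' a T := by
      have hA : (1 + ρ' a S) * (L.σ a S - S) ≠ 0 := mul_ne_zero m1 n1
      have hB : (1 + ρ' a T) * (L.σ a T - T) ≠ 0 := mul_ne_zero m2 n2
      have : (ρ' a S - ρ' a T) * (((1 + ρ' a S) * (L.σ a S - S)) *
          ((1 + ρ' a T) * (L.σ a T - T))) = 0 := by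
        linear_combination ((1 + ρ' a T) * (L.σ a T - T)) * g2
          - ((1 + ρ' a S) * (L.σ a S - S)) * g3 + a * g1
      rcases mul_eq_zero.1 this with h | h
      · exact sub_eq_zero.1 h
      · exact absurd h (mul_ne_zero hA hB)
    have g5 : S * L.σ a T = T * L.σ a S := by
      rw [g4] at g1
      have : (1 + ρ' a T) * (S * (L.σ a T - T)) = (1 + ρ' a T) * (T * (L.σ a S - S)) := by
        linear_combination g1
      have := mul_left_cancel₀ m2 this
      linear_combination this
    have g6 : s ^ 2 = t ^ 2 := key g5
    rcases sq_eq_sq_iff_eq_or_eq_neg.1 g6 with h | h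
    · exact h
    · rw [h, hσeven a ha t ht] at hst
      have h7 : t * σ' a t = 0 := by linear_combination -hst / 2
      rcases mul_eq_zero.1 h7 with h8 | h8
      · rw [h, h8]; simp
      · exact absurd h8 (hσne0 a ha t ht)
  have hρd : ∀ a ∈ V1, ∀ S, ‖S‖ < r ^ 2 →
      DifferentiableAt ℂ (fun x : ℂ × ℂ => ρ' x.1 x.2) (a, S) := by
    intro a ha S hS
    have hop : V1 ×ˢ Metric.ball (0 : ℂ) (r ^ 2) ∈ 𝓝 (a, S) :=
      (hV1o.prod Metric.isOpen_ball).mem_nhds ⟨ha, by simpa using hS⟩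
    have hmemc : V1 ×ˢ Metric.closedBall (0 : ℂ) (r ^ 2) ∈ 𝓝 (a, S) :=
      mem_of_superset hop (Set.prod_mono le_rfl Metric.ball_subset_closedBall)
    have hσd : DifferentiableAt ℂ (fun x : ℂ × ℂ => L.σ x.1 x.2) (a, S) :=
      hL.σd.differentiableAt (mem_of_superset hop (Set.prod_mono hV1s le_rfl))
    apply differentiableAt_of_sq (hρc.continuousAt hmemc) (hρne a ha S hS.le)
      (h := fun x => ((L.σ x.1 x.2 - x.2) + x.1 * x.2) / (L.σ x.1 x.2 - x.2))
    · exact diffAt_div ((hσd.sub differentiableAt_snd).add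
        (differentiableAt_fst.mul differentiableAt_snd)) (hσd.sub differentiableAt_snd)
        (hL.σne a ha.1 S hS.le)
    · filter_upwards [hmemc] with x hx
      exact hρsq' x.1 hx.1 x.2 (by simpa using hx.2)
  refine ⟨⟨V2, σ', ρ'⟩, ⟨hV2o, fun a ha => hL.sub ha.1.1, hσc,
    hρc.mono (Set.prod_mono hV2s le_rfl), ?_, ?_, hσ0, fun a ha => hρ0 a ha.1, hσne, hσne0,
    fun a ha => hρne a ha.1, ?_, ?_, hinj⟩, ⟨fun a ha => ha.1.1, hσeq, fun a ha => hρeq a ha.1, ?_⟩⟩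
  · rintro ⟨a, s⟩ ⟨ha, hs⟩
    have hs' : ‖s‖ < r := by simpa using hs
    apply DifferentiableAt.differentiableWithinAt
    have hmemc : V2 ×ˢ Metric.closedBall (0 : ℂ) r ∈ 𝓝 (a, s) :=
      mem_of_superset ((hV2o.prod Metric.isOpen_ball).mem_nhds ⟨ha, hs⟩)
        (Set.prod_mono le_rfl Metric.ball_subset_closedBall)
    have hs2 : ‖s ^ 2‖ < r ^ 2 := by rw [norm_pow]; gcongr
    have hq : DifferentiableAt ℂ (fun x : ℂ × ℂ => ((x.1, x.2 ^ 2) : ℂ × ℂ)) (a, s) := by fun_prop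
    have hq2 : DifferentiableAt ℂ (fun x : ℂ × ℂ => x.2 ^ 2) (a, s) := by fun_prop
    have hσd : DifferentiableAt ℂ (fun x : ℂ × ℂ => L.σ x.1 x.2) (a, s ^ 2) :=
      hL.σd.differentiableAt ((hL.isOpen.prod Metric.isOpen_ball).mem_nhds
        ⟨ha.1.1, by simpa using hs2⟩)
    have hσd2 : DifferentiableAt ℂ (fun x : ℂ × ℂ => L.σ x.1 (x.2 ^ 2)) (a, s) :=
      DifferentiableAt.comp (a, s) (g := fun x : ℂ × ℂ => L.σ x.1 x.2) hσd hq
    have hρd2 : DifferentiableAt ℂ (fun x : ℂ × ℂ => ρ' x.1 (x.2 ^ 2)) (a, s) :=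
      DifferentiableAt.comp (a, s) (g := fun x : ℂ × ℂ => ρ' x.1 x.2) (hρd a ha.1 _ hs2) hq
    apply differentiableAt_of_sq (hσc.continuousAt hmemc) (hσne0 a ha s hs'.le)
      (h := fun x => x.2 ^ 2 + (L.σ x.1 (x.2 ^ 2) - x.2 ^ 2) * (1 + ρ' x.1 (x.2 ^ 2)))
    · exact hq2.add ((hσd2.sub hq2).mul (hρd2.const_add 1))
    · filter_upwards [hmemc] with x hx
      exact hσsq' x.1 hx.1 x.2 (by simpa using hx.2)
  · rintro ⟨a, s⟩ ⟨ha, hs⟩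
    exact (hρd a ha.1 s (by simpa using hs)).differentiableWithinAt
  · intro a ha S hS
    simp only
    rw [hσeq a ha S hS]
    exact hρsq a ha.1 S hS
  · intro a ha s hs
    simp only
    rw [hσeq a ha _ (hsqn hs)]
    exact hσsq' a ha s hs
  · intro a ha hna
    by_cases h1 : a ∈ V1
    · right
      refine ⟨ρ' a, slice h1 hρc, hρ0 a h1, hρsq a h1, ?_⟩
      by_contra hcon
      push Not at hcon
      exact hna ⟨h1, fun S hS => hcon S (by simpa using hS)⟩
    · left
      by_contra hcon
      push Not at hcon
      exact h1 ⟨ha, fun S hS => hcon S (by simpa using hS)⟩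

theorem lev_zero : IsLev (1 / 200) ⟨Par, sig0, rho0⟩ := by
  have hs1 : ∀ s : ℂ, ‖s‖ ≤ 1 / 200 → ‖s‖ < 1 / 100 := fun s hs => by linarith
  have hs2 : ∀ s : ℂ, ‖s‖ ≤ (1 / 200) ^ 2 → ‖s‖ ≤ 1 / 10000 := fun s hs => by
    norm_num at hs ⊢; linarith
  have hd : ∀ x : ℂ × ℂ, x ∈ Par ×ˢ Metric.closedBall (0 : ℂ) (1 / 200) →
      DifferentiableAt ℂ (fun x : ℂ × ℂ => sig0 x.1 x.2) x := fun x hx =>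
    sig0_diff.differentiableAt (isOpen_Dom0.mem_nhds ⟨hx.1.2, hs1 _ (by simpa using hx.2)⟩)
  have hd2 : ∀ x : ℂ × ℂ, x ∈ Par ×ˢ Metric.closedBall (0 : ℂ) ((1 / 200) ^ 2) →
      DifferentiableAt ℂ (fun x : ℂ × ℂ => rho0 x.1 x.2) x := fun x hx =>
    rho0_diff hx.1.2 (hs2 _ (by simpa using hx.2))
  refine ⟨isOpen_Par, le_rfl, fun x hx => (hd x hx).continuousAt.continuousWithinAt,
    fun x hx => (hd2 x hx).continuousAt.continuousWithinAt,
    fun x hx => (hd x ⟨hx.1, Metric.ball_subset_closedBall hx.2⟩).differentiableWithinAt,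
    fun x hx => (hd2 x ⟨hx.1, Metric.ball_subset_closedBall hx.2⟩).differentiableWithinAt,
    fun a ha => sig0_zero ha.2, fun a _ => rho0_zero, ?_, ?_, ?_, ?_, ?_, ?_⟩
  · intro a ha s hs h
    have h1 := (sig0_norm ha.2 (hs1 s hs).le).1
    have h2 := sub_eq_zero.1 h
    simp only at h2
    rw [h2] at h1; linarith
  · intro a ha s hs h
    have h1 := (sig0_norm ha.2 (hs1 s hs).le).1
    simp only at h
    rw [h] at h1; norm_num at h1
  · intro a ha s hs h
    have h1 := rho0_near ha.2 (hs2 s hs)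
    simp only at h
    rw [h] at h1; norm_num at h1
  · intro a ha S hS
    exact rho0_sq ha.2 (hs2 S hS)
  · intro a ha s hs
    exact sig0_sq ha.2 (hs1 s hs).le
  · intro a ha s t hs ht h
    exact sig0_inj ha.2 hs ht h

noncomputable def rr : ℕ → ℝ
  | 0 => 1 / 200
  | m + 1 => √(rr m)

theorem rr_bounds (m : ℕ) : 0 < rr m ∧ rr m < 1 := by
  induction m with
  | zero => norm_num [rr]
  | succ m ih =>
    exact ⟨Real.sqrt_pos.2 ih.1, by rw [rr, Real.sqrt_lt' one_pos]; simpa using ih.2⟩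

theorem rr_sq (m : ℕ) : rr (m + 1) ^ 2 = rr m := Real.sq_sqrt (rr_bounds m).1.le

noncomputable def levS : (m : ℕ) → {L : Lev // IsLev (rr m) L}
  | 0 => ⟨⟨Par, sig0, rho0⟩, lev_zero⟩
  | m + 1 =>
    ⟨(lev_step (rr_bounds (m + 1)).1 (rr_bounds (m + 1)).2
        (L := (levS m).1) (by rw [rr_sq]; exact (levS m).2)).choose,
      (lev_step (rr_bounds (m + 1)).1 (rr_bounds (m + 1)).2
        (L := (levS m).1) (by rw [rr_sq]; exact (levS m).2)).choose_spec.1⟩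

noncomputable def lev (m : ℕ) : Lev := (levS m).1
theorem lev_isLev (m : ℕ) : IsLev (rr m) (lev m) := (levS m).2
theorem lev_rel (m : ℕ) : LevRel (rr (m + 1)) (lev m) (lev (m + 1)) :=
  (lev_step (rr_bounds (m + 1)).1 (rr_bounds (m + 1)).2
        (L := (levS m).1) (by rw [rr_sq]; exact (levS m).2)).choose_spec.2

end

section
open Filter Topology OnePoint

abbrev VV (m : ℕ) : Set ℂ := (lev m).V
def TT : Set ℂ := {a | ∀ m, a ∈ VV m}

theorem VV_anti : Antitone VV := antitone_nat_of_succ_le fun m => (lev_rel m).sub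

theorem VV_zero : VV 0 = Par := rfl

theorem rr_mono : Monotone rr := monotone_nat_of_le_succ fun m => by
  have h := rr_sq m
  have := rr_bounds (m + 1)
  nlinarith

theorem lev_sig_eq {k m : ℕ} (hkm : k ≤ m) {a s : ℂ} (ha : a ∈ VV m) (hs : ‖s‖ ≤ rr k) :
    (lev m).σ a s = (lev k).σ a s := by
  induction m, hkm using Nat.le_induction with
  | base => rfl
  | succ m hkm ih =>
    rw [← ih (VV_anti (Nat.le_succ m) ha)]
    exact (lev_rel m).σeq a ha s (by rw [rr_sq]; exact hs.trans (rr_mono hkm))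

theorem lev_rho_eq {k m : ℕ} (hkm : k ≤ m) {a s : ℂ} (ha : a ∈ VV m) (hs : ‖s‖ ≤ rr k ^ 2) :
    (lev m).ρ a s = (lev k).ρ a s := by
  induction m, hkm using Nat.le_induction with
  | base => rfl
  | succ m hkm ih =>
    rw [← ih (VV_anti (Nat.le_succ m) ha)]
    refine (lev_rel m).ρeq a ha s (by
      rw [rr_sq]
      refine hs.trans ?_
      have := rr_mono hkm
      have := (rr_bounds k).1
      gcongr)

open Classical in
noncomputable def sig (a s : ℂ) : ℂ :=
  if h : ∃ m, ‖s‖ ≤ rr m then (lev (Nat.find h)).σ a s else 0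

open Classical in
noncomputable def rho (a s : ℂ) : ℂ :=
  if h : ∃ m, ‖s‖ ≤ rr m ^ 2 then (lev (Nat.find h)).ρ a s else 0

theorem sig_eq {m : ℕ} {a s : ℂ} (ha : a ∈ VV m) (hs : ‖s‖ ≤ rr m) :
    sig a s = (lev m).σ a s := by
  classical
  have h : ∃ m, ‖s‖ ≤ rr m := ⟨m, hs⟩
  rw [sig, dif_pos h]
  exact (lev_sig_eq (Nat.find_min' h hs) ha (Nat.find_spec h)).symm

theorem rho_eq {m : ℕ} {a s : ℂ} (ha : a ∈ VV m) (hs : ‖s‖ ≤ rr m ^ 2) :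
    rho a s = (lev m).ρ a s := by
  classical
  have h : ∃ m, ‖s‖ ≤ rr m ^ 2 := ⟨m, hs⟩
  rw [rho, dif_pos h]
  exact (lev_rho_eq (Nat.find_min' h hs) ha (Nat.find_spec h)).symm

theorem rr_sq_le (m : ℕ) : rr m ^ 2 ≤ rr m := by
  have := rr_bounds m; nlinarith

theorem glev (m : ℕ) : IsLev (rr m) ⟨VV m, sig, rho⟩ := by
  have h := lev_isLev m
  have n1 : ∀ {s : ℂ}, ‖s‖ ≤ rr m ^ 2 → ‖s‖ ≤ rr m := fun hs => hs.trans (rr_sq_le m)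
  have n2 : ∀ {s : ℂ}, ‖s‖ ≤ rr m → ‖s ^ 2‖ ≤ rr m ^ 2 := fun hs => by rw [norm_pow]; gcongr
  refine ⟨h.isOpen, h.sub, ?_, ?_, ?_, ?_, ?_, ?_, ?_, ?_, ?_, ?_, ?_, ?_⟩
  · exact h.σc.congr fun x hx => sig_eq hx.1 (by simpa using hx.2)
  · exact h.ρc.congr fun x hx => rho_eq hx.1 (by simpa using hx.2)
  · exact h.σd.congr fun x hx => sig_eq hx.1 (le_of_lt (by simpa using hx.2))
  · exact h.ρd.congr fun x hx => rho_eq hx.1 (le_of_lt (by simpa using hx.2))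
  · intro a ha; simp only; rw [sig_eq ha (by simpa using (rr_bounds m).1.le)]; exact h.σ0 a ha
  · intro a ha; simp only
    rw [rho_eq ha (by simpa using pow_nonneg (rr_bounds m).1.le 2)]; exact h.ρ0 a ha
  · intro a ha s hs; simp only; rw [sig_eq ha hs]; exact h.σne a ha s hs
  · intro a ha s hs; simp only; rw [sig_eq ha hs]; exact h.σne0 a ha s hs
  · intro a ha s hs; simp only; rw [rho_eq ha hs]; exact h.ρne0 a ha s hs
  · intro a ha s hs; simp only; rw [rho_eq ha hs, sig_eq ha (n1 hs)]; exact h.ρsq a ha s hs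
  · intro a ha s hs; simp only
    rw [sig_eq ha hs, rho_eq ha (n2 hs), sig_eq ha (n1 (n2 hs))]; exact h.σsq a ha s hs
  · intro a ha s t hs ht; simp only; rw [sig_eq ha hs, sig_eq ha ht]; exact h.inj a ha s t hs ht

/-- local coordinate at infinity of the inverse Boettcher map -/
noncomputable def ph (a s : ℂ) : ℂ := s / (sig a s - s)
noncomputable def psi (a s : ℂ) : RSphere := toS (ph a s)
noncomputable def bb (a s : ℂ) : ℂ := rho a s - 1

theorem VV_Par {m : ℕ} {a : ℂ} (ha : a ∈ VV m) : a ∈ Par := (glev m).sub ha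
theorem VV_ne {m : ℕ} {a : ℂ} (ha : a ∈ VV m) : a ≠ 0 := (VV_Par ha).1
theorem isOpen_VV (m : ℕ) : IsOpen (VV m) := (glev m).isOpen

theorem one_add_rho_ne {m : ℕ} {a s : ℂ} (ha : a ∈ VV m) (hs : ‖s‖ ≤ rr m ^ 2) :
    1 + rho a s ≠ 0 :=
  rho_ne_neg_one (VV_ne ha) ((glev m).ρsq a ha s hs) (by rintro rfl; exact (glev m).ρ0 a ha)

theorem ph_zero (a : ℂ) : ph a 0 = 0 := by simp [ph]
theorem psi_zero (a : ℂ) : psi a 0 = ∞ := by rw [psi, ph_zero, toS_zero]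
theorem bb_zero {m : ℕ} {a : ℂ} (ha : a ∈ VV m) : bb a 0 = 0 := by
  rw [bb]; have := (glev m).ρ0 a ha; simp only at this; rw [this]; ring

theorem bb_formula {m : ℕ} {a s : ℂ} (ha : a ∈ VV m) (hs : ‖s‖ ≤ rr m ^ 2) :
    bb a s * ((sig a s - s) * (1 + rho a s)) = a * s := by
  have := (glev m).ρsq a ha s hs
  simp only at this
  rw [bb]; linear_combination this

theorem sq_norm_le {m : ℕ} {s : ℂ} (hs : ‖s‖ ≤ rr m) : ‖s ^ 2‖ ≤ rr m ^ 2 := by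
  rw [norm_pow]; gcongr

theorem sig_add_ne {m : ℕ} {a s : ℂ} (ha : a ∈ VV m) (hs : ‖s‖ ≤ rr m) : sig a s + s ≠ 0 := by
  have h1 := (glev m).σsq a ha s hs
  have h2 := one_add_rho_ne ha (sq_norm_le hs)
  have h3 := (glev m).σne a ha (s ^ 2) ((sq_norm_le hs).trans (rr_sq_le m))
  simp only at h1 h3
  intro h
  have : (sig a (s ^ 2) - s ^ 2) * (1 + rho a (s ^ 2)) = 0 := by
    linear_combination -h1 + (sig a s - s) * h
  exact mul_ne_zero h3 h2 this

theorem Rhat_psi {m : ℕ} {a s : ℂ} (ha : a ∈ VV m) (hs : ‖s‖ ≤ rr m) :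
    Rhat a (psi a s) = ((bb a (s ^ 2) : ℂ) : RSphere) := by
  have h0 := (glev m).σne a ha s hs
  have h1 := sig_add_ne ha hs
  have h2 := bb_formula ha (sq_norm_le hs)
  have h3 := (glev m).σsq a ha s hs
  simp only at h0 h3
  have h4 : 1 + 2 * ph a s = (sig a s + s) / (sig a s - s) := by
    rw [ph]; field_simp; ring
  rw [psi, Rhat_toS (by rw [h4]; exact div_ne_zero h1 h0), h4]
  congr 1
  rw [ph]
  have h5 : (sig a (s ^ 2) - s ^ 2) * (1 + rho a (s ^ 2)) = (sig a s - s) * (sig a s + s) := by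
    linear_combination -h3
  rw [h5] at h2
  field_simp
  linear_combination -h2

theorem Rhat_bb {m : ℕ} {a s : ℂ} (ha : a ∈ VV m) (hs : ‖s‖ ≤ rr m ^ 2) :
    Rhat a ((bb a s : ℂ) : RSphere) = psi a s := by
  have h0 := (glev m).σne a ha s (hs.trans (rr_sq_le m))
  have h2 := bb_formula ha hs
  have ha0 := VV_ne ha
  simp only at h0
  rw [Rhat_coe ha0, psi, ph]
  congr 1
  field_simp
  rw [bb] at *
  linear_combination h2

theorem pow_norm_le {m : ℕ} {s : ℂ} (hs : ‖s‖ ≤ rr m) (l : ℕ) : ‖s ^ (2 ^ l)‖ ≤ rr m := by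
  rw [norm_pow]
  have : ‖s‖ ≤ 1 := hs.trans (rr_bounds m).2.le
  exact (pow_le_of_le_one (norm_nonneg _) this (by positivity)).trans hs

theorem iter_psi {m : ℕ} {a s : ℂ} (ha : a ∈ VV m) (hs : ‖s‖ ≤ rr m) (l : ℕ) :
    (Rhat a)^[2 * l] (psi a s) = psi a (s ^ (2 ^ l)) := by
  induction l with
  | zero => simp
  | succ l ih =>
    have e : 2 * (l + 1) = 1 + (1 + 2 * l) := by ring
    rw [e, Function.iterate_add_apply, Function.iterate_add_apply _ 1, ih]
    simp only [Function.iterate_one]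
    rw [Rhat_psi ha (pow_norm_le hs l), Rhat_bb ha (sq_norm_le (pow_norm_le hs l)), ← pow_mul,
      pow_succ]

theorem iter_psi_odd {m : ℕ} {a s : ℂ} (ha : a ∈ VV m) (hs : ‖s‖ ≤ rr m) (l : ℕ) :
    (Rhat a)^[2 * l + 1] (psi a s) = ((bb a (s ^ (2 ^ (l + 1))) : ℂ) : RSphere) := by
  rw [add_comm, Function.iterate_add_apply, iter_psi ha hs, Function.iterate_one,
    Rhat_psi ha (pow_norm_le hs l), ← pow_mul, pow_succ]

theorem psi_inj {m : ℕ} {a s t : ℂ} (ha : a ∈ VV m) (hs : ‖s‖ ≤ rr m) (ht : ‖t‖ ≤ rr m)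
    (h : psi a s = psi a t) : s = t := by
  have h1 := toS_inj h
  have hs0 := (glev m).σne a ha s hs
  have ht0 := (glev m).σne a ha t ht
  simp only at hs0 ht0
  rw [ph, ph, div_eq_div_iff hs0 ht0] at h1
  exact (glev m).inj a ha s t hs ht (by simp only; linear_combination h1)

theorem bb_inj {m : ℕ} {a s t : ℂ} (ha : a ∈ VV m) (hs : ‖s‖ ≤ rr m ^ 2) (ht : ‖t‖ ≤ rr m ^ 2)
    (h : bb a s = bb a t) : s = t := by
  apply psi_inj ha (hs.trans (rr_sq_le m)) (ht.trans (rr_sq_le m))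
  rw [← Rhat_bb ha hs, ← Rhat_bb ha ht, h]

theorem ph_contOn (m : ℕ) : ContinuousOn (fun x : ℂ × ℂ => ph x.1 x.2)
    (VV m ×ˢ Metric.closedBall 0 (rr m)) :=
  continuousOn_snd.div ((glev m).σc.sub continuousOn_snd)
    fun x hx => (glev m).σne x.1 hx.1 x.2 (by simpa using hx.2)

theorem psi_contOn (m : ℕ) : ContinuousOn (fun x : ℂ × ℂ => psi x.1 x.2)
    (VV m ×ˢ Metric.closedBall 0 (rr m)) :=
  continuous_toS.comp_continuousOn (ph_contOn m)

theorem psi_contOn' {m : ℕ} {a : ℂ} (ha : a ∈ VV m) :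
    ContinuousOn (psi a) (Metric.closedBall 0 (rr m)) := by
  have : ContinuousOn (fun s : ℂ => ((a, s) : ℂ × ℂ)) (Metric.closedBall 0 (rr m)) := by fun_prop
  exact (psi_contOn m).comp this fun s hs => ⟨ha, hs⟩

theorem ph_diff {m : ℕ} {a s : ℂ} (ha : a ∈ VV m) (hs : ‖s‖ < rr m) :
    DifferentiableAt ℂ (fun x : ℂ × ℂ => ph x.1 x.2) (a, s) := by
  have : DifferentiableAt ℂ (fun x : ℂ × ℂ => sig x.1 x.2) (a, s) :=
    (glev m).σd.differentiableAt (((isOpen_VV m).prod Metric.isOpen_ball).mem_nhds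
      ⟨ha, by simpa using hs⟩)
  exact diffAt_div differentiableAt_snd (this.sub differentiableAt_snd)
    ((glev m).σne a ha s hs.le)

theorem bb_diff {m : ℕ} {a s : ℂ} (ha : a ∈ VV m) (hs : ‖s‖ < rr m ^ 2) :
    DifferentiableAt ℂ (fun x : ℂ × ℂ => bb x.1 x.2) (a, s) := by
  have : DifferentiableAt ℂ (fun x : ℂ × ℂ => rho x.1 x.2) (a, s) :=
    (glev m).ρd.differentiableAt (((isOpen_VV m).prod Metric.isOpen_ball).mem_nhds
      ⟨ha, by simpa using hs⟩)
  exact this.sub_const 1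

theorem ph_diff' {m : ℕ} {a s : ℂ} (ha : a ∈ VV m) (hs : ‖s‖ < rr m) :
    DifferentiableAt ℂ (ph a) s := by
  have h : DifferentiableAt ℂ (fun s : ℂ => ((a, s) : ℂ × ℂ)) s := by fun_prop
  exact DifferentiableAt.comp s (g := fun x : ℂ × ℂ => ph x.1 x.2) (ph_diff ha hs) h

theorem tendsto_pow_pow {s : ℂ} (hs : ‖s‖ < 1) : Tendsto (fun n => s ^ (2 ^ n)) atTop (𝓝 0) :=
  (tendsto_pow_atTop_nhds_zero_of_norm_lt_one hs).comp
    (tendsto_pow_atTop_atTop_of_one_lt (by norm_num))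

theorem psi_tendsto {m : ℕ} {a s : ℂ} (ha : a ∈ VV m) (hs : ‖s‖ ≤ rr m) :
    Tendsto (fun n => (Rhat a)^[2 * n] (psi a s)) atTop (𝓝 ∞) := by
  have h1 : ContinuousAt (psi a) 0 :=
    (psi_contOn' ha).continuousAt (Metric.closedBall_mem_nhds _ (rr_bounds m).1)
  have h2 := h1.tendsto.comp (tendsto_pow_pow (hs.trans_lt (rr_bounds m).2))
  rw [psi_zero] at h2
  refine h2.congr fun n => ?_
  rw [iter_psi ha hs]; rfl

theorem psi_mem_Ainf {m : ℕ} {a s : ℂ} (ha : a ∈ VV m) (hs : ‖s‖ ≤ rr m) :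
    psi a s ∈ Ainf a := by
  have hc : IsPreconnected (psi a '' Metric.closedBall 0 (rr m)) :=
    (convex_closedBall (0 : ℂ) _).isPreconnected.image _ (psi_contOn' ha)
  refine subset_Ainf hc ?_ (x := ∞) ⟨0, by simpa using (rr_bounds m).1.le, psi_zero a⟩
    (infty_mem_Ainf (VV_ne ha)) ⟨s, by simpa using hs, rfl⟩
  rintro _ ⟨t, ht, rfl⟩
  exact Or.inl (psi_tendsto ha (by simpa using ht))

theorem bb_ne_psi {m : ℕ} {a s t : ℂ} (ha : a ∈ VV m) (hs : ‖s‖ ≤ rr m ^ 2) (ht : ‖t‖ ≤ rr m) :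
    ((bb a s : ℂ) : RSphere) ≠ psi a t := by
  intro h
  have h1 := psi_tendsto ha ht
  rw [← h] at h1
  have h3 : Tendsto (fun n => Rhat a ((Rhat a)^[2 * n] ((bb a s : ℂ) : RSphere))) atTop
      (𝓝 (Rhat a ∞)) := ((continuous_Rhat (VV_ne ha)).tendsto _).comp h1
  have h2 : Tendsto (fun n => (Rhat a)^[2 * n] (Rhat a ((bb a s : ℂ) : RSphere))) atTop
      (𝓝 ∞) := by
    rw [Rhat_bb ha hs]
    exact psi_tendsto ha (hs.trans (rr_sq_le m))
  have h4 := tendsto_nhds_unique (h2.congr fun n => by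
    rw [← Function.iterate_succ_apply, Function.iterate_succ_apply']) h3
  rw [Rhat_infty] at h4
  exact OnePoint.infty_ne_coe _ h4

theorem small_psi {a p : ℂ} (ha : a ∈ Par) (hp : ‖p‖ ≤ 1 / 2000) :
    ∃ s, ‖s‖ < rr 0 ∧ toS p = psi a s := by
  obtain ⟨s, hs, h⟩ := sig0_surj ha.2 hp
  have hs' : ‖s‖ < rr 0 := by simpa [rr] using hs
  refine ⟨s, hs', ?_⟩
  have h0 := (glev 0).σne a (by simpa [VV_zero] using ha) s hs'.le
  simp only at h0
  have h1 : sig a s = sig0 a s := sig_eq (m := 0) (by simpa [VV_zero] using ha) hs'.le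
  rw [psi, ph]
  congr 1
  rw [eq_div_iff h0, h1]
  linear_combination -h

theorem rr_pow (l : ℕ) : rr l ^ (2 ^ l) = rr 0 := by
  induction l with
  | zero => simp
  | succ l ih => rw [pow_succ' 2 l, pow_mul, rr_sq, ih]

theorem level_lemma {l : ℕ} {s : ℂ} (h : ‖s ^ (2 ^ l)‖ ≤ rr 0) : ‖s‖ ≤ rr l := by
  rw [norm_pow, ← rr_pow l] at h
  exact le_of_pow_le_pow_left₀ (by positivity) (rr_bounds l).1.le h

theorem level_lemma_lt {l : ℕ} {s : ℂ} (h : ‖s ^ (2 ^ l)‖ < rr 0) : ‖s‖ < rr l := by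
  rw [norm_pow, ← rr_pow l] at h
  exact lt_of_pow_lt_pow_left₀ _ (rr_bounds l).1.le h

theorem exists_rr {t : ℝ} (ht0 : 0 ≤ t) (ht : t < 1) : ∃ m, t < rr m := by
  have h1 : Tendsto (fun n => t ^ (2 ^ n)) atTop (𝓝 0) :=
    (tendsto_pow_atTop_nhds_zero_of_lt_one ht0 ht).comp
      (tendsto_pow_atTop_atTop_of_one_lt (by norm_num))
  obtain ⟨m, hm⟩ := (h1.eventually_lt_const (rr_bounds 0).1).exists
  refine ⟨m, ?_⟩
  rw [← rr_pow m] at hm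
  exact lt_of_pow_lt_pow_left₀ _ (rr_bounds m).1.le hm

end

section
open Filter Topology OnePoint

theorem isPreconnected_Ainf (a : ℂ) : IsPreconnected (Ainf a) :=
  isPreconnected_connectedComponentIn

theorem Ainf_lsc {a : ℂ} (ha : a ∈ Par) {z : RSphere} (hz : z ∈ Ainf a) :
    ∀ᶠ x : ℂ × RSphere in 𝓝 (a, z), x.1 ∈ Par ∧ x.2 ∈ Ainf x.1 := by
  set G : Set RSphere := {z | ∀ᶠ x : ℂ × RSphere in 𝓝 (a, z), x.1 ∈ Par ∧ x.2 ∈ Ainf x.1} with hG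
  have hGo : IsOpen G := by
    rw [isOpen_iff_mem_nhds]
    intro w hw
    have h1 := eventually_eventually_nhds.2 hw
    have h2 : Tendsto (fun y : RSphere => (a, y)) (𝓝 w) (𝓝 (a, w)) :=
      (continuous_const.prodMk continuous_id).tendsto w
    exact h2.eventually h1
  -- connected neighbourhoods in the basin
  have hconn : ∀ w ∈ sphereBasin a, ∃ O : Set RSphere, IsOpen O ∧ IsPreconnected O ∧ w ∈ O ∧
      ∀ᶠ b in 𝓝 a, b ∈ Par ∧ O ⊆ sphereBasin b := by
    intro w hw
    have h1 := basin_eventually ha hw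
    rw [nhds_prod_eq] at h1
    obtain ⟨p, hp, q, hq, h⟩ := eventually_prod_iff.1 h1
    obtain ⟨O, hO, hOc, hwO, hOU⟩ := exists_conn_nhd w {y | q y} hq
    refine ⟨O, hO, hOc, hwO, ?_⟩
    filter_upwards [hp] with b hb
    exact ⟨(h hb (hOU hwO)).1, fun y hy => (h hb (hOU hy)).2⟩
  have key : ∀ w ∈ sphereBasin a, ∀ O : Set RSphere, IsOpen O → IsPreconnected O → w ∈ O →
      (∀ᶠ b in 𝓝 a, b ∈ Par ∧ O ⊆ sphereBasin b) → ∀ v ∈ O, (∀ᶠ b in 𝓝 a, v ∈ Ainf b) →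
      w ∈ G := by
    intro w hw O hO hOc hwO hOB v hvO hv
    have : ∀ᶠ x : ℂ × RSphere in 𝓝 a ×ˢ 𝓝 w, (x.1 ∈ Par ∧ O ⊆ sphereBasin x.1 ∧ v ∈ Ainf x.1) ∧
        x.2 ∈ O := by
      have e1 : ∀ᶠ b in 𝓝 a, b ∈ Par ∧ O ⊆ sphereBasin b ∧ v ∈ Ainf b :=
        (hOB.and hv).mono fun b hb => ⟨hb.1.1, hb.1.2, hb.2⟩
      have e2 : ∀ᶠ y in 𝓝 w, y ∈ O := hO.mem_nhds hwO
      exact e1.prod_mk e2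
    change ∀ᶠ x : ℂ × RSphere in 𝓝 (a, w), x.1 ∈ Par ∧ x.2 ∈ Ainf x.1
    rw [nhds_prod_eq]
    filter_upwards [this] with x hx
    exact ⟨hx.1.1, subset_Ainf hOc hx.1.2.1 hvO hx.1.2.2 hx.2⟩
  have hinf : (∞ : RSphere) ∈ G := by
    have hb := infty_mem_basin ha.1
    obtain ⟨O, hO, hOc, hwO, hOB⟩ := hconn _ hb
    refine key _ hb O hO hOc hwO hOB ∞ hwO ?_
    filter_upwards [hOB] with b hb
    exact infty_mem_Ainf hb.1.1
  have hsub : Ainf a ⊆ G := by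
    apply (isPreconnected_Ainf a).subset_of_closure_inter_subset hGo
      ⟨∞, infty_mem_Ainf ha.1, hinf⟩
    rintro w ⟨hwc, hwA⟩
    have hb := Ainf_subset a hwA
    obtain ⟨O, hO, hOc, hwO, hOB⟩ := hconn _ hb
    obtain ⟨v, hvO, hvG⟩ := mem_closure_iff.1 hwc O hO hwO
    refine key _ hb O hO hOc hwO hOB v hvO ?_
    have h2 : Tendsto (fun b : ℂ => (b, v)) (𝓝 a) (𝓝 (a, v)) :=
      (continuous_id.prodMk continuous_const).tendsto a
    exact (h2.eventually hvG).mono fun b hb => hb.2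
  exact hsub hz

theorem crit_Ainf_open {a : ℂ} (ha : a ∈ Par) {k : ℕ} (h : crit a k ∈ Ainf a) :
    ∀ᶠ b in 𝓝 a, crit b k ∈ Ainf b := by
  have h1 : Tendsto (fun b : ℂ => (b, crit b k)) (𝓝 a) (𝓝 (a, crit a k)) :=
    continuousAt_id.prodMk (continuousAt_crit ha.1 k)
  exact (h1.eventually (Ainf_lsc ha h)).mono fun b hb => hb.2

/-- second iterate computation with an arbitrary square root -/
theorem R2_sqrt {a s x y σ : ℂ} (ha : a ≠ 0) (hxs : x - s ^ 2 ≠ 0) (h1y : 1 + y ≠ 0)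
    (hy : y ^ 2 * (x - s ^ 2) = (x - s ^ 2) + a * s ^ 2)
    (hσ : σ ^ 2 = s ^ 2 + (x - s ^ 2) * (1 + y)) :
    σ - s ≠ 0 ∧ (Rhat a)^[2] (toS (s / (σ - s))) = toS (s ^ 2 / (x - s ^ 2)) := by
  have h5 : (σ - s) * (σ + s) = (x - s ^ 2) * (1 + y) := by linear_combination hσ
  have h6 : (σ - s) * (σ + s) ≠ 0 := by rw [h5]; exact mul_ne_zero hxs h1y
  have h0 := left_ne_zero_of_mul h6
  have h1 := right_ne_zero_of_mul h6
  refine ⟨h0, ?_⟩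
  have h4 : 1 + 2 * (s / (σ - s)) = (σ + s) / (σ - s) := by field_simp; ring
  have e1 : Rhat a (toS (s / (σ - s))) = ((y - 1 : ℂ) : RSphere) := by
    rw [Rhat_toS (by rw [h4]; exact div_ne_zero h1 h0), h4]
    congr 1
    have h7 : (y - 1) * ((σ - s) * (σ + s)) = a * s ^ 2 := by rw [h5]; linear_combination hy
    field_simp
    linear_combination -h7
  change Rhat a (Rhat a _) = _
  rw [e1, Rhat_coe ha]
  congr 1
  field_simp
  linear_combination hy

theorem neg_one_mem_Ainf {m : ℕ} {a : ℂ} (ha : a ∈ VV m) {ρ' : ℂ → ℂ}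
    (hρc : ContinuousOn ρ' (Metric.closedBall 0 (rr m))) (hρ0 : ρ' 0 = 1)
    (hρsq : ∀ S, ‖S‖ ≤ rr m → ρ' S ^ 2 * (sig a S - S) = (sig a S - S) + a * S)
    {S0 : ℂ} (hS0 : ‖S0‖ ≤ rr m) (hQ : S0 + (sig a S0 - S0) * (1 + ρ' S0) = 0) :
    ((-1 : ℂ) : RSphere) ∈ Ainf a := by
  obtain ⟨s0, hs0⟩ : ∃ s0, s0 ^ 2 = S0 := ⟨csq S0, csq_sq S0⟩
  have ha0 := VV_ne ha
  have hσ0 : sig a 0 = 2 := (glev m).σ0 a ha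
  -- the function along the ray
  set q : ℝ → ℂ := fun τ => (τ * s0) ^ 2 +
    (sig a ((τ * s0) ^ 2) - (τ * s0) ^ 2) * (1 + ρ' ((τ * s0) ^ 2)) with hq
  have hn : ∀ τ ∈ Set.Icc (0 : ℝ) 1, ‖((τ : ℂ) * s0) ^ 2‖ ≤ rr m := by
    intro τ hτ
    rw [mul_pow, hs0, norm_mul, norm_pow, Complex.norm_real, Real.norm_of_nonneg hτ.1]
    have : τ ^ 2 ≤ 1 := pow_le_one₀ hτ.1 hτ.2
    exact (mul_le_of_le_one_left (norm_nonneg _) this).trans hS0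
  have hpath : ContinuousOn (fun τ : ℝ => ((τ : ℂ) * s0) ^ 2) (Set.Icc 0 1) := by fun_prop
  have hσcont : ContinuousOn (fun s => sig a s) (Metric.closedBall 0 (rr m)) := by
    have : ContinuousOn (fun s : ℂ => ((a, s) : ℂ × ℂ)) (Metric.closedBall 0 (rr m)) := by fun_prop
    exact (glev m).σc.comp this fun s hs => ⟨ha, hs⟩
  have hqc : ContinuousOn q (Set.Icc 0 1) := by
    have hm : Set.MapsTo (fun τ : ℝ => ((τ : ℂ) * s0) ^ 2) (Set.Icc 0 1)
      (Metric.closedBall 0 (rr m)) := fun τ hτ => by simpa using hn τ hτ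
    exact hpath.add (((hσcont.comp hpath hm).sub hpath).mul
      (continuousOn_const.add (hρc.comp hpath hm)))
  have hq0 : q 0 = 4 := by simp [hq, hσ0, hρ0]; norm_num
  have hq1 : q 1 = 0 := by simp [hq, hs0]; exact hQ
  set Z : Set ℝ := Set.Icc 0 1 ∩ q ⁻¹' {0} with hZ
  have hZc : IsCompact Z := isCompact_Icc.of_isClosed_subset
    (hqc.preimage_isClosed_of_isClosed isClosed_Icc isClosed_singleton) Set.inter_subset_left
  obtain ⟨τ0, ⟨hτ0, hqτ0⟩, hleast⟩ := hZc.exists_isLeast ⟨1, by simp, hq1⟩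
  have hτpos : 0 < τ0 := by
    rcases hτ0.1.eq_or_lt with h | h
    · rw [← h] at hqτ0; simp only [Set.mem_preimage, Set.mem_singleton_iff] at hqτ0
      rw [hq0] at hqτ0; norm_num at hqτ0
    · exact h
  have hqne : ∀ τ ∈ Set.Ico 0 τ0, q τ ≠ 0 := by
    intro τ hτ h
    exact absurd (hleast ⟨⟨hτ.1, hτ.2.le.trans hτ0.2⟩, h⟩) (not_le.2 hτ.2)
  -- lift
  obtain ⟨σ, hσc, hσsq, -⟩ := exists_sqrt_lift (V := (fun x : ℝ => (x : ℂ)) '' Set.Ico 0 τ0)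
    (r := 1) (e := 2) (h := fun x s => q (x.re * ‖s‖))
    (by
      have : ContinuousOn (fun x : ℂ × ℂ => x.1.re * ‖x.2‖)
        (((fun x : ℝ => (x : ℂ)) '' Set.Ico 0 τ0) ×ˢ Metric.closedBall 0 1) := by fun_prop
      refine hqc.comp this ?_
      rintro ⟨x, s⟩ ⟨⟨τ, hτ, rfl⟩, hs⟩
      have hs' : ‖s‖ ≤ 1 := by simpa using hs
      simp only [Complex.ofReal_re]
      exact ⟨mul_nonneg hτ.1 (norm_nonneg _),
        (mul_le_of_le_one_right hτ.1 hs').trans (hτ.2.le.trans hτ0.2)⟩)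
    (by
      rintro _ ⟨τ, hτ, rfl⟩ s hs
      simp only [Complex.ofReal_re]
      exact hqne _ ⟨mul_nonneg hτ.1 (norm_nonneg _),
        (mul_le_of_le_one_right hτ.1 hs).trans_lt hτ.2⟩)
    (by rintro _ ⟨τ, hτ, rfl⟩; simp [hq0]; norm_num) two_ne_zero
  set g : ℝ → ℂ := fun τ => σ (τ : ℂ) 1 with hg
  have hgc : ContinuousOn g (Set.Ico 0 τ0) := by
    have : ContinuousOn (fun τ : ℝ => (((τ : ℂ), 1) : ℂ × ℂ)) (Set.Ico 0 τ0) := by fun_prop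
    exact hσc.comp this fun τ hτ => ⟨⟨τ, hτ, rfl⟩, by simp⟩
  have hgsq : ∀ τ ∈ Set.Ico 0 τ0, g τ ^ 2 = q τ := by
    intro τ hτ
    have := hσsq (τ : ℂ) ⟨τ, hτ, rfl⟩ 1 (by simp)
    simpa using this
  have hcore : ∀ τ ∈ Set.Icc (0 : ℝ) 1, ∀ y : ℂ, y ^ 2 = q τ → y - τ * s0 ≠ 0 ∧
      toS (τ * s0 / (y - τ * s0)) ∈ sphereBasin a := by
    intro τ hτ y hy
    have hnτ := hn τ hτ
    have h1 := (glev m).σne a ha _ hnτ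
    have h2 := rho_ne_neg_one ha0 (hρsq _ hnτ) (by intro h; rw [h]; exact hρ0)
    obtain ⟨h3, h4⟩ := R2_sqrt ha0 h1 h2 (hρsq _ hnτ) hy
    refine ⟨h3, Or.inl (tendsto_shift 1 ?_)⟩
    rw [mul_one, h4]
    exact psi_tendsto ha hnτ
  set X : Set RSphere := (fun τ : ℝ => toS (τ * s0 / (g τ - τ * s0))) '' Set.Ico 0 τ0 with hX
  have hIco : ∀ τ ∈ Set.Ico 0 τ0, τ ∈ Set.Icc (0 : ℝ) 1 := fun τ hτ =>
    ⟨hτ.1, hτ.2.le.trans hτ0.2⟩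
  have hXc : IsPreconnected X := by
    apply isPreconnected_Ico.image
    apply continuous_toS.comp_continuousOn
    have hl : ContinuousOn (fun τ : ℝ => (τ : ℂ) * s0) (Set.Ico 0 τ0) := by fun_prop
    exact hl.div (hgc.sub hl) fun τ hτ => (hcore τ (hIco τ hτ) _ (hgsq τ hτ)).1
  have hcl : ((-1 : ℂ) : RSphere) ∈ closure X := by
    have hs00 : (0 : ℂ) - τ0 * s0 ≠ 0 := (hcore τ0 hτ0 0 (by
      simp only [Set.mem_preimage, Set.mem_singleton_iff] at hqτ0; rw [hqτ0]; simp)).1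
    have hg0 : Tendsto g (𝓝[<] τ0) (𝓝 0) := by
      have h1 : Tendsto q (𝓝[<] τ0) (𝓝 0) := by
        have := (hqc τ0 hτ0).tendsto
        simp only [Set.mem_preimage, Set.mem_singleton_iff] at hqτ0
        rw [hqτ0] at this
        refine this.mono_left ?_
        rw [← nhdsWithin_Ico_eq_nhdsLT hτpos]
        exact nhdsWithin_mono _ fun τ hτ => hIco τ hτ
      have h2 : Tendsto (fun τ => √‖q τ‖) (𝓝[<] τ0) (𝓝 0) := by
        have := (h1.norm).sqrt; simpa using this
      rw [tendsto_zero_iff_norm_tendsto_zero]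
      refine h2.congr' ?_
      rw [← nhdsWithin_Ico_eq_nhdsLT hτpos]
      filter_upwards [self_mem_nhdsWithin] with τ hτ
      rw [← hgsq τ hτ, norm_pow, Real.sqrt_sq (norm_nonneg _)]
    have hl : Tendsto (fun τ : ℝ => (τ : ℂ) * s0) (𝓝[<] τ0) (𝓝 (τ0 * s0)) := by
      have : Continuous (fun τ : ℝ => (τ : ℂ) * s0) := by fun_prop
      exact (this.tendsto τ0).mono_left nhdsWithin_le_nhds
    have h3 := (continuous_toS.tendsto _).comp (hl.div (hg0.sub hl) hs00)
    have h4 : (τ0 : ℂ) * s0 / (0 - τ0 * s0) = -1 := by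
      have : (τ0 : ℂ) * s0 ≠ 0 := by simpa using hs00
      rw [zero_sub, div_neg, div_self this]
    have h5 : toS (-1) = ((-1 : ℂ) : RSphere) := by rw [toS_ne (by norm_num)]; norm_num
    rw [h4, h5] at h3
    refine mem_closure_of_tendsto h3 ?_
    rw [← nhdsWithin_Ico_eq_nhdsLT hτpos]
    filter_upwards [self_mem_nhdsWithin] with τ hτ
    exact ⟨τ, hτ, rfl⟩
  have hm1 : ((-1 : ℂ) : RSphere) ∈ sphereBasin a := by
    have := (hcore τ0 hτ0 0 (by
      simp only [Set.mem_preimage, Set.mem_singleton_iff] at hqτ0; rw [hqτ0]; simp))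
    have hs00 := this.1
    have h4 : (τ0 : ℂ) * s0 / (0 - τ0 * s0) = -1 := by
      have : (τ0 : ℂ) * s0 ≠ 0 := by simpa using hs00
      rw [zero_sub, div_neg, div_self this]
    have h5 : toS (-1) = ((-1 : ℂ) : RSphere) := by rw [toS_ne (by norm_num)]; norm_num
    have h6 := this.2
    rwa [h4, h5] at h6
  refine subset_Ainf (S := insert ((-1 : ℂ) : RSphere) X) ?_ ?_ (x := ∞) ?_
    (infty_mem_Ainf ha0) (Set.mem_insert _ _)
  · exact hXc.subset_closure (Set.subset_insert _ _) (Set.insert_subset hcl subset_closure)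
  · refine Set.insert_subset hm1 ?_
    rintro _ ⟨τ, hτ, rfl⟩
    exact (hcore τ (hIco τ hτ) _ (hgsq τ hτ)).2
  · right
    exact ⟨0, ⟨le_rfl, hτpos⟩, by simp [toS_zero]⟩

/-- The reason for `a ∉ VV (m+1)` -/
theorem dich_step {m : ℕ} {a : ℂ} (ha : a ∈ VV m) (hna : a ∉ VV (m + 1)) :
    crit a 0 ∈ Ainf a ∨ crit a 1 ∈ Ainf a := by
  have h := (lev_rel m).dich a ha hna
  rw [rr_sq] at h
  have hse : ∀ S : ℂ, ‖S‖ ≤ rr m → (lev m).σ a S = sig a S := fun S hS => (sig_eq ha hS).symm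
  rcases h with ⟨S, hS, h⟩ | ⟨ρ', hc, h0, hsq, S, hS, h⟩
  · right
    rw [hse S hS] at h
    have h2 := psi_mem_Ainf ha hS
    have hne := (glev m).σne a ha S hS
    simp only at hne
    have hS0 : S ≠ 0 := by
      rintro rfl
      apply hne
      linear_combination h
    have : psi a S = crit a 1 := by
      rw [crit_one, psi, toS_eq_coe, ph]
      refine ⟨div_ne_zero hS0 hne, ?_⟩
      field_simp
      linear_combination -h
    rwa [← this]
  · left
    rw [crit_zero]
    refine neg_one_mem_Ainf ha hc h0 ?_ hS ?_
    · intro T hT; rw [← hse T hT]; exact hsq T hT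
    · rw [← hse S hS]; exact h

theorem dich {a : ℂ} (ha : a ∈ Par) (hna : a ∉ TT) : crit a 0 ∈ Ainf a ∨ crit a 1 ∈ Ainf a := by
  have h : ∃ m, a ∉ VV m := by simpa [TT] using hna
  classical
  have h1 := Nat.find_spec h
  obtain ⟨m, hm⟩ : ∃ m, Nat.find h = m + 1 := by
    apply Nat.exists_eq_succ_of_ne_zero
    intro h0
    rw [h0] at h1
    exact h1 ha
  rw [hm] at h1
  have h2 : a ∈ VV m := by
    by_contra h3
    have := Nat.find_min' h h3
    omega
  exact dich_step h2 h1

theorem captureSet_TT {n : ℕ} (hn : 2 ≤ n) {a : ℂ} (ha : a ∈ captureSet n) : a ∈ TT := by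
  by_contra h
  rcases dich (captureSet_Par hn ha) h with h1 | h1
  · exact ha.2.2 0 (by omega) h1
  · exact ha.2.2 1 (by omega) h1

theorem psi_mem_Ainf_TT {a s : ℂ} (ha : a ∈ TT) (hs : ‖s‖ < 1) : psi a s ∈ Ainf a := by
  obtain ⟨m, hm⟩ := exists_rr (norm_nonneg s) hs
  exact psi_mem_Ainf (ha m) hm.le

theorem TT_Par {a : ℂ} (ha : a ∈ TT) : a ∈ Par := ha 0

theorem isOpen_psi_ball {m : ℕ} {a : ℂ} (ha : a ∈ VV m) {t : ℝ} (ht0 : 0 < t) (ht : t ≤ rr m) :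
    IsOpen (psi a '' Metric.ball 0 t) := by
  have hb : ∀ s ∈ Metric.ball (0 : ℂ) t, ‖s‖ < rr m := fun s hs => by
    have : ‖s‖ < t := by simpa using hs
    linarith
  have han : AnalyticOnNhd ℂ (ph a) (Metric.ball 0 t) :=
    DifferentiableOn.analyticOnNhd
      (fun s hs => (ph_diff' ha (hb s hs)).differentiableWithinAt) Metric.isOpen_ball
  have h := han.is_constant_or_isOpen (convex_ball (0 : ℂ) t).isPreconnected
  have : psi a '' Metric.ball 0 t = toS '' (ph a '' Metric.ball 0 t) := by
    rw [Set.image_image]; rfl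
  rw [this]
  apply isOpenEmbedding_toS.isOpenMap
  rcases h with ⟨w, hw⟩ | h
  · exfalso
    have h0 : (0 : ℂ) ∈ Metric.ball (0 : ℂ) t := by simpa using ht0
    have h1 : ((t / 2 : ℝ) : ℂ) ∈ Metric.ball (0 : ℂ) t := by
      rw [mem_ball_zero_iff, Complex.norm_real, Real.norm_of_nonneg (by linarith)]; linarith
    have h2 := psi_inj ha (hb _ h0).le (hb _ h1).le (by rw [psi, psi, hw _ h0, hw _ h1])
    have h3 : (0 : ℝ) = t / 2 := by exact_mod_cast h2
    linarith
  · exact h _ le_rfl Metric.isOpen_ball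

theorem Ainf_eq {a : ℂ} (ha : a ∈ TT) {z : RSphere} (hz : z ∈ Ainf a) :
    ∃ s, ‖s‖ < 1 ∧ psi a s = z := by
  have ha0 : a ≠ 0 := (TT_Par ha).1
  have hlt : ∀ {s : ℂ}, ‖s‖ < 1 → ∃ m, ‖s‖ < rr m := fun hs => exists_rr (norm_nonneg _) hs
  set U : Set RSphere := psi a '' Metric.ball 0 1 with hU
  have hUo : IsOpen U := by
    have : U = ⋃ m, psi a '' Metric.ball 0 (rr m) := by
      rw [← Set.image_iUnion, hU]
      congr 1
      ext s
      rw [Set.mem_iUnion]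
      simp only [mem_ball_zero_iff]
      exact ⟨hlt, fun ⟨m, hm⟩ => hm.trans (rr_bounds m).2⟩
    rw [this]
    exact isOpen_iUnion fun m => isOpen_psi_ball (ha m) (rr_bounds m).1 le_rfl
  have hsub : Ainf a ⊆ U := by
    apply (isPreconnected_Ainf a).subset_of_closure_inter_subset hUo
      ⟨∞, infty_mem_Ainf ha0, ⟨0, by simp, psi_zero a⟩⟩
    rintro w ⟨hwc, hwA⟩
    have hb := Ainf_subset a hwA
    have hN : IsOpen (psi a '' Metric.ball 0 (rr 0)) :=
      isOpen_psi_ball (ha 0) (rr_bounds 0).1 le_rfl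
    rcases hb with hb | hb
    · obtain ⟨l, p, hp, hl⟩ := iter_of_tendsto_infty (e := 1 / 2000) (by norm_num) hb
      obtain ⟨S, hS, hpS⟩ := small_psi (TT_Par ha) hp.le
      have hO : IsOpen ((Rhat a)^[2 * l] ⁻¹' (psi a '' Metric.ball 0 (rr 0))) :=
        hN.preimage (continuous_iter ha0 _)
      have hwO : w ∈ (Rhat a)^[2 * l] ⁻¹' (psi a '' Metric.ball 0 (rr 0)) :=
        ⟨S, by simpa using hS, by rw [hl, hpS]⟩
      have h2 : w ∈ closure ((Rhat a)^[2 * l] ⁻¹' (psi a '' Metric.ball 0 (rr 0)) ∩ U) :=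
        hO.inter_closure ⟨hwO, hwc⟩
      have h3 : (Rhat a)^[2 * l] ⁻¹' (psi a '' Metric.ball 0 (rr 0)) ∩ U ⊆
          psi a '' Metric.closedBall 0 (rr l) := by
        rintro _ ⟨⟨t, ht, hts⟩, s, hs, rfl⟩
        obtain ⟨m, hm⟩ := hlt (by simpa using hs)
        rw [iter_psi (ha m) hm.le] at hts
        have ht' : ‖t‖ < rr 0 := by simpa using ht
        have h4 := psi_inj (ha m) (ht'.le.trans (rr_mono (Nat.zero_le m))) (pow_norm_le hm.le l) hts
        exact ⟨s, by simpa using level_lemma (l := l) (by rw [← h4]; exact ht'.le), rfl⟩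
      have h5 : IsClosed (psi a '' Metric.closedBall 0 (rr l)) :=
        ((isCompact_closedBall (0 : ℂ) _).image_of_continuousOn (psi_contOn' (ha l))).isClosed
      obtain ⟨s, hs, hsw⟩ := h5.closure_subset_iff.2 h3 h2
      exact ⟨s, by
        have : ‖s‖ ≤ rr l := by simpa using hs
        simpa using this.trans_lt (rr_bounds l).2, hsw⟩
    · exfalso
      obtain ⟨l, p, hp, hl⟩ := iter_of_tendsto_zero ha0 (e := 1 / 2000) (by norm_num) hb
      obtain ⟨S, hS, hpS⟩ := small_psi (TT_Par ha) hp.le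
      have hO : IsOpen ((Rhat a)^[2 * l + 1] ⁻¹' (psi a '' Metric.ball 0 (rr 0))) :=
        hN.preimage (continuous_iter ha0 _)
      obtain ⟨_, ⟨t, ht, hts⟩, ⟨s, hs, rfl⟩⟩ := mem_closure_iff.1 hwc _ hO
        ⟨S, by simpa using hS, by rw [hl, hpS]⟩
      obtain ⟨m, hm⟩ := hlt (by simpa using hs)
      rw [iter_psi_odd (ha m) hm.le] at hts
      have ht' : ‖t‖ < rr 0 := by simpa using ht
      refine bb_ne_psi (ha m) ?_ (ht'.le.trans (rr_mono (Nat.zero_le m))) hts.symm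
      rw [pow_succ, pow_mul]
      exact sq_norm_le (pow_norm_le hm.le l)
  obtain ⟨s, hs, h⟩ := hsub hz
  exact ⟨s, by simpa using hs, h⟩

end

section
open Filter Topology OnePoint

theorem tube {m k : ℕ} {a : ℂ} (ha : a ∈ VV m) {K : Set ℂ} (hK : IsCompact K)
    (hKm : K ⊆ Metric.closedBall 0 (rr m)) (h : ∀ s ∈ K, crit a k ≠ psi a s) :
    ∀ᶠ b in 𝓝 a, ∀ s ∈ K, crit b k ≠ psi b s := by
  have h1 : ∀ᶠ b in 𝓝 a, ∀ s ∈ K, (b ∈ VV m ∧ s ∈ K) → crit b k ≠ psi b s := by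
    apply hK.eventually_forall_of_forall_eventually
    intro s hs
    have h2 : ContinuousWithinAt (fun x : ℂ × ℂ => psi x.1 x.2) (VV m ×ˢ K) (a, s) :=
      (psi_contOn m).mono (Set.prod_mono le_rfl hKm) (a, s) ⟨ha, hs⟩
    have h3 : ContinuousWithinAt (fun x : ℂ × ℂ => crit x.1 k) (VV m ×ˢ K) (a, s) := by
      have : ContinuousAt (fun x : ℂ × ℂ => crit x.1 k) (a, s) :=
        ContinuousAt.comp (f := Prod.fst) (g := fun b => crit b k) (x := (a, s))
          (continuousAt_crit (VV_ne ha) k) continuousAt_fst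
      exact this.continuousWithinAt
    have h4 : ∀ᶠ x in 𝓝[VV m ×ˢ K] (a, s), crit x.1 k ≠ psi x.1 x.2 := by
      have h5 := h3.tendsto.prodMk_nhds h2.tendsto
      have h6 : {y : RSphere × RSphere | y.1 ≠ y.2} ∈ 𝓝 (crit a k, psi a s) :=
        (isOpen_ne_fun continuous_fst continuous_snd).mem_nhds (h s hs)
      exact h5 h6
    rw [eventually_nhdsWithin_iff] at h4
    filter_upwards [h4] with x hx hx2
    exact hx hx2
  filter_upwards [h1, (isOpen_VV m).mem_nhds ha] with b hb hbV
  exact fun s hs => hb s hs ⟨hbV, hs⟩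

theorem dich_detail {m : ℕ} {a : ℂ} (ha : a ∈ VV m) (hna : a ∉ VV (m + 1)) :
    (∃ S, ‖S‖ ≤ rr m ∧ crit a 1 = psi a S) ∨
    (∃ S, ‖S‖ ≤ rr m ∧ ¬ ‖S‖ ≤ rr m ^ 2 ∧ crit a 2 = psi a S) := by
  have h := (lev_rel m).dich a ha hna
  have ha0 := VV_ne ha
  rw [rr_sq] at h
  have hse : ∀ S : ℂ, ‖S‖ ≤ rr m → (lev m).σ a S = sig a S := fun S hS => (sig_eq ha hS).symm
  rcases h with ⟨S, hS, h⟩ | ⟨ρ', hc, h0, hsq, S, hS, h⟩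
  · left
    refine ⟨S, hS, ?_⟩
    rw [hse S hS] at h
    have hne := (glev m).σne a ha S hS
    simp only at hne
    have hS0 : S ≠ 0 := by
      rintro rfl
      apply hne
      linear_combination h
    symm
    rw [crit_one, psi, toS_eq_coe, ph]
    refine ⟨div_ne_zero hS0 hne, ?_⟩
    field_simp
    linear_combination -h
  · right
    have hsq' : ∀ T, ‖T‖ ≤ rr m → ρ' T ^ 2 * (sig a T - T) = (sig a T - T) + a * T := by
      intro T hT; rw [← hse T hT]; exact hsq T hT
    rw [hse S hS] at h
    have hne := (glev m).σne a ha S hS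
    simp only at hne
    have hS0 : S ≠ 0 := by
      rintro rfl
      have := (glev m).σ0 a ha
      simp only at this
      rw [this, h0] at h
      norm_num at h
    have e1 : ρ' S - 1 = -a := by
      have h2 := hsq' S hS
      have : (ρ' S - 1 + a) * S = 0 := by linear_combination -h2 + (ρ' S - 1) * h
      rcases mul_eq_zero.1 this with h3 | h3
      · linear_combination h3
      · exact absurd h3 hS0
    refine ⟨S, hS, ?_, ?_⟩
    · intro hS2
      have e2 : ρ' S = rho a S := by
        have hcl : Metric.closedBall (0 : ℂ) (rr m ^ 2) ⊆ Metric.closedBall 0 (rr m) :=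
          Metric.closedBall_subset_closedBall (rr_sq_le m)
        have hrc : ContinuousOn (rho a) (Metric.closedBall 0 (rr m ^ 2)) := by
          have : ContinuousOn (fun s : ℂ => ((a, s) : ℂ × ℂ)) (Metric.closedBall 0 (rr m ^ 2)) := by
            fun_prop
          exact (glev m).ρc.comp this fun s hs => ⟨ha, hs⟩
        refine sqrt_unique (pow_nonneg (rr_bounds m).1.le 2) (hc.mono hcl) hrc ?_ ?_ ?_ S hS2
        · intro T hT
          have h1 := hsq' T (hT.trans (rr_sq_le m))
          have h2 := (glev m).ρsq a ha T hT
          simp only at h2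
          rw [← h2] at h1
          exact mul_right_cancel₀ ((glev m).σne a ha T (hT.trans (rr_sq_le m))) h1
        · exact (glev m).ρne0 a ha
        · rw [h0]; exact ((glev m).ρ0 a ha).symm
      rw [e2] at h
      obtain ⟨s, hs⟩ : ∃ s, s ^ 2 = S := ⟨csq S, csq_sq S⟩
      have hsn : ‖s‖ ≤ rr m := by
        rw [← hs, norm_pow] at hS2
        exact le_of_pow_le_pow_left₀ two_ne_zero (rr_bounds m).1.le hS2
      have h3 := (glev m).σsq a ha s hsn
      simp only at h3
      rw [hs, h] at h3
      exact (glev m).σne0 a ha s hsn (pow_eq_zero_iff two_ne_zero |>.1 h3)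
    · rw [crit_succ, crit_one, ← e1, Rhat_coe ha0, psi, ph]
      congr 1
      field_simp
      linear_combination hsq' S hS

theorem level_bound {m k N : ℕ} {a s t : ℂ} (ha : a ∈ VV m) (hs : ‖s‖ ≤ rr m)
    (hk : crit a k = psi a s) (hkN : k ≤ N) (hN : crit a N = psi a t) (ht : ‖t‖ ≤ rr 0) :
    ‖s‖ ≤ rr N := by
  have ht' : ‖t‖ ≤ rr m := ht.trans (rr_mono (Nat.zero_le m))
  obtain ⟨d, rfl⟩ := Nat.exists_eq_add_of_le hkN
  rw [← crit_add, hk] at hN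
  rcases Nat.even_or_odd' d with ⟨l, rfl | rfl⟩
  · rw [iter_psi ha hs] at hN
    have := psi_inj ha (pow_norm_le hs l) ht' hN
    rw [← this] at ht
    exact (level_lemma ht).trans (rr_mono (by omega))
  · rw [iter_psi_odd ha hs] at hN
    refine absurd hN (bb_ne_psi ha ?_ ht')
    rw [pow_succ, pow_mul]
    exact sq_norm_le (pow_norm_le hs l)

theorem isOpen_captureSet {n : ℕ} (hn : 2 ≤ n) : IsOpen (captureSet n) := by
  rw [isOpen_iff_mem_nhds]
  intro a ha
  have haT := captureSet_TT hn ha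
  have haP := TT_Par haT
  have hcn : crit a n ∈ Ainf a := ha.2.1
  obtain ⟨t, ht, htc⟩ := Ainf_eq haT hcn
  obtain ⟨m0, hm0⟩ := exists_rr (norm_nonneg t) ht
  have hten := psi_tendsto (haT m0) hm0.le
  rw [htc] at hten
  obtain ⟨l, p, hp, hl⟩ := iter_of_tendsto_infty (e := 1 / 2000) (by norm_num) hten
  rw [crit_add] at hl
  set N := n + 2 * l with hN
  have e1 : ∀ᶠ b in 𝓝 a, ∃ q, ‖q‖ < 1 / 2000 ∧ crit b N = toS q := by
    have ho : IsOpen (toS '' Metric.ball 0 (1 / 2000)) :=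
      isOpenEmbedding_toS.isOpenMap _ Metric.isOpen_ball
    have := (continuousAt_crit haP.1 N).eventually_mem (ho.mem_nhds ⟨p, by simpa using hp, hl.symm⟩)
    filter_upwards [this] with b hb
    obtain ⟨q, hq, h⟩ := hb
    exact ⟨q, by simpa using hq, h.symm⟩
  have e2 : ∀ᶠ b in 𝓝 a, b ∈ VV (N + 1) := (isOpen_VV (N + 1)).mem_nhds (haT _)
  have e3 : ∀ᶠ b in 𝓝 a, ∀ k ∈ Finset.range n, ∀ s ∈ Metric.closedBall (0 : ℂ) (rr N),
      crit b k ≠ psi b s := by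
    rw [Filter.eventually_all_finset]
    intro k hk
    refine tube (haT N) (isCompact_closedBall _ _) le_rfl ?_
    intro s hs h
    refine ha.2.2 k (Finset.mem_range.1 hk) ?_
    change crit a k ∈ _
    rw [h]
    exact psi_mem_Ainf (haT N) (by simpa using hs)
  filter_upwards [e1, e2, e3, crit_Ainf_open haP hcn] with b ⟨q, hq, hbq⟩ hbV hbk hbn
  have hbP := VV_Par hbV
  obtain ⟨s', hs', hqs⟩ := small_psi hbP hq.le
  rw [hqs] at hbq
  have hbT : b ∈ TT := by
    by_contra hcon
    have h : ∃ m, b ∉ VV m := by simpa [TT] using hcon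
    classical
    have h1 := Nat.find_spec h
    obtain ⟨m, hm⟩ : ∃ m, Nat.find h = m + 1 := by
      apply Nat.exists_eq_succ_of_ne_zero
      intro h0
      rw [h0] at h1
      exact h1 hbP
    rw [hm] at h1
    have h2 : b ∈ VV m := by
      by_contra h3
      have := Nat.find_min' h h3
      omega
    have h3 : N + 1 ≤ m := by
      by_contra h3
      exact h1 (VV_anti (by omega) hbV)
    rcases dich_detail h2 h1 with ⟨S, hS, hc⟩ | ⟨S, hS, hS2, hc⟩
    · have := level_bound h2 hS hc (by omega) hbq hs'.le
      exact hbk 1 (Finset.mem_range.2 (by omega)) S (by simpa using this) hc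
    · have := level_bound h2 hS hc (by omega) hbq hs'.le
      apply hS2
      obtain ⟨m', rfl⟩ := Nat.exists_eq_add_of_le' (Nat.le_of_succ_le_succ (h3.trans (Nat.le_succ m)) |>.trans' (Nat.zero_le _) |> fun _ => (by omega : 1 ≤ m))
      rw [rr_sq]
      exact this.trans (rr_mono (by omega))
  refine ⟨hbP.1, hbn, ?_⟩
  intro k hk hkA
  obtain ⟨s, hs, hsk⟩ := Ainf_eq hbT (z := crit b k) hkA
  obtain ⟨m, hm⟩ := exists_rr (norm_nonneg s) hs
  have := level_bound (hbT m) hm.le hsk.symm (by omega) hbq hs'.le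
  exact hbk k (Finset.mem_range.2 hk) s (by simpa using this) hsk.symm

/-- behaviour near the puncture -/
theorem near_zero_aux (k : ℕ) : ∃ x : ℝ, ∃ w : ℂ → ℂ, -1 ≤ x ∧ x < 0 ∧
    Tendsto w (𝓝[≠] 0) (𝓝 (x : ℂ)) ∧ ∀ᶠ a in 𝓝[≠] 0, crit a (2 * k) = ((w a : ℂ) : RSphere) := by
  induction k with
  | zero => exact ⟨-1, fun _ => -1, le_rfl, by norm_num, by simp, by simp [crit_zero]⟩
  | succ k ih =>
    obtain ⟨x, w, hx1, hx0, hw, he⟩ := ih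
    have hq : Tendsto (fun a => w a ^ 2 + 2 * w a) (𝓝[≠] 0) (𝓝 ((x : ℂ) ^ 2 + 2 * x)) :=
      (hw.pow 2).add (hw.const_mul 2)
    have hx2 : x ^ 2 + 2 * x < 0 := by nlinarith
    have hxne : (x : ℂ) ^ 2 + 2 * x ≠ 0 := by exact_mod_cast hx2.ne
    have hid : Tendsto (fun a : ℂ => a) (𝓝[≠] 0) (𝓝 0) := tendsto_id.mono_left nhdsWithin_le_nhds
    have hd : Tendsto (fun a => a + 2 * (w a ^ 2 + 2 * w a)) (𝓝[≠] 0)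
        (𝓝 (0 + 2 * ((x : ℂ) ^ 2 + 2 * x))) := hid.add (hq.const_mul 2)
    have hdne : (0 + 2 * ((x : ℂ) ^ 2 + 2 * x)) ≠ 0 := by simpa using hxne
    refine ⟨(x ^ 2 + 2 * x) / 2, fun a => (w a ^ 2 + 2 * w a) ^ 2 / (a + 2 * (w a ^ 2 + 2 * w a)),
      by nlinarith [sq_nonneg (x + 1)], by linarith, ?_, ?_⟩
    · have e : (((x ^ 2 + 2 * x) / 2 : ℝ) : ℂ) =
          ((x : ℂ) ^ 2 + 2 * x) ^ 2 / (0 + 2 * ((x : ℂ) ^ 2 + 2 * x)) := by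
        push_cast
        rw [eq_div_iff hdne]
        ring
      rw [e]
      exact (hq.pow 2).div hd hdne
    · filter_upwards [he, hq.eventually_ne hxne, hd.eventually_ne hdne, self_mem_nhdsWithin]
        with a h1 h2 h3 h4
      have h4' : a ≠ 0 := h4
      have e : 2 * (k + 1) = 2 * k + 1 + 1 := by ring
      rw [e, crit_succ, crit_succ, h1, Rhat_coe_ne _ _ h2]
      have h5 : (a / (w a ^ 2 + 2 * w a)) ^ 2 + 2 * (a / (w a ^ 2 + 2 * w a)) =
          a * (a + 2 * (w a ^ 2 + 2 * w a)) / (w a ^ 2 + 2 * w a) ^ 2 := by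
        field_simp
      rw [Rhat_coe_ne _ _ (by
        rw [h5]; exact div_ne_zero (mul_ne_zero h4' h3) (pow_ne_zero 2 h2)), h5]
      congr 1
      field_simp

theorem near_zero {k : ℕ} (hk : 1 ≤ k) :
    ∀ᶠ a in 𝓝[≠] 0, ∃ w : ℂ, crit a k = (w : RSphere) ∧ ‖w‖ ≤ 2 := by
  rcases Nat.even_or_odd' k with ⟨l, rfl | rfl⟩
  · obtain ⟨x, w, hx1, hx0, hw, he⟩ := near_zero_aux l
    have h1 : ∀ᶠ a in 𝓝[≠] 0, ‖w a‖ < 2 := by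
      refine hw.norm.eventually_lt_const ?_
      rw [Complex.norm_real, Real.norm_of_nonpos hx0.le]; linarith
    filter_upwards [he, h1] with a h2 h3
    exact ⟨w a, h2, h3.le⟩
  · obtain ⟨x, w, hx1, hx0, hw, he⟩ := near_zero_aux l
    have hq : Tendsto (fun a => w a ^ 2 + 2 * w a) (𝓝[≠] 0) (𝓝 ((x : ℂ) ^ 2 + 2 * x)) :=
      (hw.pow 2).add (hw.const_mul 2)
    have hx2 : x ^ 2 + 2 * x < 0 := by nlinarith
    have hxne : (x : ℂ) ^ 2 + 2 * x ≠ 0 := by exact_mod_cast hx2.ne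
    have hid : Tendsto (fun a : ℂ => a) (𝓝[≠] 0) (𝓝 0) := tendsto_id.mono_left nhdsWithin_le_nhds
    have h4 := hid.div hq hxne
    have h1 : ∀ᶠ a in 𝓝[≠] 0, ‖a / (w a ^ 2 + 2 * w a)‖ < 2 := by
      refine h4.norm.eventually_lt_const ?_
      simp
    filter_upwards [he, h1, hq.eventually_ne hxne] with a h2 h3 h5
    exact ⟨_, by rw [crit_succ, h2, Rhat_coe_ne _ _ h5], h3.le⟩

theorem psi_far {a s : ℂ} (ha : a ∈ Par) (hs : ‖s‖ ≤ rr 0) {w : ℂ} (h : psi a s = (w : RSphere)) :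
    2 < ‖w‖ := by
  have haV : a ∈ VV 0 := ha
  have hs' : ‖s‖ ≤ 1 / 200 := by simpa [rr] using hs
  rw [psi, toS_eq_coe, ph] at h
  obtain ⟨h1, h2⟩ := h
  have h0 := (glev 0).σne a haV s hs
  simp only at h0
  have h3 : s * w = sig a s - s := by
    field_simp at h2
    exact h2
  have h4 : sig a s = sig0 a s := sig_eq haV hs
  have h5 := (sig0_norm ha.2 (hs'.trans (by norm_num))).1
  rw [← h4] at h5
  have h6 : ‖sig a s‖ ≤ ‖s‖ * ‖w‖ + ‖s‖ := by
    have : sig a s = s * w + s := by rw [h3]; ring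
    rw [this]
    exact (norm_add_le _ _).trans (by rw [norm_mul])
  nlinarith [norm_nonneg w, norm_nonneg s]

open Classical in
noncomputable def gg (n : ℕ) (a : ℂ) : ℂ :=
  if h : ∃ s, ‖s‖ < 1 ∧ psi a s = crit a n then h.choose else 0

theorem gg_spec {n : ℕ} (hn : 2 ≤ n) {a : ℂ} (ha : a ∈ captureSet n) :
    ‖gg n a‖ < 1 ∧ psi a (gg n a) = crit a n := by
  have h : ∃ s, ‖s‖ < 1 ∧ psi a s = crit a n := Ainf_eq (captureSet_TT hn ha) ha.2.1
  rw [gg, dif_pos h]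
  exact h.choose_spec

theorem psi_inj_TT {a s t : ℂ} (ha : a ∈ TT) (hs : ‖s‖ < 1) (ht : ‖t‖ < 1)
    (h : psi a s = psi a t) : s = t := by
  obtain ⟨m, hm⟩ := exists_rr (norm_nonneg s) hs
  obtain ⟨k, hk⟩ := exists_rr (norm_nonneg t) ht
  exact psi_inj (ha (max m k)) (hm.le.trans (rr_mono (le_max_left _ _)))
    (hk.le.trans (rr_mono (le_max_right _ _))) h

theorem gg_eq {n : ℕ} (hn : 2 ≤ n) {a s : ℂ} (ha : a ∈ captureSet n) (hs : ‖s‖ < 1)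
    (h : psi a s = crit a n) : gg n a = s :=
  psi_inj_TT (captureSet_TT hn ha) (gg_spec hn ha).1 hs ((gg_spec hn ha).2.trans h.symm)

theorem gg_zero_iff {n : ℕ} (hn : 2 ≤ n) {a : ℂ} (ha : a ∈ captureSet n) :
    gg n a = 0 ↔ crit a n = ∞ := by
  constructor
  · intro h
    rw [← (gg_spec hn ha).2, h, psi_zero]
  · intro h
    exact gg_eq hn ha (by simp) (by rw [psi_zero, h])

theorem compact_subset_closedBall {K : Set ℂ} (hK : IsCompact K) (hK1 : K ⊆ Metric.ball 0 1) :
    ∃ m, K ⊆ Metric.closedBall 0 (rr m) := by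
  rcases K.eq_empty_or_nonempty with rfl | hne
  · exact ⟨0, by simp⟩
  obtain ⟨z, hz, hmax⟩ := hK.exists_isMaxOn hne continuous_norm.continuousOn
  obtain ⟨m, hm⟩ := exists_rr (norm_nonneg z) (by simpa using hK1 hz)
  refine ⟨m, fun w hw => ?_⟩
  have : ‖w‖ ≤ ‖z‖ := hmax hw
  simpa using this.trans hm.le

theorem gg_proper {n : ℕ} (hn : 2 ≤ n) {K : Set ℂ} (hK : IsCompact K) (hK1 : K ⊆ Metric.ball 0 1) :
    IsCompact {a | a ∈ captureSet n ∧ gg n a ∈ K} := by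
  obtain ⟨m, hm⟩ := compact_subset_closedBall hK hK1
  refine Metric.isCompact_of_isClosed_isBounded ?_ ?_
  swap
  · refine (Metric.isBounded_closedBall (x := (0 : ℂ)) (r := 10)).subset fun a ha => ?_
    simpa using (captureSet_bound hn ha.1).le
  rw [← closure_subset_iff_isClosed]
  intro a ha
  set S := {a | a ∈ captureSet n ∧ gg n a ∈ K} with hS
  have hne : (𝓝[S] a).NeBot := mem_closure_iff_nhdsWithin_neBot.1 ha
  have hfreq : ∀ {p : ℂ → Prop}, (∀ᶠ b in 𝓝 a, p b) → ∃ b ∈ S, p b := by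
    intro p hp
    have h1 : ∀ᶠ b in 𝓝[S] a, b ∈ S ∧ p b :=
      Filter.Eventually.and self_mem_nhdsWithin (hp.filter_mono nhdsWithin_le_nhds)
    obtain ⟨b, hb⟩ := h1.exists
    exact ⟨b, hb.1, hb.2⟩
  have ha10 : ‖a‖ ≤ 10 := by
    by_contra hcon
    push Not at hcon
    obtain ⟨b, hb, hb2⟩ := hfreq (continuous_norm.continuousAt.eventually_const_lt hcon)
    linarith [captureSet_bound hn hb.1]
  have ha0 : a ≠ 0 := by
    rintro rfl
    have h1 := near_zero (k := n + 2 * m) (by omega)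
    rw [eventually_nhdsWithin_iff] at h1
    obtain ⟨b, hb, hb2⟩ := hfreq h1
    obtain ⟨w, hw, hw2⟩ := hb2 hb.1.1
    have hbT := captureSet_TT hn hb.1
    have hgm : ‖gg n b‖ ≤ rr m := by simpa using hm hb.2
    have h3 := iter_psi (hbT m) hgm m
    rw [(gg_spec hn hb.1).2, crit_add, hw] at h3
    have h4 := psi_far (TT_Par hbT) (by
      rw [norm_pow, ← rr_pow m]; gcongr) h3.symm
    linarith
  have haP : a ∈ Par := ⟨ha0, by linarith⟩
  have haT : a ∈ TT := by
    by_contra hcon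
    rcases dich haP hcon with h | h
    · obtain ⟨b, hb, hb2⟩ := hfreq (crit_Ainf_open haP h)
      exact hb.1.2.2 0 (by omega) hb2
    · obtain ⟨b, hb, hb2⟩ := hfreq (crit_Ainf_open haP h)
      exact hb.1.2.2 1 (by omega) hb2
  obtain ⟨s, hsK, hs⟩ : ∃ s ∈ K, crit a n = psi a s := by
    by_contra hcon
    push Not at hcon
    obtain ⟨b, hb, hb2⟩ := hfreq (tube (haT m) hK hm hcon)
    exact hb2 _ hb.2 (gg_spec hn hb.1).2.symm
  have hs1 : ‖s‖ < 1 := by simpa using hK1 hsK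
  have hcap : a ∈ captureSet n := by
    refine ⟨ha0, ?_, ?_⟩
    · change crit a n ∈ Ainf a
      rw [hs]; exact psi_mem_Ainf_TT haT hs1
    · intro k hk h
      obtain ⟨b, hb, hb2⟩ := hfreq (crit_Ainf_open haP (k := k) h)
      exact hb.1.2.2 k hk hb2
  exact ⟨hcap, by rw [gg_eq hn hcap hs1 hs.symm]; exact hsK⟩

end

section
open Filter Topology OnePoint

theorem ph_add_ne {m : ℕ} {a s : ℂ} (ha : a ∈ VV m) (hs : ‖s‖ ≤ rr m) : 1 + 2 * ph a s ≠ 0 := by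
  have h0 : sig a s - s ≠ 0 := (glev m).σne a ha s hs
  have h1 := sig_add_ne ha hs
  have : 1 + 2 * ph a s = (sig a s + s) / (sig a s - s) := by
    rw [ph]; field_simp; ring
  rw [this]; exact div_ne_zero h1 h0

theorem ph_bb {m : ℕ} {a s : ℂ} (ha : a ∈ VV m) (hs : ‖s‖ ≤ rr m ^ 2) :
    a * ph a s = bb a s ^ 2 + 2 * bb a s := by
  have h0 : sig a s - s ≠ 0 := (glev m).σne a ha s (hs.trans (rr_sq_le m))
  have h2 := bb_formula ha hs
  have h3 : rho a s = bb a s + 1 := by rw [bb]; ring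
  rw [h3] at h2
  rw [ph]; field_simp
  linear_combination -h2

theorem bb_ph {m : ℕ} {a s : ℂ} (ha : a ∈ VV m) (hs : ‖s‖ ≤ rr m) :
    bb a (s ^ 2) = a * ph a s ^ 2 / (1 + 2 * ph a s) := by
  have h := Rhat_psi ha hs
  rw [psi, Rhat_toS (ph_add_ne ha hs)] at h
  exact (OnePoint.coe_injective h).symm

theorem ph_feq {m : ℕ} {a s : ℂ} (ha : a ∈ VV m) (hs : ‖s‖ ≤ rr m) :
    a * ph a (s ^ 2) = (a * ph a s ^ 2 / (1 + 2 * ph a s)) ^ 2 +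
      2 * (a * ph a s ^ 2 / (1 + 2 * ph a s)) := by
  rw [ph_bb ha (sq_norm_le hs), bb_ph ha hs]

theorem ph_deriv_zero {m : ℕ} {a : ℂ} (ha : a ∈ VV m) : deriv (ph a) 0 = 1 / 2 := by
  have h0 : (0:ℝ) < rr m := (rr_bounds m).1
  have hσ : DifferentiableAt ℂ (sig a) 0 := by
    have h := (glev m).σd.differentiableAt (x := (a, 0))
      (((isOpen_VV m).prod Metric.isOpen_ball).mem_nhds ⟨ha, by simpa using h0⟩)
    exact DifferentiableAt.comp (0:ℂ) (f := fun s : ℂ => ((a, s) : ℂ × ℂ)) h (by fun_prop)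
  have e : sig a 0 = 2 := (glev m).σ0 a ha
  have h1 : HasDerivAt (fun s => s / (sig a s - s))
      ((1 * (sig a 0 - 0) - 0 * (deriv (sig a) 0 - 1)) / (sig a 0 - 0) ^ 2) 0 :=
    (hasDerivAt_id (0:ℂ)).div (hσ.hasDerivAt.sub (hasDerivAt_id 0)) (by simp [e])
  have h2 := h1.deriv
  rw [e] at h2
  have : ph a = fun s => s / (sig a s - s) := rfl
  rw [this, h2]; norm_num

theorem ph_diffOn {m : ℕ} {a : ℂ} (ha : a ∈ VV m) :
    DifferentiableOn ℂ (ph a) (Metric.ball 0 (rr m)) := fun s hs =>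
  (ph_diff' ha (by simpa using hs)).differentiableWithinAt

theorem ph_deriv_ne {m : ℕ} {a s : ℂ} (ha : a ∈ VV m) (hs : ‖s‖ < rr m) : deriv (ph a) s ≠ 0 := by
  intro h
  have step : ∀ s : ℂ, ‖s‖ < rr m → deriv (ph a) s = 0 → deriv (ph a) (s ^ 2) = 0 := by
    intro s hs h
    by_cases h0 : s = 0
    · subst h0; simpa using h
    have hs2 : ‖s ^ 2‖ < rr m := by
      rw [norm_pow]; have := rr_bounds m; nlinarith [norm_nonneg s]
    have e : (fun s => a * ph a (s ^ 2)) =ᶠ[𝓝 s]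
        (fun p => (a * p ^ 2 / (1 + 2 * p)) ^ 2 + 2 * (a * p ^ 2 / (1 + 2 * p))) ∘ ph a := by
      filter_upwards [continuous_norm.continuousAt.eventually_lt_const hs] with t ht
      exact ph_feq ha ht.le
    have hne := ph_add_ne ha hs.le
    have hG : DifferentiableAt ℂ
        (fun p : ℂ => (a * p ^ 2 / (1 + 2 * p)) ^ 2 + 2 * (a * p ^ 2 / (1 + 2 * p))) (ph a s) := by
      fun_prop (disch := exact hne)
    have h1 := e.deriv_eq
    rw [deriv_comp s hG (ph_diff' ha hs), h, mul_zero] at h1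
    have h2 : HasDerivAt (fun s => a * ph a (s ^ 2)) (a * (deriv (ph a) (s ^ 2) * (2 * s))) s := by
      have := (ph_diff' ha hs2).hasDerivAt.comp s ((hasDerivAt_id s).pow 2)
      simpa using this.const_mul a
    rw [h2.deriv] at h1
    have ha0 := VV_ne ha
    simpa [ha0, h0] using h1
  have hk : ∀ k : ℕ, ‖s ^ 2 ^ k‖ < rr m ∧ deriv (ph a) (s ^ 2 ^ k) = 0 := by
    intro k
    induction k with
    | zero => simpa using ⟨hs, h⟩
    | succ k ih =>
      have e : s ^ 2 ^ (k + 1) = (s ^ 2 ^ k) ^ 2 := by rw [← pow_mul, pow_succ]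
      rw [e]
      refine ⟨?_, step _ ih.1 ih.2⟩
      rw [norm_pow]; have := rr_bounds m; nlinarith [norm_nonneg (s ^ 2 ^ k), ih.1]
  have hc : ContinuousAt (deriv (ph a)) 0 :=
    (((ph_diffOn ha).deriv Metric.isOpen_ball).differentiableAt
      (Metric.ball_mem_nhds _ (rr_bounds m).1)).continuousAt
  have h1 := hc.tendsto.comp (tendsto_pow_pow (hs.trans (rr_bounds m).2))
  have h2 : (deriv (ph a)) ∘ (fun n => s ^ 2 ^ n) = fun _ => 0 := funext fun k => (hk k).2
  rw [h2, ph_deriv_zero ha] at h1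
  have := tendsto_nhds_unique h1 tendsto_const_nhds
  norm_num at this

/-- affine critical orbit -/
noncomputable def cc : ℕ → ℂ → ℂ
  | 0, _ => -1
  | k + 1, a => a / (cc k a ^ 2 + 2 * cc k a)

noncomputable def PP (n : ℕ) (a : ℂ) : ℂ := (cc (n - 1) a ^ 2 + 2 * cc (n - 1) a) / a

theorem crit_ne_infty {n k : ℕ} {a : ℂ} (ha : a ∈ captureSet n) (hk : k < n) : crit a k ≠ ∞ := by
  intro h
  exact ha.2.2 k hk (by
    show crit a k ∈ Ainf a
    rw [h]; exact infty_mem_Ainf ha.1)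

theorem crit_cc {n k : ℕ} {a : ℂ} (ha : a ∈ captureSet n) (hk : k < n) :
    crit a k = ((cc k a : ℂ) : RSphere) := by
  induction k with
  | zero => rw [crit_zero]; rfl
  | succ k ih =>
    have h1 := ih (by omega)
    have h2 := crit_ne_infty ha hk
    rw [crit_succ, h1] at h2 ⊢
    by_cases h3 : cc k a ^ 2 + 2 * cc k a = 0
    · exfalso; apply h2
      rw [Rhat_coe ha.1, h3, zero_div, toS_zero]
    · rw [Rhat_coe_ne _ _ h3]; rfl

theorem cc_ne {n k : ℕ} {a : ℂ} (ha : a ∈ captureSet n) (hk : k + 1 < n) :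
    cc k a ^ 2 + 2 * cc k a ≠ 0 := by
  intro h
  apply crit_ne_infty ha hk
  rw [crit_succ, crit_cc ha (by omega), Rhat_coe ha.1, h, zero_div, toS_zero]

theorem cc_diff {n k : ℕ} {a : ℂ} (ha : a ∈ captureSet n) (hk : k < n) :
    DifferentiableAt ℂ (cc k) a := by
  induction k with
  | zero => exact differentiableAt_const _
  | succ k ih =>
    have h1 := ih (by omega)
    have h2 := cc_ne ha hk
    show DifferentiableAt ℂ (fun a => a / (cc k a ^ 2 + 2 * cc k a)) a
    exact differentiableAt_id.div ((h1.pow 2).add (h1.const_mul 2)) h2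

theorem PP_diff {n : ℕ} (hn : 2 ≤ n) {a : ℂ} (ha : a ∈ captureSet n) :
    DifferentiableAt ℂ (PP n) a := by
  have h1 := cc_diff ha (k := n - 1) (by omega)
  exact ((h1.pow 2).add (h1.const_mul 2)).div differentiableAt_id ha.1

theorem crit_PP {n : ℕ} (hn : 2 ≤ n) {a : ℂ} (ha : a ∈ captureSet n) : crit a n = toS (PP n a) := by
  obtain ⟨k, rfl⟩ : ∃ k, n = k + 1 := ⟨n - 1, by omega⟩
  rw [crit_succ, crit_cc ha (by omega), Rhat_coe ha.1]; rfl

theorem ph_gg {n : ℕ} (hn : 2 ≤ n) {a : ℂ} (ha : a ∈ captureSet n) : ph a (gg n a) = PP n a := by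
  apply toS_inj
  rw [← crit_PP hn ha]
  exact (gg_spec hn ha).2

theorem ph_gg_eq {n : ℕ} (hn : 2 ≤ n) {a s : ℂ} (ha : a ∈ captureSet n) (hs : ‖s‖ < 1)
    (h : ph a s = PP n a) : gg n a = s :=
  gg_eq hn ha hs (by rw [crit_PP hn ha, psi, h])

theorem strictDiff {E : Type*} [NormedAddCommGroup E] [NormedSpace ℂ E] [FiniteDimensional ℂ E]
    {F : E → ℂ} {U : Set E} (hU : IsOpen U) (hF : DifferentiableOn ℂ F U) {x : E}
    (hx : x ∈ U) : HasStrictFDerivAt F (fderiv ℂ F x) x := by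
  apply hasStrictFDerivAt_of_hasFDerivAt_of_continuousAt (f' := fun y => fderiv ℂ F y)
  · filter_upwards [hU.mem_nhds hx] with y hy
    exact (hF.differentiableAt (hU.mem_nhds hy)).hasFDerivAt
  · have : ContinuousOn (fun y => fderiv ℂ F y) U := by
      rw [continuousOn_clm_apply]
      intro v y hy
      exact (fderiv_apply_differentiableAt hU hF v hy).continuousAt.continuousWithinAt
    exact this.continuousAt (hU.mem_nhds hx)

/-- local structure of `gg` -/
theorem gg_local {n : ℕ} (hn : 2 ≤ n) {a : ℂ} (ha : a ∈ captureSet n) :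
    HasStrictDerivAt (gg n) (deriv (gg n) a) a ∧
    deriv (PP n) a - deriv (fun b => ph b (gg n a)) a = deriv (ph a) (gg n a) * deriv (gg n) a := by
  obtain ⟨m, hm⟩ := exists_rr (norm_nonneg _) (gg_spec hn ha).1
  have haV : a ∈ VV m := captureSet_TT hn ha m
  have hopen : IsOpen ((VV m ∩ captureSet n) ×ˢ Metric.ball (0:ℂ) (rr m)) :=
    ((isOpen_VV m).inter (isOpen_captureSet hn)).prod Metric.isOpen_ball
  set t := gg n a with ht
  let F : ℂ × ℂ → ℂ := fun x => ph x.1 x.2 - PP n x.1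
  have hF : DifferentiableOn ℂ F ((VV m ∩ captureSet n) ×ˢ Metric.ball (0:ℂ) (rr m)) := by
    intro x hx
    have h1 : DifferentiableAt ℂ (fun x : ℂ × ℂ => ph x.1 x.2) x :=
      ph_diff hx.1.1 (by simpa using hx.2)
    have h2 : DifferentiableAt ℂ (fun x : ℂ × ℂ => PP n x.1) x :=
      DifferentiableAt.comp x (g := PP n) (PP_diff hn hx.1.2) differentiableAt_fst
    exact (h1.sub h2).differentiableWithinAt
  have hmem : (a, t) ∈ (VV m ∩ captureSet n) ×ˢ Metric.ball (0:ℂ) (rr m) :=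
    ⟨⟨haV, ha⟩, by simpa using hm⟩
  have hst := strictDiff hopen hF hmem
  have hFd : HasFDerivAt F (fderiv ℂ F (a, t)) (a, t) := hst.hasFDerivAt
  have e2 : fderiv ℂ F (a, t) (0, 1) = deriv (ph a) t := by
    have h1 : HasDerivAt (fun s : ℂ => ((a, s) : ℂ × ℂ)) (0, 1) t :=
      (hasDerivAt_const t a).prodMk (hasDerivAt_id t)
    have h2 := (hFd.comp_hasDerivAt t h1).deriv
    rw [← h2]
    show deriv (fun s => ph a s - PP n a) t = _
    simp
  have hPd := PP_diff hn ha
  have hphd : DifferentiableAt ℂ (fun b => ph b t) a :=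
    DifferentiableAt.comp a (g := fun x : ℂ × ℂ => ph x.1 x.2) (f := fun b : ℂ => (b, t))
      (ph_diff haV hm) (by fun_prop)
  have e1 : fderiv ℂ F (a, t) (1, 0) = deriv (fun b => ph b t) a - deriv (PP n) a := by
    have h1 : HasDerivAt (fun s : ℂ => ((s, t) : ℂ × ℂ)) (1, 0) a :=
      (hasDerivAt_id a).prodMk (hasDerivAt_const a t)
    have h2 := (hFd.comp_hasDerivAt a h1).deriv
    rw [← h2]
    exact deriv_sub hphd hPd
  have hne := ph_deriv_ne haV hm
  have hinv : (fderiv ℂ F (a, t) ∘L .inr ℂ ℂ ℂ).IsInvertible := by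
    refine ⟨ContinuousLinearEquiv.unitsEquivAut ℂ (Units.mk0 _ hne), ?_⟩
    ext
    simp [e2]
  set φ := hst.implicitFunctionOfProdDomain hinv with hφ
  have hφs : HasStrictFDerivAt φ _ a := hst.hasStrictFDerivAt_implicitFunctionOfProdDomain hinv
  have hφt : Tendsto φ (𝓝 a) (𝓝 t) := hst.tendsto_implicitFunctionOfProdDomain hinv
  have hφe : ∀ᶠ b in 𝓝 a, F (b, φ b) = F (a, t) :=
    hst.eventually_apply_implicitFunctionOfProdDomain hinv
  have hF0 : F (a, t) = 0 := by
    show ph a t - PP n a = 0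
    rw [ht, ph_gg hn ha, sub_self]
  have heq : φ =ᶠ[𝓝 a] gg n := by
    filter_upwards [hφe, (isOpen_captureSet hn).mem_nhds ha,
      hφt.norm.eventually_lt_const hm] with b h1 h2 h3
    rw [hF0] at h1
    exact (ph_gg_eq hn h2 (h3.trans (rr_bounds m).2) (sub_eq_zero.1 h1)).symm
  have hgs := hφs.congr_of_eventuallyEq heq
  have hgs' := hgs.hasStrictDerivAt
  have hd := hgs'.hasDerivAt.deriv
  refine ⟨by rw [hd]; exact hgs', ?_⟩
  have hgd : HasDerivAt (gg n) (deriv (gg n) a) a := hgs'.hasDerivAt.differentiableAt.hasDerivAt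
  have h1 : HasDerivAt (fun b : ℂ => ((b, gg n b) : ℂ × ℂ)) (1, deriv (gg n) a) a :=
    (hasDerivAt_id a).prodMk hgd
  have h2 := HasFDerivAt.comp_hasDerivAt a (l := F) (f := fun b : ℂ => ((b, gg n b) : ℂ × ℂ)) hFd h1
  have h3 : F ∘ (fun b : ℂ => ((b, gg n b) : ℂ × ℂ)) =ᶠ[𝓝 a] fun _ => 0 := by
    filter_upwards [(isOpen_captureSet hn).mem_nhds ha] with b hb
    show ph b (gg n b) - PP n b = 0
    rw [ph_gg hn hb, sub_self]
  have h4 := h2.deriv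
  rw [h3.deriv_eq, deriv_const] at h4
  have e3 : ((1, deriv (gg n) a) : ℂ × ℂ) = (1, 0) + deriv (gg n) a • ((0, 1) : ℂ × ℂ) := by
    ext <;> simp
  rw [e3, map_add, _root_.map_smul, e1, e2, smul_eq_mul] at h4
  linear_combination h4

end

section
open Filter Topology OnePoint

theorem isLocalHomeomorphOn_of_deriv {g : ℂ → ℂ} {S : Set ℂ} (h : ∀ a ∈ S,
    HasStrictDerivAt g (deriv g a) a ∧ deriv g a ≠ 0) : IsLocalHomeomorphOn g S := by
  intro a ha
  have h1 := (h a ha).1.hasStrictFDerivAt_equiv (h a ha).2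
  exact ⟨h1.toOpenPartialHomeomorph g, h1.mem_toOpenPartialHomeomorph_source,
    h1.toOpenPartialHomeomorph_coe.symm⟩

theorem final_assembly (n : ℕ) (hn : 2 ≤ n) (htr : ∀ a ∈ captureSet n, deriv (gg n) a ≠ 0)
    (P : Set ℂ) (hP : IsParabubble n P) :
    IsOpen P ∧ SimplyConnectedSpace ↥P ∧
    (∃! a₀ : ℂ, a₀ ∈ P ∧ (Rhat a₀)^[n] ((-1 : ℂ) : RSphere) = ∞) := by
  obtain ⟨a, ha, rfl⟩ := hP
  set P := connectedComponentIn (captureSet n) a with hPdef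
  have hPo : IsOpen P := (isOpen_captureSet hn).connectedComponentIn
  have hPs : P ⊆ captureSet n := connectedComponentIn_subset _ _
  have haP : a ∈ P := mem_connectedComponentIn ha
  have hco : IsOpen (captureSet n \ P) := by
    rw [isOpen_iff_mem_nhds]
    rintro b ⟨hb, hbP⟩
    refine mem_of_superset ((isOpen_captureSet hn).connectedComponentIn.mem_nhds
      (mem_connectedComponentIn hb)) ?_
    intro x hx
    refine ⟨connectedComponentIn_subset _ _ hx, fun hxP => hbP ?_⟩
    rw [hPdef, connectedComponentIn_eq hxP, ← connectedComponentIn_eq hx]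
    exact mem_connectedComponentIn hb
  have hpre : IsPreconnected P := isPreconnected_connectedComponentIn
  have : ConnectedSpace P := isConnected_iff_connectedSpace.1 ⟨⟨a, haP⟩, hpre⟩
  let D : Set ℂ := Metric.ball (0 : ℂ) 1
  have hDo : IsOpen D := Metric.isOpen_ball
  have hgD : ∀ x : P, gg n x ∈ D := fun x => by simpa [D] using (gg_spec hn (hPs x.2)).1
  let G : P → D := fun x => ⟨gg n x, hgD x⟩
  have hlocal := fun b (hb : b ∈ captureSet n) => (gg_local hn hb).1
  have hgc : Continuous fun x : P => gg n x := by
    rw [continuous_iff_continuousAt]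
    intro x
    exact ContinuousAt.comp (hlocal x (hPs x.2)).hasDerivAt.continuousAt
      continuous_subtype_val.continuousAt
  have hGc : Continuous G := hgc.subtype_mk _
  have hv : IsLocalHomeomorph (Subtype.val : P → ℂ) := hPo.isOpenEmbedding_subtypeVal.isLocalHomeomorph
  have hvD : IsLocalHomeomorph (Subtype.val : D → ℂ) := hDo.isOpenEmbedding_subtypeVal.isLocalHomeomorph
  have hGl : IsLocalHomeomorph G := by
    refine IsLocalHomeomorph.of_comp (g := (Subtype.val : D → ℂ)) ?_ hvD hGc
    have h1 : IsLocalHomeomorphOn (gg n) P :=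
      isLocalHomeomorphOn_of_deriv fun b hb => ⟨hlocal b (hPs hb), htr b (hPs hb)⟩
    rw [isLocalHomeomorph_iff_isLocalHomeomorphOn_univ] at hv ⊢
    exact h1.comp hv fun x _ => x.2
  have hprop : IsProperMap G := by
    rw [isProperMap_iff_isCompact_preimage]
    refine ⟨hGc, fun K hK => ?_⟩
    rw [Subtype.isCompact_iff]
    have hK' : IsCompact (Subtype.val '' K) := hK.image continuous_subtype_val
    have hKD : Subtype.val '' K ⊆ Metric.ball (0:ℂ) 1 := by
      rintro _ ⟨x, -, rfl⟩; exact x.2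
    have h1 := gg_proper hn hK' hKD
    have h2 := h1.inter_right hco.isClosed_compl
    convert h2 using 1
    ext x
    constructor
    · rintro ⟨y, hy, rfl⟩
      exact ⟨⟨hPs y.2, ⟨_, hy, rfl⟩⟩, fun h => h.2 y.2⟩
    · rintro ⟨⟨hx1, ⟨k, hk, hk2⟩⟩, hx2⟩
      have hxP : x ∈ P := by
        by_contra hcon
        exact hx2 ⟨hx1, hcon⟩
      refine ⟨⟨x, hxP⟩, ?_, rfl⟩
      show G ⟨x, hxP⟩ ∈ K
      have : G ⟨x, hxP⟩ = k := Subtype.ext hk2.symm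
      rwa [this]
  have hfin : ∀ x ∈ (Set.univ : Set D), (G ⁻¹' {x}).Finite := by
    intro x _
    have h1 : IsCompact (G ⁻¹' {x}) := hprop.isCompact_preimage isCompact_singleton
    refine h1.finite ?_
    refine IsDiscrete.of_openPartialHomeomorph G (x := x) subset_rfl fun e he => ?_
    obtain ⟨φ, hφ, hφ2⟩ := hGl e
    exact ⟨φ, hφ, hφ2.symm⟩
  have hcov : IsCoveringMap G := by
    rw [isCoveringMap_iff_isCoveringMapOn_univ]
    exact hprop.isClosedMap.isCoveringMapOn_of_isLocalHomeomorphOn hfin fun x _ => hGl x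
  have : ContractibleSpace D := (convex_ball (0:ℂ) 1).contractibleSpace ⟨0, by simp⟩
  have : LocallyPathConnectedSpace D := hDo.locallyPathConnectedSpace
  obtain ⟨F, ⟨hF1, hF2⟩, -⟩ := hcov.existsUnique_continuousMap_lifts (ContinuousMap.id D)
    (G ⟨a, haP⟩) ⟨a, haP⟩ rfl
  have hGF : ∀ x, G (F x) = x := fun x => congrFun hF2 x
  have hFG : F ∘ G = id := by
    refine hcov.eq_of_comp_eq (F.continuous.comp hGc) continuous_id ?_ ⟨a, haP⟩ hF1
    funext x
    exact hGF (G x)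
  let e : P ≃ₜ D :=
    { toFun := G
      invFun := F
      left_inv := fun x => congrFun hFG x
      right_inv := hGF
      continuous_toFun := hGc
      continuous_invFun := F.continuous }
  refine ⟨hPo, ?_, ?_⟩
  · have : ContractibleSpace P := e.toHomotopyEquiv.contractibleSpace
    infer_instance
  · have h0 : (0:ℂ) ∈ D := by simp [D]
    refine ⟨(F ⟨0, h0⟩ : ℂ), ⟨(F ⟨0, h0⟩).2, ?_⟩, ?_⟩
    · have : gg n (F ⟨0, h0⟩) = 0 := congrArg Subtype.val (hGF ⟨0, h0⟩)
      exact (gg_zero_iff hn (hPs (F ⟨0, h0⟩).2)).1 this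
    · rintro y ⟨hyP, hy⟩
      have h1 : gg n y = 0 := (gg_zero_iff hn (hPs hyP)).2 hy
      have h2 : G ⟨y, hyP⟩ = ⟨0, h0⟩ := Subtype.ext h1
      have h3 : F (G ⟨y, hyP⟩) = ⟨y, hyP⟩ := congrFun hFG _
      rw [← h2, h3]

end

section
open Filter Topology OnePoint
open MeasureTheory

theorem circle_mean {Q : ℂ → ℂ} {w : ℂ} {R r : ℝ} (hQ : DifferentiableOn ℂ Q (Metric.ball w R))
    (hr0 : 0 < r) (hr : r < R) :
    ENNReal.ofReal (2 * Real.pi) * ‖Q w‖ₑ ≤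
      ∫⁻ θ in Set.Ioo (-Real.pi) Real.pi, ‖Q (circleMap w r θ)‖ₑ := by
  have hd : DiffContOnCl ℂ Q (Metric.ball w |r|) := by
    rw [abs_of_pos hr0]
    apply (hQ.mono ?_).diffContOnCl
    rw [closure_ball _ hr0.ne']
    exact Metric.closedBall_subset_ball hr
  have h1 := hd.circleAverage
  have hper : Function.Periodic (fun θ => Q (circleMap w r θ)) (2 * Real.pi) := fun θ => by
    simp only [periodic_circleMap w r θ]
  have h2 : ∫ θ in (0:ℝ)..2 * Real.pi, Q (circleMap w r θ) =
      ∫ θ in Set.Ioo (-Real.pi) Real.pi, Q (circleMap w r θ) := by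
    have := hper.intervalIntegral_add_eq 0 (-Real.pi)
    rw [zero_add] at this
    rw [this, intervalIntegral.integral_of_le (by linarith [Real.pi_pos]),
      integral_Ioc_eq_integral_Ioo]
    congr 2
    ring_nf
  rw [Real.circleAverage_def, h2] at h1
  have h3 : (2 * Real.pi : ℝ) • Q w = ∫ θ in Set.Ioo (-Real.pi) Real.pi, Q (circleMap w r θ) := by
    rw [← h1, smul_smul, mul_inv_cancel₀ (by positivity), one_smul]
  have h4 : ‖(2 * Real.pi : ℝ) • Q w‖ₑ ≤ _ := h3 ▸ enorm_integral_le_lintegral_enorm _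
  rwa [enorm_smul, Real.enorm_eq_ofReal (by positivity)] at h4

theorem ball_mean {Q : ℂ → ℂ} {w : ℂ} {R : ℝ} (hQm : Measurable Q) (hR : 0 < R)
    (hQ : DifferentiableOn ℂ Q (Metric.ball w R)) :
    ENNReal.ofReal (R ^ 2) * ‖Q w‖ₑ ≤ ∫⁻ z in Metric.ball w R, ‖Q z‖ₑ := by
  have e1 : ∫⁻ z in Metric.ball w R, ‖Q z‖ₑ =
      ∫⁻ z, (Metric.ball w R).indicator (fun z => ‖Q z‖ₑ) (w + z) := by
    rw [lintegral_add_left_eq_self (μ := volume)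
      (fun z => (Metric.ball w R).indicator (fun z => ‖Q z‖ₑ) z) w,
      lintegral_indicator Metric.isOpen_ball.measurableSet]
  rw [e1, ← Complex.lintegral_comp_polarCoord_symm]
  have hsub : Set.Ioo (R / 2) R ×ˢ Set.Ioo (-Real.pi) Real.pi ⊆ polarCoord.target := by
    rintro ⟨r, θ⟩ ⟨hr, hθ⟩
    exact ⟨lt_trans (by positivity) hr.1, hθ⟩
  refine le_trans ?_ (lintegral_mono_set hsub)
  have e2 : ∀ p ∈ Set.Ioo (R / 2) R ×ˢ Set.Ioo (-Real.pi) Real.pi,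
      ENNReal.ofReal (R / 2) * ‖Q (circleMap w p.1 p.2)‖ₑ ≤
      ENNReal.ofReal p.1 • (Metric.ball w R).indicator (fun z => ‖Q z‖ₑ)
        (w + Complex.polarCoord.symm p) := by
    rintro ⟨r, θ⟩ ⟨hr, hθ⟩
    have hr0 : 0 < r := lt_trans (by positivity) hr.1
    have e : w + Complex.polarCoord.symm (r, θ) = circleMap w r θ := by
      rw [Complex.polarCoord_symm_apply, circleMap, Complex.exp_mul_I]
      simp
    rw [e, Set.indicator_of_mem (by
      rw [Metric.mem_ball, dist_eq_norm, circleMap_sub_center, norm_circleMap_zero,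
        abs_of_pos hr0]
      exact hr.2)]
    simp only [smul_eq_mul]
    gcongr
    exact hr.1.le
  refine le_trans ?_ (setLIntegral_mono' (measurableSet_Ioo.prod measurableSet_Ioo) e2)
  have hmeas : Measurable fun p : ℝ × ℝ => ENNReal.ofReal (R / 2) * ‖Q (circleMap w p.1 p.2)‖ₑ := by
    have : Measurable fun p : ℝ × ℝ => circleMap w p.1 p.2 := by
      have : Continuous fun p : ℝ × ℝ => circleMap w p.1 p.2 := by
        unfold circleMap; fun_prop
      exact this.measurable
    exact (hQm.comp this).enorm.const_mul _
  rw [Measure.volume_eq_prod, ← Measure.prod_restrict,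
    lintegral_prod _ hmeas.aemeasurable]
  have h3 : ∀ r ∈ Set.Ioo (R / 2) R, ENNReal.ofReal (R / 2) *
      (ENNReal.ofReal (2 * Real.pi) * ‖Q w‖ₑ) ≤
      ∫⁻ θ in Set.Ioo (-Real.pi) Real.pi, ENNReal.ofReal (R / 2) * ‖Q (circleMap w r θ)‖ₑ := by
    intro r hr
    rw [lintegral_const_mul' _ _ ENNReal.ofReal_ne_top]
    gcongr
    exact circle_mean hQ (lt_trans (by positivity) hr.1) hr.2
  refine le_trans ?_ (setLIntegral_mono' measurableSet_Ioo h3)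
  rw [setLIntegral_const, Real.volume_Ioo, mul_comm _ (ENNReal.ofReal (R - R / 2)), ← mul_assoc,
    ← mul_assoc, ← ENNReal.ofReal_mul (by linarith), ← ENNReal.ofReal_mul (by nlinarith)]
  gcongr
  nlinarith [Real.pi_gt_three, sq_nonneg R]

theorem lintegral_inv_lt_top (x : ℂ) (R : ℝ) :
    ∫⁻ z in Metric.ball x R, ‖(z - x)⁻¹‖ₑ < ⊤ := by
  have e1 : ∫⁻ z in Metric.ball x R, ‖(z - x)⁻¹‖ₑ =
      ∫⁻ z, (Metric.ball x R).indicator (fun z => ‖(z - x)⁻¹‖ₑ) (x + z) := by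
    rw [lintegral_add_left_eq_self (μ := volume)
      (fun z => (Metric.ball x R).indicator (fun z => ‖(z - x)⁻¹‖ₑ) z) x,
      lintegral_indicator Metric.isOpen_ball.measurableSet]
  rw [e1, ← Complex.lintegral_comp_polarCoord_symm]
  have e2 : ∀ p ∈ polarCoord.target, ENNReal.ofReal p.1 •
      (Metric.ball x R).indicator (fun z => ‖(z - x)⁻¹‖ₑ) (x + Complex.polarCoord.symm p) ≤
      (Set.Ioo 0 R ×ˢ Set.Ioo (-Real.pi) Real.pi).indicator (fun _ => 1) p := by
    rintro ⟨r, θ⟩ ⟨hr, hθ⟩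
    have hr0 : 0 < r := hr
    have e : x + Complex.polarCoord.symm (r, θ) = circleMap x r θ := by
      rw [Complex.polarCoord_symm_apply, circleMap, Complex.exp_mul_I]
      simp
    rw [e]
    by_cases hm : circleMap x r θ ∈ Metric.ball x R
    · rw [Set.indicator_of_mem hm]
      rw [Metric.mem_ball, dist_eq_norm, circleMap_sub_center, norm_circleMap_zero,
        abs_of_pos hr0] at hm
      rw [Set.indicator_of_mem (show ((r, θ) : ℝ × ℝ) ∈ Set.Ioo 0 R ×ˢ Set.Ioo (-Real.pi) Real.pi from
        ⟨⟨hr0, hm⟩, hθ⟩), circleMap_sub_center, ← ofReal_norm,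
        norm_inv, norm_circleMap_zero, abs_of_pos hr0, smul_eq_mul,
        ← ENNReal.ofReal_mul hr0.le, mul_inv_cancel₀ hr0.ne', ENNReal.ofReal_one]
    · rw [Set.indicator_of_notMem hm]; simp
  refine lt_of_le_of_lt (setLIntegral_mono' polarCoord.open_target.measurableSet e2) ?_
  refine lt_of_le_of_lt (setLIntegral_le_lintegral _ _) ?_
  rw [lintegral_indicator (measurableSet_Ioo.prod measurableSet_Ioo), setLIntegral_one,
    Measure.volume_eq_prod, Measure.prod_prod, Real.volume_Ioo, Real.volume_Ioo]
  exact ENNReal.mul_lt_top ENNReal.ofReal_lt_top ENNReal.ofReal_lt_top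

/-- integrability of the basic quadratic differential -/
theorem lintegral_d_lt_top {Ω : Set ℂ} (hb : Bornology.IsBounded Ω) {δ : ℝ} (hδ : 0 < δ)
    (h0 : ∀ z ∈ Ω, δ ≤ ‖z‖) (hm : MeasurableSet Ω) {c : ℂ} (hc : c ≠ -2) :
    ∫⁻ z in Ω, ‖1 / (z * (z + 2) * (z - c))‖ₑ < ⊤ := by
  obtain ⟨R1, hR1⟩ := hb.subset_ball (-2)
  obtain ⟨R2, hR2⟩ := hb.subset_ball c
  set K : ℂ := 1 / ((δ : ℂ) * (c + 2)) with hK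
  have hc2 : c + 2 ≠ 0 := fun h => hc (by linear_combination h)
  have hpt : ∀ z ∈ Ω, ‖1 / (z * (z + 2) * (z - c))‖ₑ ≤
      ‖K‖ₑ * (‖(z - -2)⁻¹‖ₑ + ‖(z - c)⁻¹‖ₑ) + ‖(0:ℂ)‖ₑ := by
    intro z hz
    have hz0 : z ≠ 0 := fun h => by have := h0 z hz; rw [h] at this; simp at this; linarith
    rw [enorm_zero, add_zero]
    by_cases h1 : z + 2 = 0
    · simp [h1]
    by_cases h2 : z - c = 0
    · simp [h2]
    have e : 1 / (z * (z + 2) * (z - c)) = (δ / z) * (K * ((z - c)⁻¹ - (z - -2)⁻¹)) := by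
      have hδ' : (δ : ℂ) ≠ 0 := by exact_mod_cast hδ.ne'
      rw [hK, sub_neg_eq_add]
      field_simp
      ring
    rw [e, enorm_mul, enorm_mul]
    have h3 : ‖(δ : ℂ) / z‖ₑ ≤ 1 := by
      rw [← ofReal_norm, ← ENNReal.ofReal_one]
      apply ENNReal.ofReal_le_ofReal
      rw [norm_div, Complex.norm_real, Real.norm_of_nonneg hδ.le,
        div_le_one (norm_pos_iff.2 hz0)]
      exact h0 z hz
    calc _ ≤ 1 * (‖K‖ₑ * (‖(z - c)⁻¹‖ₑ + ‖(z - -2)⁻¹‖ₑ)) := by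
          gcongr; exact enorm_sub_le
      _ = _ := by rw [one_mul, add_comm]
  refine lt_of_le_of_lt (setLIntegral_mono' hm hpt) ?_
  simp only [enorm_zero, add_zero]
  rw [lintegral_const_mul' _ _ enorm_ne_top]
  refine ENNReal.mul_lt_top enorm_lt_top ?_
  rw [lintegral_add_left (by fun_prop)]
  exact ENNReal.add_lt_top.2 ⟨lt_of_le_of_lt (lintegral_mono_set hR1) (lintegral_inv_lt_top _ _),
    lt_of_le_of_lt (lintegral_mono_set hR2) (lintegral_inv_lt_top _ _)⟩

end

section
open Filter Topology OnePoint
open MeasureTheory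

theorem abs_det_mul (c : ℂ) :
    |((ContinuousLinearMap.toSpanSingleton ℂ c).restrictScalars ℝ : ℂ →L[ℝ] ℂ).det| = ‖c‖ ^ 2 := by
  have : ((ContinuousLinearMap.toSpanSingleton ℂ c).restrictScalars ℝ : ℂ →L[ℝ] ℂ).det
      = ‖c‖ ^ 2 := by
    simp [ContinuousLinearMap.det, LinearMap.det_restrictScalars, Algebra.norm_complex_apply,
      Complex.normSq_eq_norm_sq]
  rw [this, abs_of_nonneg (by positivity)]

noncomputable def ff (a : ℂ) (z : ℂ) : ℂ := a / (z ^ 2 + 2 * z)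
noncomputable def ff' (a : ℂ) (z : ℂ) : ℂ := -a * (2 * z + 2) / (z ^ 2 + 2 * z) ^ 2

theorem measurable_ff (a : ℂ) : Measurable (ff a) := by
  unfold ff; fun_prop

theorem ff_hasDerivAt {a w : ℂ} (h : w ^ 2 + 2 * w ≠ 0) : HasDerivAt (ff a) (ff' a w) w := by
  have h1 : HasDerivAt (fun z : ℂ => z ^ 2 + 2 * z) (2 * w + 2) w := by
    have := (hasDerivAt_pow 2 w).add ((hasDerivAt_id' w).const_mul 2)
    refine HasDerivAt.congr_deriv this ?_
    simp
  refine HasDerivAt.congr_deriv ((hasDerivAt_const w a).div h1 h) ?_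
  unfold ff'
  ring

theorem ff_inj {a w w' : ℂ} (ha : a ≠ 0) (h : w ^ 2 + 2 * w ≠ 0) (h' : w' ^ 2 + 2 * w' ≠ 0)
    (hr : -1 < w.re) (hr' : -1 < w'.re) (he : ff a w = ff a w') : w = w' := by
  unfold ff at he
  rw [div_eq_div_iff h h'] at he
  have h1 := mul_left_cancel₀ ha he
  have h2 : (w - w') * (w + w' + 2) = 0 := by linear_combination -h1
  rcases mul_eq_zero.1 h2 with h3 | h3
  · exact sub_eq_zero.1 h3
  · have := congrArg Complex.re h3
    simp at this
    linarith

theorem refl_mp : MeasurePreserving (fun w : ℂ => -2 - w) volume volume :=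
  Measure.measurePreserving_sub_left volume (-2 : ℂ)

theorem L1_contract {a : ℂ} (ha : a ≠ 0) {Ω : Set ℂ} (hΩ : MeasurableSet Ω) (h0 : (0:ℂ) ∉ Ω)
    {q q' : ℂ → ℂ} (hq : Measurable q) {F : Set ℂ} (hF : F.Countable)
    (push : ∀ w, w ∉ F → ff a w ∈ Ω → ff' a w ^ 2 * q' (ff a w) = q w + q (-2 - w)) :
    ∫⁻ z in Ω, ‖q' z‖ₑ ≤ ∫⁻ z in ff a ⁻¹' Ω, ‖q z‖ₑ := by
  have hpre : MeasurableSet (ff a ⁻¹' Ω) := measurable_ff a hΩ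
  have hne : ∀ w ∈ ff a ⁻¹' Ω, w ^ 2 + 2 * w ≠ 0 := by
    intro w hw h
    apply h0
    have : ff a w = 0 := by simp [ff, h]
    rw [← this]; exact hw
  set S := ff a ⁻¹' Ω ∩ {w | -1 < w.re} with hS
  set S' := ff a ⁻¹' Ω ∩ {w | w.re < -1} with hS'
  have hSm : MeasurableSet S := hpre.inter (measurableSet_lt measurable_const Complex.measurable_re)
  have hSm' : MeasurableSet S' :=
    hpre.inter (measurableSet_lt Complex.measurable_re measurable_const)
  set L := ff a ⁻¹' Ω ∩ {w | w.re = -1} with hL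
  have hL0 : volume L = 0 := by
    refine measure_mono_null (Set.inter_subset_right) ?_
    have : {w : ℂ | w.re = -1} = Complex.measurableEquivRealProd ⁻¹' ({-1} ×ˢ Set.univ) := by
      ext w; simp
    rw [this, Complex.volume_preserving_equiv_real_prod.measure_preimage
      ((measurableSet_singleton _).prod MeasurableSet.univ).nullMeasurableSet,
      Measure.volume_eq_prod, Measure.prod_prod]
    simp
  have hfL0 : volume (ff a '' L) = 0 := by
    apply addHaar_image_eq_zero_of_differentiableOn_of_addHaar_eq_zero volume _ hL0
    intro w hw
    exact ((ff_hasDerivAt (hne w hw.1)).differentiableAt.restrictScalars ℝ).differentiableWithinAt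
  have hcov : Ω ⊆ ff a '' S ∪ ff a '' L := by
    intro z hz
    have hz0 : z ≠ 0 := fun h => h0 (h ▸ hz)
    obtain ⟨y, hy⟩ := IsSquare.exists_sq (1 + a / z) (IsAlgClosed.exists_eq_mul_self _)
    have key : ∀ y : ℂ, 1 + a / z = y ^ 2 → ff a (-1 + y) = z := by
      intro y hy
      have : (-1 + y) ^ 2 + 2 * (-1 + y) = a / z := by linear_combination -hy
      simp only [ff, this]
      field_simp
    rcases lt_trichotomy y.re 0 with h | h | h
    · left
      have := key (-y) (by rw [hy]; ring)
      refine ⟨-1 + -y, ⟨?_, ?_⟩, this⟩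
      · show ff a _ ∈ Ω
        rw [this]; exact hz
      · simp; exact h
    · right
      have := key y hy
      refine ⟨-1 + y, ⟨?_, ?_⟩, this⟩
      · show ff a _ ∈ Ω
        rw [this]; exact hz
      · simp; exact h
    · left
      have := key y hy
      refine ⟨-1 + y, ⟨?_, ?_⟩, this⟩
      · show ff a _ ∈ Ω
        rw [this]; exact hz
      · simp; exact h
  have hcv := lintegral_image_eq_lintegral_abs_det_fderiv_mul volume hSm
    (f := ff a) (f' := fun w => (ContinuousLinearMap.toSpanSingleton ℂ (ff' a w)).restrictScalars ℝ)
    (fun w hw => ((ff_hasDerivAt (hne w hw.1)).hasFDerivAt.restrictScalars ℝ).hasFDerivWithinAt)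
    (fun w hw w' hw' he => ff_inj ha (hne w hw.1) (hne w' hw'.1) hw.2 hw'.2 he)
    (fun z => ‖q' z‖ₑ)
  have hSS : ∫⁻ w in S, ‖q (-2 - w)‖ₑ = ∫⁻ w in S', ‖q w‖ₑ := by
    have hpr : (fun w : ℂ => -2 - w) ⁻¹' S' = S := by
      ext w
      have : ff a (-2 - w) = ff a w := by
        simp only [ff]; congr 1; ring
      simp only [hS, hS', Set.mem_preimage, Set.mem_inter_iff, Set.mem_ofPred_eq, this]
      simp
      intro _
      constructor <;> intro h <;> linarith
    rw [← hpr]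
    exact refl_mp.setLIntegral_comp_preimage hSm' (f := fun w => ‖q w‖ₑ) (by fun_prop)
  calc ∫⁻ z in Ω, ‖q' z‖ₑ ≤ ∫⁻ z in ff a '' S ∪ ff a '' L, ‖q' z‖ₑ := lintegral_mono_set hcov
    _ ≤ (∫⁻ z in ff a '' S, ‖q' z‖ₑ) + ∫⁻ z in ff a '' L, ‖q' z‖ₑ := lintegral_union_le _ _ _
    _ = ∫⁻ z in ff a '' S, ‖q' z‖ₑ := by
        rw [setLIntegral_measure_zero _ _ hfL0, add_zero]
    _ ≤ ∫⁻ w in S, (‖q w‖ₑ + ‖q (-2 - w)‖ₑ) := by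
        rw [hcv]
        apply lintegral_mono_ae
        have hFn : ∀ᵐ w ∂(volume.restrict S), w ∉ F :=
          ae_restrict_of_ae (measure_eq_zero_iff_ae_notMem.1 (hF.measure_zero _))
        filter_upwards [hFn, ae_restrict_mem hSm] with w hw hwS
        rw [abs_det_mul, ENNReal.ofReal_pow (norm_nonneg _), ofReal_norm, ← enorm_pow, ← enorm_mul,
          push w hw hwS.1]
        exact enorm_add_le _ _
    _ = (∫⁻ w in S, ‖q w‖ₑ) + ∫⁻ w in S', ‖q w‖ₑ := by
        rw [lintegral_add_left (by fun_prop), hSS]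
    _ = ∫⁻ w in S ∪ S', ‖q w‖ₑ := by
        rw [lintegral_union hSm']
        rw [Set.disjoint_left]
        rintro w ⟨_, h1⟩ ⟨_, h2⟩
        simp at h1 h2
        linarith
    _ ≤ _ := by
        apply lintegral_mono_set
        rintro w (h | h)
        · exact h.1
        · exact h.1

end

section
open Filter Topology OnePoint
open MeasureTheory

theorem vitali_ball {h : ℕ → ℂ → ℂ} {z : ℂ} {R M δ ρ : ℝ}
    (hd : ∀ k, DifferentiableOn ℂ (h k) (Metric.ball z R))
    (hM : ∀ k, ∀ x ∈ Metric.ball z R, ‖h k x‖ ≤ M) (hδ : 0 < δ) (hδR : δ ≤ R)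
    (hu : ∀ ε > 0, ∀ᶠ k in atTop, ∀ x ∈ Metric.ball z δ, ‖h k x‖ ≤ ε) (hρ0 : 0 < ρ) (hρ : ρ < R) :
    ∀ ε > 0, ∀ᶠ k in atTop, ∀ x ∈ Metric.ball z ρ, ‖h k x‖ ≤ ε := by
  obtain ⟨R1, hR1, hR1'⟩ := exists_between hρ
  have hR10 : 0 < R1 := hρ0.trans hR1
  have hM0 : 0 ≤ M := (norm_nonneg _).trans
    (hM 0 z (Metric.mem_ball_self (hR10.trans hR1')))
  set c : ℕ → ℕ → ℝ := fun k j => ‖((j.factorial : ℂ))⁻¹ * iteratedDeriv j (h k) z‖ * ρ ^ j with hc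
  have hcb : ∀ (s : ℝ) (C : ℝ) (k j : ℕ), 0 < s → s < R →
      (∀ x ∈ Metric.sphere z s, ‖h k x‖ ≤ C) → c k j ≤ C * (ρ / s) ^ j := by
    intro s C k j hs hsR hC
    have hdc : DiffContOnCl ℂ (h k) (Metric.ball z s) := by
      apply ((hd k).mono ?_).diffContOnCl
      rw [closure_ball _ hs.ne']
      exact Metric.closedBall_subset_ball hsR
    have h1 := Complex.norm_iteratedDeriv_le_of_forall_mem_sphere_norm_le j hs hdc hC
    have hf : (0:ℝ) < j.factorial := by exact_mod_cast j.factorial_pos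
    have h2 : ‖((j.factorial : ℂ))⁻¹ * iteratedDeriv j (h k) z‖ ≤ C / s ^ j := by
      rw [norm_mul, norm_inv, Complex.norm_natCast]
      calc (j.factorial : ℝ)⁻¹ * ‖iteratedDeriv j (h k) z‖
          ≤ (j.factorial : ℝ)⁻¹ * (j.factorial * C / s ^ j) := by gcongr
        _ = C / s ^ j := by field_simp
    calc c k j ≤ C / s ^ j * ρ ^ j := by
          simp only [hc]; gcongr
      _ = C * (ρ / s) ^ j := by rw [div_pow]; ring
  have hc0 : ∀ k j, 0 ≤ c k j := fun k j => by positivity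
  have hdom : ∀ k j, ‖c k j‖ ≤ M * (ρ / R1) ^ j := by
    intro k j
    rw [Real.norm_of_nonneg (hc0 k j)]
    apply hcb R1 M k j hR10 hR1'
    intro x hx
    apply hM k x
    rw [Metric.mem_sphere] at hx
    rw [Metric.mem_ball, hx]; exact hR1'
  have hsum : Summable (fun j : ℕ => M * (ρ / R1) ^ j) := by
    apply Summable.mul_left
    exact summable_geometric_of_lt_one (by positivity) ((div_lt_one hR10).2 hR1)
  have hlim : ∀ j, Tendsto (fun k => c k j) atTop (𝓝 0) := by
    intro j
    rw [Metric.tendsto_atTop']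
    intro ε hε
    have hA : 0 < (ρ / (δ / 2)) ^ j := by positivity
    have h1 := hu (ε / 2 / (ρ / (δ / 2)) ^ j) (by positivity)
    obtain ⟨N, hN⟩ := eventually_atTop.1 h1
    refine ⟨N, fun k hk => ?_⟩
    rw [Real.dist_eq, sub_zero, abs_of_nonneg (hc0 k j)]
    have h2 := hcb (δ / 2) _ k j (by positivity) (by linarith) (fun x hx => hN k hk.le x (by
      rw [Metric.mem_sphere] at hx
      rw [Metric.mem_ball, hx]; linarith))
    rw [div_mul_cancel₀ _ hA.ne'] at h2
    linarith
  have hts := tendsto_tsum_of_dominated_convergence hsum hlim (Eventually.of_forall hdom)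
  rw [tsum_zero] at hts
  intro ε hε
  filter_upwards [hts.eventually_le_const hε] with k hk x hx
  have hxR : x ∈ Metric.ball z R := Metric.ball_subset_ball hρ.le hx
  have hs := Complex.hasSum_taylorSeries_on_ball (hd k) hxR
  have hsc : Summable (c k) := Summable.of_norm_bounded hsum (hdom k)
  rw [← hs.tsum_eq]
  refine le_trans (tsum_of_norm_bounded hsc.hasSum (fun j => ?_)) hk
  simp only [smul_eq_mul, hc]
  rw [mul_left_comm, norm_mul, mul_comm, norm_pow]
  gcongr
  rw [Metric.mem_ball, dist_eq_norm] at hx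
  exact hx.le

theorem mean_bd {Q q : ℂ → ℂ} {w : ℂ} {R M : ℝ} {A Ω F : Set ℂ} {C : ENNReal}
    (hQm : Measurable Q) (hR : 0 < R) (hA : Metric.ball w R ⊆ A)
    (hAΩ : A ⊆ Ω) (hQ : DifferentiableOn ℂ Q Ω) (hF : F.Countable) (hM : 0 ≤ M)
    (hb : ∀ z ∈ Ω, z ∉ F → ‖Q z‖ ≤ M * ‖q z‖) (hC : C ≠ ⊤) (hI : ∫⁻ z in A, ‖q z‖ₑ ≤ C) :
    ‖Q w‖ ≤ M * C.toReal / R ^ 2 := by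
  have h1 := ball_mean hQm hR (hQ.mono (hA.trans hAΩ))
  have h2 : ∫⁻ z in Metric.ball w R, ‖Q z‖ₑ ≤ ENNReal.ofReal M * C := by
    calc ∫⁻ z in Metric.ball w R, ‖Q z‖ₑ ≤ ∫⁻ z in Metric.ball w R, ENNReal.ofReal M * ‖q z‖ₑ := by
          apply lintegral_mono_ae
          have hFn : ∀ᵐ z ∂(volume.restrict (Metric.ball w R)), z ∉ F :=
            ae_restrict_of_ae (measure_eq_zero_iff_ae_notMem.1 (hF.measure_zero _))
          filter_upwards [hFn, ae_restrict_mem Metric.isOpen_ball.measurableSet] with z hz hzB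
          have := hb z (hAΩ (hA hzB)) hz
          rw [← ofReal_norm, ← ofReal_norm, ← ENNReal.ofReal_mul hM]
          exact ENNReal.ofReal_le_ofReal this
      _ = ENNReal.ofReal M * ∫⁻ z in Metric.ball w R, ‖q z‖ₑ :=
          lintegral_const_mul' _ _ ENNReal.ofReal_ne_top
      _ ≤ ENNReal.ofReal M * C := by
          gcongr
          exact (lintegral_mono_set hA).trans hI
  have h3 := h1.trans h2
  rw [← ofReal_norm, ← ENNReal.ofReal_mul (by positivity), ← ENNReal.ofReal_toReal hC,
    ← ENNReal.ofReal_mul hM, ENNReal.ofReal_le_ofReal_iff (by positivity)] at h3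
  rw [le_div_iff₀ (by positivity)]
  linarith

def SU (Q : ℕ → ℂ → ℂ) (z : ℂ) : Prop :=
  ∃ δ > 0, ∀ ε > 0, ∀ᶠ k in atTop, ∀ x ∈ Metric.ball z δ, ‖Q k x‖ ≤ ε

theorem SU_open {Q : ℕ → ℂ → ℂ} : IsOpen {z | SU Q z} := by
  rw [Metric.isOpen_iff]
  rintro z ⟨δ, hδ, h⟩
  refine ⟨δ / 2, by positivity, fun z' hz' => ⟨δ / 2, by positivity, fun ε hε => ?_⟩⟩
  filter_upwards [h ε hε] with k hk x hx
  apply hk x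
  rw [Metric.mem_ball] at *
  have := dist_triangle x z' z
  linarith

theorem core_A {a : ℂ} (ha : a ≠ 0) {Ω : Set ℂ} (hΩ : IsOpen Ω)
    (h0 : (0:ℂ) ∉ Ω) (h1 : ∀ z, ff a z ∈ Ω → z ∈ Ω)
    (h2 : ∀ x, x ∉ Ω → ∀ᶠ z in 𝓝 x, ff a z ∉ Ω)
    {q Q : ℕ → ℂ → ℂ} (hqm : ∀ k, Measurable (q k)) (hQm : ∀ k, Measurable (Q k))
    (hQ : ∀ k, DifferentiableOn ℂ (Q k) Ω) {F : Set ℂ} (hF : F.Countable) {M : ℝ} (hM : 0 ≤ M)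
    (hb : ∀ k, ∀ z ∈ Ω, z ∉ F → ‖Q k z‖ ≤ M * ‖q k z‖)
    (hI : ∫⁻ z in Ω, ‖q 0 z‖ₑ ≠ ⊤)
    (push : ∀ k, ∃ F' : Set ℂ, F'.Countable ∧
      ∀ w, w ∉ F' → ff a w ∈ Ω → ff' a w ^ 2 * q (k + 1) (ff a w) = q k w + q k (-2 - w)) :
    ∀ z ∈ Ω, SU Q z := by
  set D := Ω \ ff a ⁻¹' Ω with hD
  have hpre : MeasurableSet (ff a ⁻¹' Ω) := measurable_ff a hΩ.measurableSet
  have hDm : MeasurableSet D := hΩ.measurableSet.diff hpre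
  have hpΩ : ff a ⁻¹' Ω ⊆ Ω := fun z hz => h1 z hz
  set I : ℕ → ENNReal := fun k => ∫⁻ z in Ω, ‖q k z‖ₑ with hIdef
  set E : ℕ → ENNReal := fun k => ∫⁻ z in D, ‖q k z‖ₑ with hEdef
  have hEI : ∀ k, E k + I (k + 1) ≤ I k := by
    intro k
    obtain ⟨F', hF', hp⟩ := push k
    have h3 := L1_contract ha hΩ.measurableSet h0 (hqm k) hF' hp
    calc E k + I (k + 1) ≤ E k + ∫⁻ z in ff a ⁻¹' Ω, ‖q k z‖ₑ := by gcongr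
      _ = ∫⁻ z in D ∪ ff a ⁻¹' Ω, ‖q k z‖ₑ := by
          rw [lintegral_union hpre]
          exact Set.disjoint_sdiff_left
      _ = I k := by rw [hD, Set.sdiff_union_of_subset hpΩ]
  have hsumE : ∀ n, (∑ k ∈ Finset.range n, E k) + I n ≤ I 0 := by
    intro n
    induction n with
    | zero => simp
    | succ n ih =>
      rw [Finset.sum_range_succ, add_assoc]
      exact le_trans (add_le_add le_rfl (hEI n)) ih
  have hE0 : Tendsto E atTop (𝓝 0) := by
    apply ENNReal.tendsto_atTop_zero_of_tsum_ne_top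
    apply ne_top_of_le_ne_top hI
    exact ENNReal.tsum_le_of_sum_range_le fun n => le_self_add.trans (hsumE n)
  have hIle : ∀ k, I k ≤ I 0 := fun k => le_add_self.trans (hsumE k)
  have hEle : ∀ k, E k ≠ ⊤ := fun k =>
    ne_top_of_le_ne_top hI ((le_self_add.trans (hEI k)).trans (hIle k))
  have hEt : Tendsto (fun k => (E k).toReal) atTop (𝓝 0) := by
    have := (ENNReal.tendsto_toReal ENNReal.zero_ne_top).comp hE0
    exact this
  -- interior of `D` consists of points with local uniform convergence
  have hInt : ∀ z ∈ interior D, SU Q z := by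
    intro z hz
    obtain ⟨r, hr, hrD⟩ := Metric.isOpen_iff.1 isOpen_interior z hz
    refine ⟨r / 2, by positivity, fun ε hε => ?_⟩
    have ht : Tendsto (fun k => M * (E k).toReal / (r / 2) ^ 2) atTop (𝓝 0) := by
      simpa using (hEt.const_mul M).div_const ((r / 2) ^ 2)
    filter_upwards [ht.eventually_le_const hε] with k hk x hx
    refine le_trans (mean_bd (hQm k) (half_pos hr) (A := D) ?_ Set.sdiff_subset (hQ k) hF hM (hb k)
      (hEle k) le_rfl) hk
    intro y hy
    apply interior_subset
    apply hrD
    rw [Metric.mem_ball] at *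
    have := dist_triangle y x z
    linarith
  -- closedness
  have hclosed : ∀ z ∈ Ω, z ∈ closure {z | SU Q z} → SU Q z := by
    intro z hz hzc
    obtain ⟨r, hr, hrΩ⟩ := Metric.isOpen_iff.1 hΩ z hz
    obtain ⟨z', ⟨δ, hδ, hu⟩, hzz'⟩ := Metric.mem_closure_iff.1 hzc (r / 8) (by positivity)
    have hsub : ∀ x, dist x z' < r / 2 → Metric.ball x (r / 4) ⊆ Ω := by
      intro x hx y hy
      apply hrΩ
      rw [Metric.mem_ball] at *
      have := dist_triangle y x z
      have := dist_triangle x z' z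
      rw [dist_comm z z'] at hzz'
      linarith
    have hv := vitali_ball (h := Q) (z := z') (R := r / 2) (M := M * (I 0).toReal / (r / 4) ^ 2)
      (δ := min δ (r / 2)) (ρ := r / 4) (fun k => (hQ k).mono (fun x hx =>
        hsub x hx (Metric.mem_ball_self (by positivity))))
      (fun k x hx => mean_bd (hQm k) (by positivity) (hsub x hx) le_rfl (hQ k) hF hM (hb k) hI
        (hIle k)) (by positivity) (min_le_right _ _) (fun ε hε => by
          filter_upwards [hu ε hε] with k hk x hx
          exact hk x (Metric.ball_subset_ball (min_le_left _ _) hx)) (by positivity) (by linarith)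
    refine ⟨r / 8, by positivity, fun ε hε => ?_⟩
    filter_upwards [hv ε hε] with k hk x hx
    apply hk x
    rw [Metric.mem_ball] at *
    have := dist_triangle x z z'
    linarith
  by_contra hcon
  push Not at hcon
  obtain ⟨z₀, hz₀, hz₀n⟩ := hcon
  set Y := Ω \ {z | SU Q z} with hY
  have hYo : IsOpen Y := by
    have : Y = Ω ∩ (closure {z | SU Q z})ᶜ := by
      ext z
      constructor
      · rintro ⟨hz, hzn⟩
        exact ⟨hz, fun h => hzn (hclosed z hz h)⟩
      · rintro ⟨hz, hzn⟩
        exact ⟨hz, fun h => hzn (subset_closure h)⟩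
    rw [this]
    exact hΩ.inter isClosed_closure.isOpen_compl
  have hYne : Y.Nonempty := ⟨z₀, hz₀, hz₀n⟩
  have hfr : (frontier Y).Nonempty := by
    rw [nonempty_frontier_iff]
    refine ⟨hYne, fun h => ?_⟩
    have : (0:ℂ) ∈ Y := h ▸ Set.mem_univ _
    exact h0 this.1
  obtain ⟨x, hx⟩ := hfr
  rw [hYo.frontier_eq] at hx
  have hxΩ : x ∉ Ω := by
    intro hxΩ
    have hsu : SU Q x := by
      by_contra h
      exact hx.2 ⟨hxΩ, h⟩
    obtain ⟨y, hy1, hy2⟩ := mem_closure_iff.1 hx.1 _ SU_open hsu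
    exact hy2.2 hy1
  obtain ⟨U, hU, hUo, hxU⟩ := eventually_nhds_iff.1 (h2 x hxΩ)
  obtain ⟨y, hy1, hy2⟩ := mem_closure_iff.1 hx.1 U hUo hxU
  apply hy2.2
  apply hInt
  have : U ∩ Ω ⊆ D := fun w hw => ⟨hw.2, hU w hw.1⟩
  exact interior_maximal this (hUo.inter hΩ) ⟨hy1, hy2.1⟩

end

section
open Filter Topology OnePoint
open MeasureTheory

noncomputable def dd (x z : ℂ) : ℂ := 1 / (z * (z + 2) * (z - x))

theorem ff'_sq {a u : ℂ} : ff' a (-1 + u) ^ 2 = 4 * a ^ 2 * u ^ 2 / (u ^ 2 - 1) ^ 4 := by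
  unfold ff'
  rw [show (-1 + u) ^ 2 + 2 * (-1 + u) = u ^ 2 - 1 by ring, div_pow]
  ring

theorem push_dd {a x w : ℂ} (ha : a ≠ 0) (hx0 : x ^ 2 + 2 * x ≠ 0) (hx1 : x ≠ -1)
    (hw0 : w ^ 2 + 2 * w ≠ 0) (hw1 : w ≠ -1) (hwx : w ≠ x) (hwx' : w ≠ -2 - x)
    (hf2 : ff a w ≠ -2) :
    ff' a w ^ 2 * ((-(a * (x + 1) / 2) / (x ^ 2 + 2 * x)) / (-a - ff a x) *
      ((-a + 2) * dd (-a) (ff a w) - (ff a x + 2) * dd (ff a x) (ff a w))) =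
    dd x w + dd x (-2 - w) := by
  obtain ⟨u, rfl⟩ : ∃ u, w = -1 + u := ⟨w + 1, by ring⟩
  obtain ⟨y, rfl⟩ : ∃ y, x = -1 + y := ⟨x + 1, by ring⟩
  have hu0 : u ≠ 0 := fun h => hw1 (by rw [h]; ring)
  have hy0 : y ≠ 0 := fun h => hx1 (by rw [h]; ring)
  have hD : (-1 + u) ^ 2 + 2 * (-1 + u) = u ^ 2 - 1 := by ring
  have hE : (-1 + y) ^ 2 + 2 * (-1 + y) = y ^ 2 - 1 := by ring
  rw [hD] at hw0
  rw [hE] at hx0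
  have huy : u - y ≠ 0 := fun h => hwx (by linear_combination h)
  have huy' : u + y ≠ 0 := fun h => hwx' (by linear_combination h)
  rw [ff'_sq]
  simp only [ff, hD, hE, dd] at hf2 ⊢
  set A := u ^ 2 - 1 with hA
  set B := y ^ 2 - 1 with hB
  have hA2 : a + 2 * A ≠ 0 := by
    intro h
    apply hf2
    rw [div_eq_iff hw0]
    linear_combination h
  have hBA : B - A ≠ 0 := by
    rw [show B - A = -((u - y) * (u + y)) by rw [hA, hB]; ring]
    exact neg_ne_zero.2 (mul_ne_zero huy huy')
  have hu2 : u ^ 2 = A + 1 := by rw [hA]; ring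
  have hy2 : y ^ 2 = B + 1 := by rw [hB]; ring
  have hA1 : A + 1 ≠ 0 := by rw [← hu2]; positivity
  have hB1 : B + 1 ≠ 0 := by rw [← hy2]; positivity
  have e1 : a / A - -a = a * (A + 1) / A := by field_simp; ring
  have e2 : a / A - a / B = a * (B - A) / (A * B) := by field_simp
  have e3 : -a - a / B = -(a * (B + 1)) / B := by field_simp; ring
  have e4 : a / A + 2 = (a + 2 * A) / A := by field_simp
  have e5 : -1 + u + 2 = u + 1 := by ring
  have e6 : (-1 + u) * (-1 + u + 2) * (-1 + u - (-1 + y)) = A * (u - y) := by rw [hA]; ring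
  have e7 : (-2 - (-1 + u)) * (-2 - (-1 + u) + 2) * (-2 - (-1 + u) - (-1 + y)) =
    -(A * (u + y)) := by rw [hA]; ring
  rw [e1, e2, e3, e4, e6, e7]
  have hR : 1 / (A * (u - y)) + 1 / -(A * (u + y)) = 2 * y / (A * (A - B)) := by
    rw [show A - B = (u - y) * (u + y) by rw [hA, hB]; ring]
    field_simp
    ring
  have hAB : A - B ≠ 0 := fun h => hBA (by linear_combination -h)
  rw [hR, hu2, show -1 + y + 1 = y by ring]
  have hL : ((-a + 2) * (1 / (a / A * ((a + 2 * A) / A) * (a * (A + 1) / A))) -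
      (a / B + 2) * (1 / (a / A * ((a + 2 * A) / A) * (a * (B - A) / (A * B))))) =
      - A ^ 3 * (B + 1) / (a ^ 2 * (A + 1) * (B - A)) := by
    field_simp
    ring
  rw [hL]
  field_simp
  ring

section alg
variable (a : ℂ) (c v : ℕ → ℂ)

noncomputable def Tv (j : ℕ) : ℕ →₀ ℂ :=
  ((-(a * (c j + 1) / 2) / (c j ^ 2 + 2 * c j)) / (-a - ff a (c j))) •
    (Finsupp.single 1 (-a + 2) - Finsupp.single (j + 1) (ff a (c j) + 2))

noncomputable def gam : ℕ → ℕ →₀ ℂ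
  | 0 => Finsupp.single 1 1
  | k + 1 => Finsupp.linearCombination ℂ (Tv a c) (gam k)

noncomputable def Ev (z : ℂ) : (ℕ →₀ ℂ) →ₗ[ℂ] ℂ := Finsupp.linearCombination ℂ (fun j => dd (c j) z)

noncomputable def Lam : (ℕ →₀ ℂ) →ₗ[ℂ] ℂ :=
  Finsupp.linearCombination ℂ (fun j => v j / (c j * (c j + 2)))

end alg

structure Orb (a : ℂ) (c v : ℕ → ℂ) (J : Set ℕ) : Prop where
  ha : a ≠ 0
  hc1 : c 1 = -a
  h1J : 1 ∈ J
  hJ0 : ∀ j ∈ J, c j ≠ 0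
  hJ2 : ∀ j ∈ J, c j ≠ -2
  hJ1 : ∀ j ∈ J, c j ≠ -1
  hrec : ∀ j ∈ J, c (j + 1) = ff a (c j)
  hJs : ∀ j ∈ J, j + 1 ∈ J ∨ (c (j + 1) = -2 ∧ v (j + 1) = 0)
  hv1 : v 1 = -1
  hvrec : ∀ j ∈ J, v (j + 1) = ff' a (c j) * v j + 1 / (c j ^ 2 + 2 * c j)

namespace Orb
variable {a : ℂ} {c v : ℕ → ℂ} {J : Set ℕ}

theorem D_ne (H : Orb a c v J) {j : ℕ} (hj : j ∈ J) : c j ^ 2 + 2 * c j ≠ 0 := by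
  rw [show c j ^ 2 + 2 * c j = c j * (c j + 2) by ring]
  refine mul_ne_zero (H.hJ0 j hj) (fun h => H.hJ2 j hj (by linear_combination h))

theorem Tv_supp (H : Orb a c v J) {j : ℕ} (hj : j ∈ J) : Tv a c j ∈ Finsupp.supported ℂ ℂ J := by
  unfold Tv
  apply Submodule.smul_mem
  apply Submodule.sub_mem
  · exact Finsupp.single_mem_supported ℂ _ H.h1J
  · rcases H.hJs j hj with h | ⟨h, -⟩
    · exact Finsupp.single_mem_supported ℂ _ h
    · rw [← H.hrec j hj, h]
      simp

theorem gam_supp (H : Orb a c v J) (k : ℕ) : gam a c k ∈ Finsupp.supported ℂ ℂ J := by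
  induction k with
  | zero => exact Finsupp.single_mem_supported ℂ _ H.h1J
  | succ k ih =>
    show Finsupp.linearCombination ℂ (Tv a c) (gam a c k) ∈ _
    rw [Finsupp.linearCombination_apply, Finsupp.sum]
    apply Submodule.sum_mem
    intro j hj
    exact Submodule.smul_mem _ _ (H.Tv_supp (ih hj))

theorem Lam_Tv (H : Orb a c v J) {j : ℕ} (hj : j ∈ J) : Lam c v (Tv a c j) = v j / (c j * (c j + 2)) := by
  have hD := H.D_ne hj
  have ha := H.ha
  have hy : c j + 1 ≠ 0 := fun h => H.hJ1 j hj (by linear_combination h)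
  have h12 : -a + 2 ≠ 0 := fun h => H.hJ2 1 H.h1J (by rw [H.hc1]; linear_combination h)
  have e1 : Lam c v (Finsupp.single 1 (-a + 2)) = 1 / a := by
    simp only [Lam, Finsupp.linearCombination_single, H.hc1, H.hv1, smul_eq_mul]
    field_simp
  have e2 : Lam c v (Finsupp.single (j + 1) (ff a (c j) + 2)) = v (j + 1) / ff a (c j) := by
    simp only [Lam, Finsupp.linearCombination_single, smul_eq_mul, H.hrec j hj]
    rcases H.hJs j hj with h | ⟨h, h'⟩
    · have h3 : ff a (c j) + 2 ≠ 0 := by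
        rw [← H.hrec j hj]
        exact fun h' => H.hJ2 _ h (by linear_combination h')
      have h4 : ff a (c j) ≠ 0 := by
        rw [← H.hrec j hj]
        exact H.hJ0 _ h
      field_simp
    · rw [h']; simp
  rw [Tv, _root_.map_smul, map_sub, e1, e2, H.hvrec j hj]
  rw [show c j * (c j + 2) = c j ^ 2 + 2 * c j by ring]
  unfold ff ff'
  set D := c j ^ 2 + 2 * c j with hDd
  have hy2 : D + 1 ≠ 0 := by
    rw [show D + 1 = (c j + 1) ^ 2 by rw [hDd]; ring]; positivity
  have e3 : -a - a / D = -(a * (D + 1)) / D := by field_simp; ring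
  rw [e3, smul_eq_mul]
  have e4 : 1 / a - (-a * (2 * c j + 2) / D ^ 2 * v j + 1 / D) / (a / D) =
      2 * (c j + 1) * v j / D := by
    field_simp
    ring
  rw [e4, show D + 1 = (c j + 1) ^ 2 by rw [hDd]; ring]
  field_simp

theorem Lam_gam (H : Orb a c v J) (k : ℕ) : Lam c v (gam a c k) = -1 / (c 1 * (c 1 + 2)) := by
  induction k with
  | zero => simp [gam, Lam, H.hv1]
  | succ k ih =>
    rw [← ih]
    show Lam c v (Finsupp.linearCombination ℂ (Tv a c) (gam a c k)) = _
    rw [Finsupp.linearCombination_apply, Finsupp.sum, map_sum]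
    conv_rhs => rw [Lam, Finsupp.linearCombination_apply, Finsupp.sum]
    apply Finset.sum_congr rfl
    intro j hj
    rw [_root_.map_smul, H.Lam_Tv (H.gam_supp k hj)]

theorem push (H : Orb a c v J) (k : ℕ) : ∃ F' : Set ℂ, F'.Countable ∧
      ∀ w, w ∉ F' → ff a w ≠ 0 →
        ff' a w ^ 2 * Ev c (ff a w) (gam a c (k + 1)) =
          Ev c w (gam a c k) + Ev c (-2 - w) (gam a c k) := by
  obtain ⟨y, hy⟩ := IsSquare.exists_sq (1 - a / 2) (IsAlgClosed.exists_eq_mul_self _)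
  refine ⟨{-1, -1 + y, -1 - y} ∪ Set.range c ∪ Set.range (fun j => -2 - c j), ?_, ?_⟩
  · exact ((Set.toFinite _).countable.union (Set.countable_range _)).union (Set.countable_range _)
  · intro w hw hw0
    simp only [Set.mem_union, Set.mem_insert_iff, Set.mem_singleton_iff, Set.mem_range,
      not_or, not_exists] at hw
    obtain ⟨⟨⟨hw1, hw2, hw3⟩, hw4⟩, hw5⟩ := hw
    have hD : w ^ 2 + 2 * w ≠ 0 := by
      intro h
      apply hw0
      simp [ff, h]
    have hf2 : ff a w ≠ -2 := by
      intro h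
      unfold ff at h
      rw [div_eq_iff hD] at h
      have : (w - (-1 + y)) * (w - (-1 - y)) = 0 := by
        linear_combination h / 2 + hy
      rcases mul_eq_zero.1 this with h' | h'
      · exact hw2 (sub_eq_zero.1 h')
      · exact hw3 (sub_eq_zero.1 h')
    show ff' a w ^ 2 * Ev c (ff a w) (Finsupp.linearCombination ℂ (Tv a c) (gam a c k)) = _
    rw [Finsupp.linearCombination_apply, Finsupp.sum, map_sum, Finset.mul_sum]
    conv_rhs => rw [Ev, Ev, Finsupp.linearCombination_apply, Finsupp.linearCombination_apply,
      Finsupp.sum, Finsupp.sum, ← Finset.sum_add_distrib]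
    apply Finset.sum_congr rfl
    intro j hj
    have hjJ : j ∈ J := H.gam_supp k hj
    have hp := push_dd H.ha (H.D_ne hjJ) (H.hJ1 j hjJ) hD hw1 (fun h => hw4 j h.symm)
      (fun h => hw5 j h.symm) hf2
    rw [← smul_add, ← hp, _root_.map_smul, Tv, _root_.map_smul, map_sub]
    simp only [Ev, Finsupp.linearCombination_single, smul_eq_mul, H.hc1, H.hrec j hjJ]
    ring

end Orb

end

section
open Filter Topology OnePoint
open MeasureTheory

structure Dom (a : ℂ) (Ω : Set ℂ) : Prop where
  isOpen : IsOpen Ω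
  bdd : Bornology.IsBounded Ω
  away : ∃ δ > 0, ∀ z ∈ Ω, δ ≤ ‖z‖
  h1 : ∀ z, ff a z ∈ Ω → z ∈ Ω
  h2 : ∀ x, x ∉ Ω → ∀ᶠ z in 𝓝 x, ff a z ∉ Ω

theorem Dom.zero {a : ℂ} {Ω : Set ℂ} (h : Dom a Ω) : (0:ℂ) ∉ Ω := by
  obtain ⟨δ, hδ, hz⟩ := h.away
  intro h0
  have := hz 0 h0
  simp at this
  linarith

theorem SU_compact {Q : ℕ → ℂ → ℂ} {K : Set ℂ} (hK : IsCompact K) (h : ∀ z ∈ K, SU Q z) :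
    ∀ ε > 0, ∀ᶠ k in atTop, ∀ z ∈ K, ‖Q k z‖ ≤ ε := by
  intro ε hε
  refine hK.induction_on (p := fun s => ∀ᶠ k in atTop, ∀ z ∈ s, ‖Q k z‖ ≤ ε) ?_ ?_ ?_ ?_
  · simp
  · intro s t hst ht
    filter_upwards [ht] with k hk z hz using hk z (hst hz)
  · intro s t hs ht
    filter_upwards [hs, ht] with k h1 h2 z hz
    rcases hz with hz | hz
    · exact h1 z hz
    · exact h2 z hz
  · intro z hz
    obtain ⟨δ, hδ, hu⟩ := h z hz
    exact ⟨Metric.ball z δ, mem_nhdsWithin_of_mem_nhds (Metric.ball_mem_nhds z hδ), hu ε hε⟩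

noncomputable def gfun (c : ℕ → ℂ) (o : Finset ℕ) (j : ℕ) (z : ℂ) : ℂ :=
  (if j ∈ o then 1 else 1 / (z - c j)) * (∏ i ∈ o.erase j, (z - c i)) / z

noncomputable def Pfun (c : ℕ → ℂ) (o : Finset ℕ) (z : ℂ) : ℂ := (z + 2) * ∏ i ∈ o, (z - c i)

theorem gfun_eq {c : ℕ → ℂ} {o : Finset ℕ} {j : ℕ} {z : ℂ} (h2 : z ≠ -2)
    (hz : ∀ i ∈ o, z ≠ c i) : gfun c o j z = Pfun c o z * dd (c j) z := by
  have h2' : z + 2 ≠ 0 := fun h => h2 (by linear_combination h)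
  unfold gfun Pfun dd
  split_ifs with hj
  · have hzj : z - c j ≠ 0 := sub_ne_zero.2 (hz j hj)
    rw [← Finset.mul_prod_erase o _ hj]
    by_cases hz0 : z = 0
    · simp [hz0]
    · field_simp
  · rw [Finset.erase_eq_of_notMem hj]
    by_cases hz0 : z = 0
    · simp [hz0]
    by_cases hzj : z - c j = 0
    · simp [hzj]
    · field_simp

theorem gfun_meas (c : ℕ → ℂ) (o : Finset ℕ) (j : ℕ) : Measurable (gfun c o j) := by
  unfold gfun
  split_ifs <;> fun_prop

theorem gfun_diff {c : ℕ → ℂ} {o : Finset ℕ} {j : ℕ} {Ω : Set ℂ} (h0 : (0:ℂ) ∉ Ω)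
    (hj : j ∉ o → c j ∉ Ω) : DifferentiableOn ℂ (gfun c o j) Ω := by
  intro z hz
  have hz0 : z ≠ 0 := fun h => h0 (h ▸ hz)
  apply DifferentiableAt.differentiableWithinAt
  unfold gfun
  split_ifs with h
  · exact DifferentiableAt.fun_div (by fun_prop) differentiableAt_id hz0
  · have : z - c j ≠ 0 := fun h' => hj h (by rw [← sub_eq_zero.1 h']; exact hz)
    refine DifferentiableAt.fun_div (DifferentiableAt.fun_mul ?_ (by fun_prop)) differentiableAt_id hz0
    exact DifferentiableAt.fun_div (by fun_prop) (by fun_prop) this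

theorem core_B {a : ℂ} {c v : ℕ → ℂ} {J : Set ℕ} (H : Orb a c v J) {Ω : Set ℂ} (hΩ : Dom a Ω)
    {o : Finset ℕ} (hoΩ : ∀ i ∈ o, c i ∈ Ω) (hoinj : ∀ i ∈ o, ∀ j ∈ o, c i = c j → i = j)
    (hout : ∀ j ∈ J, j ∉ o → c j ∉ Ω) :
    (∀ i ∈ o, Tendsto (fun k => gam a c k i) atTop (𝓝 0)) ∧
    ∀ K, IsCompact K → K ⊆ Ω → (-2:ℂ) ∉ K → (∀ i ∈ o, c i ∉ K) →
      ∀ ε > 0, ∀ᶠ k in atTop, ∀ z ∈ K, ‖Ev c z (gam a c k)‖ ≤ ε := by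
  set q : ℕ → ℂ → ℂ := fun k z => Ev c z (gam a c k) with hq
  set Q : ℕ → ℂ → ℂ := fun k z => ∑ j ∈ (gam a c k).support, gam a c k j * gfun c o j z with hQ
  have hqs : ∀ k z, q k z = ∑ j ∈ (gam a c k).support, gam a c k j * dd (c j) z := by
    intro k z
    simp only [hq, Ev, Finsupp.linearCombination_apply, Finsupp.sum, smul_eq_mul]
  have hQq : ∀ k z, z ≠ -2 → (∀ i ∈ o, z ≠ c i) → Q k z = Pfun c o z * q k z := by
    intro k z h2 hz
    rw [hqs, Finset.mul_sum]
    apply Finset.sum_congr rfl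
    intro j _
    rw [gfun_eq h2 hz]
    ring
  have hPc : Continuous (Pfun c o) := by unfold Pfun; fun_prop
  obtain ⟨M, hM⟩ := (hΩ.bdd.isCompact_closure).exists_bound_of_continuousOn hPc.continuousOn
  have hddm : ∀ x, Measurable (dd x) := fun x => by unfold dd; fun_prop
  have hqm : ∀ k, Measurable (q k) := by
    intro k
    rw [show q k = fun z => ∑ j ∈ (gam a c k).support, gam a c k j * dd (c j) z from
      funext (hqs k)]
    exact Finset.measurable_fun_sum _ (fun j _ => (hddm _).const_mul _)
  have hSU : ∀ z ∈ Ω, SU Q z := by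
    refine core_A H.ha hΩ.isOpen hΩ.zero hΩ.h1 hΩ.h2 (q := q) (Q := Q) hqm ?_ ?_
      (F := {-2} ∪ (o.image c : Set ℂ)) ?_ (M := max M 0) (le_max_right _ _) ?_ ?_ ?_
    · intro k
      exact Finset.measurable_fun_sum _ (fun j _ => (gfun_meas _ _ _).const_mul _)
    · intro k
      apply DifferentiableOn.fun_sum
      intro j hj
      apply DifferentiableOn.const_mul
      exact gfun_diff hΩ.zero (hout j (H.gam_supp k hj))
    · exact ((Set.finite_singleton _).union (Finset.finite_toSet _)).countable
    · intro k z hz hzF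
      simp only [Set.mem_union, Set.mem_singleton_iff, Finset.coe_image, Set.mem_image,
        not_or, not_exists, not_and] at hzF
      rw [hQq k z hzF.1 (fun i hi h => hzF.2 i hi h.symm), norm_mul]
      gcongr
      exact (hM z (subset_closure hz)).trans (le_max_left _ _)
    · obtain ⟨δ, hδ, hz⟩ := hΩ.away
      have := lintegral_d_lt_top hΩ.bdd hδ hz hΩ.isOpen.measurableSet (H.hJ2 1 H.h1J)
      have e : ∀ z, q 0 z = 1 / (z * (z + 2) * (z - c 1)) := by
        intro z
        simp [hq, gam, Ev, dd]
      simp only [e]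
      exact this.ne
    · intro k
      obtain ⟨F', hF', hp⟩ := H.push k
      exact ⟨F', hF', fun w hw hwΩ => hp w hw (fun h => hΩ.zero (h ▸ hwΩ))⟩
  constructor
  · intro i hi
    have hg : gfun c o i (c i) ≠ 0 := by
      unfold gfun
      rw [if_pos hi, one_mul]
      refine div_ne_zero ?_ (fun h => hΩ.zero (h ▸ hoΩ i hi))
      rw [Finset.prod_ne_zero_iff]
      intro j hj
      rw [Finset.mem_erase] at hj
      exact sub_ne_zero.2 fun h => hj.1 (hoinj i hi j hj.2 h).symm
    have hv : ∀ k, Q k (c i) = gam a c k i * gfun c o i (c i) := by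
      intro k
      simp only [hQ]
      rw [Finset.sum_eq_single i]
      · intro j _ hj
        have : gfun c o j (c i) = 0 := by
          unfold gfun
          rw [Finset.prod_eq_zero (i := i) (Finset.mem_erase.2 ⟨hj.symm, hi⟩) (sub_self _)]
          simp
        rw [this, mul_zero]
      · intro h
        rw [Finsupp.notMem_support_iff.1 h, zero_mul]
    have ht : Tendsto (fun k => Q k (c i)) atTop (𝓝 0) := by
      rw [tendsto_zero_iff_norm_tendsto_zero, Metric.tendsto_atTop']
      intro ε hε
      obtain ⟨δ, hδ, hu⟩ := hSU _ (hoΩ i hi)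
      obtain ⟨N, hN⟩ := eventually_atTop.1 (hu (ε / 2) (by positivity))
      refine ⟨N, fun k hk => ?_⟩
      have := hN k hk.le (c i) (Metric.mem_ball_self hδ)
      rw [Real.dist_eq, sub_zero, abs_of_nonneg (norm_nonneg _)]
      linarith
    have := ht.div_const (gfun c o i (c i))
    rw [zero_div] at this
    refine this.congr (fun k => ?_)
    rw [hv, mul_div_cancel_right₀ _ hg]
  · intro K hK hKΩ h2 hKo ε hε
    rcases K.eq_empty_or_nonempty with rfl | hne
    · simp
    obtain ⟨z₀, hz₀, hmin⟩ := hK.exists_isMinOn hne (hPc.norm.continuousOn)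
    have hP : ∀ z ∈ K, Pfun c o z ≠ 0 := by
      intro z hz
      refine mul_ne_zero (fun h => h2 ?_) ?_
      · rw [show (-2:ℂ) = z by linear_combination -h]; exact hz
      · rw [Finset.prod_ne_zero_iff]
        intro i hi h
        exact hKo i hi (by rw [← sub_eq_zero.1 h]; exact hz)
    have hm : 0 < ‖Pfun c o z₀‖ := norm_pos_iff.2 (hP z₀ hz₀)
    filter_upwards [SU_compact hK (fun z hz => hSU z (hKΩ hz)) (ε * ‖Pfun c o z₀‖)
      (by positivity)] with k hk z hz
    have h3 := hk z hz
    rw [hQq k z (fun h => h2 (h ▸ hz)) (fun i hi h => hKo i hi (h ▸ hz)), norm_mul] at h3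
    have h4 : ‖Pfun c o z₀‖ ≤ ‖Pfun c o z‖ := hmin hz
    have h5 : ‖Pfun c o z₀‖ * ‖q k z‖ ≤ ‖Pfun c o z‖ * ‖q k z‖ := by gcongr
    by_contra hcon
    push Not at hcon
    have : ‖Pfun c o z₀‖ * ε < ‖Pfun c o z₀‖ * ‖q k z‖ := by
      apply mul_lt_mul_of_pos_left hcon hm
    linarith

end

section
open Filter Topology OnePoint
open MeasureTheory

theorem exists_lev {t : ℝ} (h0 : 0 ≤ t) (h1 : t < 1) : ∃ m, t < rr m ^ 2 ∧ t < rr m := by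
  obtain ⟨m, hm⟩ := exists_rr h0 h1
  refine ⟨m + 1, by rw [rr_sq]; exact hm, lt_of_lt_of_le ?_ (rr_sq_le (m + 1))⟩
  rw [rr_sq]; exact hm

theorem exists_lev2 {s t : ℂ} (hs : ‖s‖ < 1) (ht : ‖t‖ < 1) :
    ∃ m, (‖s‖ < rr m ^ 2 ∧ ‖s‖ < rr m) ∧ ‖t‖ < rr m ^ 2 ∧ ‖t‖ < rr m := by
  obtain ⟨m, h1, h2⟩ := exists_lev (t := max ‖s‖ ‖t‖) (by positivity) (max_lt hs ht)
  exact ⟨m, ⟨(le_max_left _ _).trans_lt h1, (le_max_left _ _).trans_lt h2⟩,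
    (le_max_right _ _).trans_lt h1, (le_max_right _ _).trans_lt h2⟩

theorem Rhat_psi_TT {a s : ℂ} (ha : a ∈ TT) (hs : ‖s‖ < 1) :
    Rhat a (psi a s) = ↑(bb a (s ^ 2)) := by
  obtain ⟨m, -, h⟩ := exists_lev (norm_nonneg s) hs
  exact Rhat_psi (ha m) h.le

theorem Rhat_bb_TT {a s : ℂ} (ha : a ∈ TT) (hs : ‖s‖ < 1) : Rhat a ↑(bb a s) = psi a s := by
  obtain ⟨m, h, -⟩ := exists_lev (norm_nonneg s) hs
  exact Rhat_bb (ha m) h.le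

theorem bb_inj_TT {a s t : ℂ} (ha : a ∈ TT) (hs : ‖s‖ < 1) (ht : ‖t‖ < 1)
    (h : bb a s = bb a t) : s = t := by
  obtain ⟨m, h1, h2⟩ := exists_lev2 hs ht
  exact bb_inj (ha m) h1.1.le h2.1.le h

theorem bb_ne_psi_TT {a s t : ℂ} (ha : a ∈ TT) (hs : ‖s‖ < 1) (ht : ‖t‖ < 1) :
    ((bb a s : ℂ) : RSphere) ≠ psi a t := by
  obtain ⟨m, h1, h2⟩ := exists_lev2 hs ht
  exact bb_ne_psi (ha m) h1.1.le h2.2.le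

theorem bb_diff_TT {a s : ℂ} (ha : a ∈ TT) (hs : ‖s‖ < 1) : DifferentiableAt ℂ (bb a) s := by
  obtain ⟨m, h, -⟩ := exists_lev (norm_nonneg s) hs
  have h1 := bb_diff (ha m) h
  exact h1.comp s (f := fun s => (a, s)) (by fun_prop)

theorem ph_diff_TT {a s : ℂ} (ha : a ∈ TT) (hs : ‖s‖ < 1) : DifferentiableAt ℂ (ph a) s := by
  obtain ⟨m, -, h⟩ := exists_lev (norm_nonneg s) hs
  have h1 := ph_diff (ha m) h
  exact h1.comp s (f := fun s => (a, s)) (by fun_prop)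

theorem isOpen_bb_ball {a : ℂ} (ha : a ∈ TT) {t : ℝ} (ht : t ≤ 1) :
    IsOpen (bb a '' Metric.ball 0 t) := by
  have hd : DifferentiableOn ℂ (bb a) (Metric.ball 0 1) := fun s hs =>
    (bb_diff_TT ha (by simpa using hs)).differentiableWithinAt
  rcases (hd.analyticOnNhd Metric.isOpen_ball).is_constant_or_isOpen
    (convex_ball (0:ℂ) 1).isPreconnected with ⟨w, hw⟩ | h
  · exfalso
    have h1 := hw 0 (by simp)
    have h2 := hw (1 / 2) (by simp; norm_num)
    have := bb_inj_TT ha (by simp) (by simp; norm_num) (h1.trans h2.symm)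
    norm_num at this
  · exact h _ (Metric.ball_subset_ball ht) Metric.isOpen_ball

noncomputable def NN (a : ℂ) (r s : ℝ) : Set RSphere :=
  psi a '' Metric.closedBall 0 r ∪ (fun t => ((bb a t : ℂ) : RSphere)) '' Metric.closedBall 0 s

def OO (a : ℂ) (r s : ℝ) : Set ℂ := {z | (z : RSphere) ∉ NN a r s}

theorem ff_Rhat {a z : ℂ} (h : ff a z ≠ 0) : Rhat a (z : RSphere) = ↑(ff a z) := by
  apply Rhat_coe_ne
  intro h'
  apply h
  simp [ff, h']

theorem Dom_OO {a : ℂ} (ha : a ∈ TT) {r s : ℝ} (hs : r ^ 2 < s) (hsr : s < r) (hr : r < 1) :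
    Dom a (OO a r s) := by
  have hr2 : 0 ≤ r ^ 2 := sq_nonneg r
  have hs0 : 0 < s := by linarith
  have hr0 : 0 < r := by linarith
  obtain ⟨m, hm1, hm2⟩ := exists_lev hr0.le hr
  have hNc : IsCompact (NN a r s) := by
    apply IsCompact.union
    · apply (isCompact_closedBall _ _).image_of_continuousOn
      exact (psi_contOn' (ha m)).mono (Metric.closedBall_subset_closedBall hm2.le)
    · apply (isCompact_closedBall _ _).image_of_continuousOn
      intro t ht
      have : ‖t‖ < 1 := by
        rw [mem_closedBall_zero_iff] at ht
        linarith
      exact (OnePoint.continuous_coe.continuousAt.comp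
        (bb_diff_TT ha this).continuousAt).continuousWithinAt
  set U : Set RSphere := psi a '' Metric.ball 0 r ∪
    (fun t => ((bb a t : ℂ) : RSphere)) '' Metric.ball 0 s with hU
  have hUo : IsOpen U := by
    apply IsOpen.union (isOpen_psi_ball (ha m) hr0 hm2.le)
    have := OnePoint.isOpenEmbedding_coe.isOpenMap _ (isOpen_bb_ball ha (t := s) (by linarith))
    rwa [Set.image_image] at this
  have hUN : U ⊆ NN a r s := Set.union_subset_union
    (Set.image_mono Metric.ball_subset_closedBall) (Set.image_mono Metric.ball_subset_closedBall)
  have hN0 : ((0:ℂ) : RSphere) ∈ U := by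
    right
    exact ⟨0, by simpa using hs0, by simp only [bb_zero (ha 0)]⟩
  have hNinf : (∞ : RSphere) ∈ U := by
    left
    exact ⟨0, by simpa using hr0, psi_zero a⟩
  have hRN : ∀ z ∈ NN a r s, Rhat a z ∈ U := by
    rintro z (⟨t, ht, rfl⟩ | ⟨t, ht, rfl⟩)
    · rw [mem_closedBall_zero_iff] at ht
      rw [Rhat_psi_TT ha (by linarith)]
      right
      refine ⟨t ^ 2, ?_, rfl⟩
      rw [mem_ball_zero_iff, norm_pow]
      have : ‖t‖ ^ 2 ≤ r ^ 2 := by gcongr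
      linarith
    · rw [mem_closedBall_zero_iff] at ht
      show Rhat a ((bb a t : ℂ) : RSphere) ∈ U
      rw [Rhat_bb_TT ha (by linarith)]
      left
      exact ⟨t, by rw [mem_ball_zero_iff]; linarith, rfl⟩
  have hff : ∀ z : ℂ, Rhat a (z : RSphere) ∈ U → ff a z ∉ OO a r s := by
    intro z hz h
    by_cases h0 : ff a z = 0
    · rw [h0] at h
      exact h (hUN hN0)
    · rw [ff_Rhat h0] at hz
      exact h (hUN hz)
  constructor
  · exact hNc.isClosed.isOpen_compl.preimage OnePoint.continuous_coe
  · have := ((OnePoint.isOpen_iff_of_mem hNinf).1 hUo).2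
    apply this.isBounded.subset
    intro z hz h
    exact hz (hUN h)
  · have h1 : IsOpen ((fun z : ℂ => (z : RSphere)) ⁻¹' U) := hUo.preimage OnePoint.continuous_coe
    obtain ⟨δ, hδ, hδU⟩ := Metric.isOpen_iff.1 h1 0 hN0
    refine ⟨δ, hδ, fun z hz => ?_⟩
    by_contra hcon
    push Not at hcon
    exact hz (hUN (hδU (by simpa using hcon)))
  · intro z hz
    by_contra hcon
    have : (z : RSphere) ∈ NN a r s := by
      by_contra h
      exact hcon h
    exact hff z (hRN _ this) hz
  · intro x hx
    have hx' : (x : RSphere) ∈ NN a r s := by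
      by_contra h
      exact hx h
    have hc : ContinuousAt (fun z : ℂ => Rhat a (z : RSphere)) x :=
      ((continuous_Rhat (TT_Par ha).1).comp OnePoint.continuous_coe).continuousAt
    filter_upwards [hc.eventually (hUo.mem_nhds (hRN _ hx'))] with z hz
    exact hff z hz

theorem psi_ne_neg_two {a s : ℂ} (ha : a ∈ TT) (hs : ‖s‖ < 1) : psi a s ≠ ((-2 : ℂ) : RSphere) := by
  intro h
  have h1 := Rhat_psi_TT ha hs
  rw [h, Rhat_coe (TT_Par ha).1] at h1
  norm_num [toS_zero] at h1

theorem bb_ne_neg_two {a s : ℂ} (ha : a ∈ TT) (hs : ‖s‖ < 1) : bb a s ≠ -2 := by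
  intro h
  have h1 := Rhat_bb_TT ha hs
  rw [h, Rhat_coe (TT_Par ha).1] at h1
  have h2 : psi a s = psi a 0 := by
    rw [← h1, psi_zero]
    norm_num [toS_zero]
  have h3 := psi_inj_TT ha hs (by simp) h2
  rw [h3, bb_zero (ha 0)] at h
  norm_num at h

theorem cc_not_psi {n i : ℕ} {a s : ℂ} (hn : 2 ≤ n) (ha : a ∈ captureSet n) (hi : i < n)
    (hs : ‖s‖ < 1) : psi a s ≠ (cc i a : RSphere) := by
  intro h
  have h1 := psi_mem_Ainf_TT (captureSet_TT hn ha) hs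
  rw [h, ← crit_cc ha hi] at h1
  exact ha.2.2 i hi h1

theorem cc_not_bb {n i : ℕ} {a s : ℂ} (hn : 2 ≤ n) (ha : a ∈ captureSet n) (hi : i < n)
    (hs : ‖s‖ < 1) : bb a s ≠ cc i a := by
  intro h
  have haT := captureSet_TT hn ha
  have ha0 := (TT_Par haT).1
  have h1 : crit a (i + 1) ∈ Ainf a := by
    rw [crit_succ, crit_cc ha hi, ← h, Rhat_bb_TT haT hs]
    exact psi_mem_Ainf_TT haT hs
  have hin : i + 1 = n := by
    by_contra hne
    exact ha.2.2 (i + 1) (by omega) h1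
  obtain ⟨l, rfl⟩ : ∃ l, i = l + 1 := ⟨i - 1, by omega⟩
  have hR : Rhat a (cc l a : RSphere) = ((bb a s : ℂ) : RSphere) := by
    rw [h, ← crit_cc ha hi, ← crit_cc ha (by omega), crit_succ]
  obtain ⟨t, ht⟩ := IsSquare.exists_sq s (IsAlgClosed.exists_eq_mul_self _)
  have ht1 : ‖t‖ < 1 := by
    rw [ht, norm_pow] at hs
    by_contra hcon
    push Not at hcon
    nlinarith
  have ht1' : ‖-t‖ < 1 := by rwa [norm_neg]
  have hwl := hR
  rw [Rhat_coe ha0] at hR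
  have hs0 : s ≠ 0 := by
    intro h0
    rw [h0, bb_zero (haT 0), toS_eq_coe] at hR
    simp at hR
  have ht0 : t ≠ 0 := by
    rintro rfl
    exact hs0 (by rw [ht]; simp)
  have key : ∀ t : ℂ, ‖t‖ < 1 → t ≠ 0 → s = t ^ 2 → ∃ z : ℂ, psi a t = z ∧
      z ^ 2 + 2 * z = cc l a ^ 2 + 2 * cc l a := by
    intro t ht1 ht0 ht
    have hne : psi a t ≠ ∞ := by
      intro h'
      rw [← psi_zero a] at h'
      exact ht0 (psi_inj_TT haT ht1 (by simp) h')
    obtain ⟨z, hz⟩ := OnePoint.ne_infty_iff_exists.1 hne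
    refine ⟨z, hz.symm, ?_⟩
    have h2 := Rhat_psi_TT haT ht1
    rw [← hz, ← ht, Rhat_coe ha0] at h2
    have h3 := toS_inj (h2.trans hR.symm)
    field_simp at h3
    linear_combination h3
  obtain ⟨z1, hz1, e1⟩ := key t ht1 ht0 ht
  obtain ⟨z2, hz2, e2⟩ := key (-t) ht1' (neg_ne_zero.2 ht0) (by rw [ht]; ring)
  have h12 : z1 ≠ z2 := by
    rintro rfl
    have := psi_inj_TT haT ht1 ht1' (hz1.trans hz2.symm)
    exact ht0 (by linear_combination this / 2)
  have hn1 : z1 ≠ cc l a := fun h => cc_not_psi hn ha (by omega) ht1 (h ▸ hz1)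
  have hn2 : z2 ≠ cc l a := fun h => cc_not_psi hn ha (by omega) ht1' (h ▸ hz2)
  have f1 : (z1 - cc l a) * (z1 + cc l a + 2) = 0 := by linear_combination e1
  have f2 : (z2 - cc l a) * (z2 + cc l a + 2) = 0 := by linear_combination e2
  have g1 := (mul_eq_zero.1 f1).resolve_left (sub_ne_zero.2 hn1)
  have g2 := (mul_eq_zero.1 f2).resolve_left (sub_ne_zero.2 hn2)
  exact h12 (by linear_combination g1 - g2)

end

section
open Filter Topology OnePoint
open MeasureTheory

theorem diffContOnCl_of_unit {G : ℂ → ℂ} {ρ : ℝ} (hG : DifferentiableOn ℂ G (Metric.ball 0 1))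
    (hρ0 : 0 < ρ) (hρ : ρ < 1) : DiffContOnCl ℂ G (Metric.ball 0 ρ) := by
  apply (hG.mono ?_).diffContOnCl
  rw [closure_ball _ hρ0.ne']
  exact Metric.closedBall_subset_ball hρ

theorem contour_val {h φ : ℂ → ℂ} (hh : DifferentiableOn ℂ h (Metric.ball 0 1))
    (hφ : DifferentiableOn ℂ φ (Metric.ball 0 1))
    (hinj : ∀ s ∈ Metric.ball (0:ℂ) 1, ∀ t ∈ Metric.ball (0:ℂ) 1, h s = h t → s = t)
    (hd : ∀ s ∈ Metric.ball (0:ℂ) 1, deriv h s ≠ 0) {ρ : ℝ} (hρ : ρ < 1) {t : ℂ}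
    (ht : ‖t‖ < ρ) :
    ∮ s in C(0, ρ), deriv h s * φ s / (h s - h t) = 2 * Real.pi * Complex.I * φ t := by
  have hρ0 : 0 < ρ := (norm_nonneg t).trans_lt ht
  have htb : t ∈ Metric.ball (0:ℂ) 1 := by
    rw [mem_ball_zero_iff]; exact ht.trans hρ
  have hg : DifferentiableOn ℂ (dslope h t) (Metric.ball 0 1) :=
    (Complex.differentiableOn_dslope (Metric.isOpen_ball.mem_nhds htb)).2 hh
  have hgne : ∀ s ∈ Metric.ball (0:ℂ) 1, dslope h t s ≠ 0 := by
    intro s hs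
    by_cases hst : s = t
    · rw [hst, dslope_same]; exact hd t htb
    · rw [dslope_of_ne _ hst, slope_def_field]
      exact div_ne_zero (sub_ne_zero.2 fun h' => hst (hinj s hs t htb h')) (sub_ne_zero.2 hst)
  have hG : DifferentiableOn ℂ (fun s => deriv h s * φ s / dslope h t s) (Metric.ball 0 1) :=
    ((hh.deriv Metric.isOpen_ball).fun_mul hφ).fun_div hg hgne
  have h1 := (diffContOnCl_of_unit hG hρ0 hρ).circleIntegral_sub_inv_smul
    (w := t) (by rwa [mem_ball_zero_iff])
  rw [dslope_same, mul_div_cancel_left₀ _ (hd t htb), smul_eq_mul] at h1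
  rw [← h1]
  apply circleIntegral.integral_congr hρ0.le
  intro s hs
  have hst : s ≠ t := by
    rintro rfl
    rw [mem_sphere_zero_iff_norm] at hs
    linarith
  have hst' : s - t ≠ 0 := sub_ne_zero.2 hst
  have hsb : s ∈ Metric.ball (0:ℂ) 1 := by
    rw [mem_sphere_zero_iff_norm] at hs
    rw [mem_ball_zero_iff]; linarith
  have hne : h s - h t ≠ 0 := sub_ne_zero.2 fun h' => hst (hinj s hsb t htb h')
  simp only [dslope_of_ne _ hst, slope_def_field, smul_eq_mul]
  field_simp

theorem contour_zero {h φ : ℂ → ℂ} (hh : DifferentiableOn ℂ h (Metric.ball 0 1))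
    (hφ : DifferentiableOn ℂ φ (Metric.ball 0 1)) {ρ : ℝ} (hρ0 : 0 < ρ) (hρ : ρ < 1) {c : ℂ}
    (hc : ∀ s ∈ Metric.ball (0:ℂ) 1, h s ≠ c) :
    ∮ s in C(0, ρ), deriv h s * φ s / (h s - c) = 0 := by
  have hG : DifferentiableOn ℂ (fun s => deriv h s * φ s / (h s - c)) (Metric.ball 0 1) :=
    ((hh.deriv Metric.isOpen_ball).fun_mul hφ).fun_div (hh.sub_const c)
      (fun s hs => sub_ne_zero.2 (hc s hs))
  exact (diffContOnCl_of_unit hG hρ0 hρ).circleIntegral_eq_zero hρ0.le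

theorem partial_diff {F : ℂ × ℂ → ℂ} {U : Set (ℂ × ℂ)} (hU : IsOpen U)
    (hF : DifferentiableOn ℂ F U) {a s : ℂ} (h : (a, s) ∈ U) :
    DifferentiableAt ℂ (fun s => deriv (fun b => F (b, s)) a) s := by
  have h1 := fderiv_apply_differentiableAt hU hF (1, 0) h
  have h2 : DifferentiableAt ℂ (fun s => fderiv ℂ F (a, s) (1, 0)) s :=
    h1.comp s (f := fun s => (a, s)) (by fun_prop)
  refine h2.congr_of_eventuallyEq ?_
  have hc : ContinuousAt (fun s : ℂ => (a, s)) s := by fun_prop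
  filter_upwards [hc.eventually (hU.mem_nhds h)] with t ht
  have h3 : HasFDerivAt F (fderiv ℂ F (a, t)) (a, t) :=
    ((hF _ ht).differentiableAt (hU.mem_nhds ht)).hasFDerivAt
  have h4 : HasDerivAt (fun b : ℂ => (b, t)) ((1:ℂ), (0:ℂ)) a :=
    (hasDerivAt_id a).prodMk (hasDerivAt_const a t)
  exact (h3.comp_hasDerivAt a h4).deriv

noncomputable def dsig (a s : ℂ) : ℂ := deriv (fun b => sig b s) a
noncomputable def dph (a s : ℂ) : ℂ := deriv (fun b => ph b s) a
noncomputable def dbb (a s : ℂ) : ℂ := deriv (fun b => bb b s) a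
noncomputable def eta (a s : ℂ) : ℂ := dsig a s / (sig a s + s)
noncomputable def beta (a s : ℂ) : ℂ := dslope (dbb a) 0 s * (sig a s - s) / a

section
variable {a s : ℂ}

theorem dsig_diff (ha : a ∈ TT) (hs : ‖s‖ < 1) : DifferentiableAt ℂ (dsig a) s := by
  obtain ⟨m, -, h⟩ := exists_lev (norm_nonneg s) hs
  exact partial_diff ((isOpen_VV m).prod Metric.isOpen_ball) (glev m).σd
    ⟨ha m, by rwa [mem_ball_zero_iff]⟩

theorem sig_hasDeriv (ha : a ∈ TT) (hs : ‖s‖ < 1) :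
    HasDerivAt (fun b => sig b s) (dsig a s) a := by
  obtain ⟨m, -, h⟩ := exists_lev (norm_nonneg s) hs
  have h1 := ((glev m).σd (a, s) ⟨ha m, by rwa [mem_ball_zero_iff]⟩).differentiableAt
    (((isOpen_VV m).prod Metric.isOpen_ball).mem_nhds ⟨ha m, by rwa [mem_ball_zero_iff]⟩)
  have h2 : DifferentiableAt ℂ (fun b => sig b s) a :=
    h1.comp a (f := fun b => (b, s)) (by fun_prop)
  exact h2.hasDerivAt

theorem sig_diff (ha : a ∈ TT) (hs : ‖s‖ < 1) : DifferentiableAt ℂ (sig a) s := by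
  obtain ⟨m, -, h⟩ := exists_lev (norm_nonneg s) hs
  have h1 := ((glev m).σd (a, s) ⟨ha m, by rwa [mem_ball_zero_iff]⟩).differentiableAt
    (((isOpen_VV m).prod Metric.isOpen_ball).mem_nhds ⟨ha m, by rwa [mem_ball_zero_iff]⟩)
  exact h1.comp s (f := fun s => (a, s)) (by fun_prop)

theorem sig_sub_ne (ha : a ∈ TT) (hs : ‖s‖ < 1) : sig a s - s ≠ 0 := by
  obtain ⟨m, -, h⟩ := exists_lev (norm_nonneg s) hs
  exact (glev m).σne a (ha m) s h.le

theorem sig_add_ne_TT (ha : a ∈ TT) (hs : ‖s‖ < 1) : sig a s + s ≠ 0 := by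
  obtain ⟨m, -, h⟩ := exists_lev (norm_nonneg s) hs
  exact sig_add_ne (ha m) h.le

theorem ph_hasDeriv (ha : a ∈ TT) (hs : ‖s‖ < 1) :
    HasDerivAt (fun b => ph b s) (dph a s) a := by
  obtain ⟨m, -, h⟩ := exists_lev (norm_nonneg s) hs
  have h2 : DifferentiableAt ℂ (fun b => ph b s) a :=
    (ph_diff (ha m) h).comp a (f := fun b => (b, s)) (by fun_prop)
  exact h2.hasDerivAt

theorem bb_hasDeriv (ha : a ∈ TT) (hs : ‖s‖ < 1) :
    HasDerivAt (fun b => bb b s) (dbb a s) a := by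
  obtain ⟨m, h, -⟩ := exists_lev (norm_nonneg s) hs
  have h2 : DifferentiableAt ℂ (fun b => bb b s) a :=
    (bb_diff (ha m) h).comp a (f := fun b => (b, s)) (by fun_prop)
  exact h2.hasDerivAt

theorem dbb_diff (ha : a ∈ TT) (hs : ‖s‖ < 1) : DifferentiableAt ℂ (dbb a) s := by
  obtain ⟨m, h, -⟩ := exists_lev (norm_nonneg s) hs
  refine partial_diff (F := fun x => bb x.1 x.2) (U := VV m ×ˢ Metric.ball 0 (rr m ^ 2))
    ((isOpen_VV m).prod Metric.isOpen_ball) ?_ ⟨ha m, by rwa [mem_ball_zero_iff]⟩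
  rintro ⟨b, t⟩ ⟨hb, ht⟩
  exact (bb_diff hb (by rwa [mem_ball_zero_iff] at ht)).differentiableWithinAt

theorem dph_formula (ha : a ∈ TT) (hs : ‖s‖ < 1) :
    dph a s = - (s * dsig a s) / (sig a s - s) ^ 2 := by
  have h1 := (hasDerivAt_const a s).div ((sig_hasDeriv ha hs).sub_const s) (sig_sub_ne ha hs)
  have h2 := (ph_hasDeriv ha hs).unique h1
  rw [h2]
  ring

theorem dbb_zero (ha : a ∈ TT) : dbb a 0 = 0 := by
  unfold dbb
  have : (fun b => bb b 0) =ᶠ[𝓝 a] fun _ => 0 := by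
    filter_upwards [(isOpen_VV 0).mem_nhds (ha 0)] with b hb
    exact bb_zero hb
  rw [this.deriv_eq, deriv_const]

theorem eta_diffOn (ha : a ∈ TT) : DifferentiableOn ℂ (eta a) (Metric.ball 0 1) := by
  intro s hs
  rw [mem_ball_zero_iff] at hs
  exact ((dsig_diff ha hs).fun_div ((sig_diff ha hs).fun_add differentiableAt_id)
    (sig_add_ne_TT ha hs)).differentiableWithinAt

theorem beta_diffOn (ha : a ∈ TT) : DifferentiableOn ℂ (beta a) (Metric.ball 0 1) := by
  have h1 : DifferentiableOn ℂ (dslope (dbb a) 0) (Metric.ball 0 1) := by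
    rw [Complex.differentiableOn_dslope (Metric.ball_mem_nhds _ one_pos)]
    intro s hs
    exact (dbb_diff ha (by rwa [mem_ball_zero_iff] at hs)).differentiableWithinAt
  refine DifferentiableOn.fun_div (h1.fun_mul ?_) (differentiableOn_const _) (fun _ _ => (TT_Par ha).1)
  intro s hs
  exact ((sig_diff ha (by rwa [mem_ball_zero_iff] at hs)).fun_sub
    differentiableAt_id).differentiableWithinAt

theorem ph_add_ne_TT (ha : a ∈ TT) (hs : ‖s‖ < 1) : 1 + 2 * ph a s ≠ 0 := by
  obtain ⟨m, -, h⟩ := exists_lev (norm_nonneg s) hs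
  exact ph_add_ne (ha m) h.le

theorem ph_ne_zero (ha : a ∈ TT) (hs : ‖s‖ < 1) (h0 : s ≠ 0) : ph a s ≠ 0 :=
  div_ne_zero h0 (sig_sub_ne ha hs)

theorem ph_bb_TT (ha : a ∈ TT) (hs : ‖s‖ < 1) : a * ph a s = bb a s ^ 2 + 2 * bb a s := by
  obtain ⟨m, h, -⟩ := exists_lev (norm_nonneg s) hs
  exact ph_bb (ha m) h.le

theorem bb_ph_TT (ha : a ∈ TT) (hs : ‖s‖ < 1) :
    bb a (s ^ 2) = a * ph a s ^ 2 / (1 + 2 * ph a s) := by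
  obtain ⟨m, -, h⟩ := exists_lev (norm_nonneg s) hs
  exact bb_ph (ha m) h.le

theorem eta_val (ha : a ∈ TT) (hs : ‖s‖ < 1) (h0 : s ≠ 0) :
    eta a s = - dph a s / (ph a s) ^ 2 / (1 / ph a s + 2) := by
  rw [dph_formula ha hs]
  have h1 := sig_sub_ne ha hs
  have h2 := sig_add_ne_TT ha hs
  have e : 1 / ph a s + 2 = (sig a s + s) / s := by
    unfold ph
    field_simp
    ring
  rw [e]
  unfold ph eta
  field_simp

theorem beta_val (ha : a ∈ TT) (hs : ‖s‖ < 1) (h0 : s ≠ 0) :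
    beta a s = dbb a s / (bb a s * (bb a s + 2)) := by
  rw [show bb a s * (bb a s + 2) = a * ph a s by rw [ph_bb_TT ha hs]; ring]
  unfold beta ph
  rw [dslope_of_ne _ h0, slope_def_field, dbb_zero ha]
  have h1 := sig_sub_ne ha hs
  have h2 := (TT_Par ha).1
  field_simp
  simp

/-- differentiating `a p = b² + 2 b` -/
theorem dph_dbb (ha : a ∈ TT) (hs : ‖s‖ < 1) :
    a * dph a s + ph a s = (2 * bb a s + 2) * dbb a s := by
  obtain ⟨m, h, -⟩ := exists_lev (norm_nonneg s) hs
  have h1 := (hasDerivAt_id' a).fun_mul (ph_hasDeriv ha hs)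
  have h2 := ((bb_hasDeriv ha hs).fun_pow 2).fun_add ((bb_hasDeriv ha hs).const_mul 2)
  have h3 : (fun b => b * ph b s) =ᶠ[𝓝 a] fun b => bb b s ^ 2 + 2 * bb b s := by
    filter_upwards [(isOpen_VV m).mem_nhds (ha m)] with b hb
    exact ph_bb hb h.le
  have := h1.unique (h2.congr_of_eventuallyEq h3)
  push_cast at this
  linear_combination this

/-- differentiating `b(s²) = a p² / (1 + 2 p)` -/
theorem dbb_dph (ha : a ∈ TT) (hs : ‖s‖ < 1) :
    dbb a (s ^ 2) = ph a s ^ 2 / (1 + 2 * ph a s) +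
      a * dph a s * (2 * ph a s + 2 * ph a s ^ 2) / (1 + 2 * ph a s) ^ 2 := by
  obtain ⟨m, -, h⟩ := exists_lev (norm_nonneg s) hs
  have hs2 : ‖s ^ 2‖ < 1 := by
    rw [norm_pow]; exact pow_lt_one₀ (norm_nonneg _) hs two_ne_zero
  have hne := ph_add_ne_TT ha hs
  have h1 := ((hasDerivAt_id' a).fun_mul ((ph_hasDeriv ha hs).fun_pow 2)).fun_div
    (((ph_hasDeriv ha hs).const_mul 2).const_add 1) hne
  have h3 : (fun b => bb b (s ^ 2)) =ᶠ[𝓝 a] fun b => b * ph b s ^ 2 / (1 + 2 * ph b s) := by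
    filter_upwards [(isOpen_VV m).mem_nhds (ha m)] with b hb
    exact bb_ph hb h.le
  have := (bb_hasDeriv ha hs2).unique (h1.congr_of_eventuallyEq h3)
  rw [this]
  push_cast
  field_simp
  ring

theorem ph_inj_TT {t : ℂ} (ha : a ∈ TT) (hs : ‖s‖ < 1) (ht : ‖t‖ < 1) (h : ph a s = ph a t) :
    s = t := psi_inj_TT ha hs ht (by unfold psi; rw [h])

theorem ph_deriv_ne_TT (ha : a ∈ TT) (hs : ‖s‖ < 1) : deriv (ph a) s ≠ 0 := by
  obtain ⟨m, -, h⟩ := exists_lev (norm_nonneg s) hs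
  exact ph_deriv_ne (ha m) h

theorem bb_deriv_ne_TT (ha : a ∈ TT) (hs : ‖s‖ < 1) : deriv (bb a) s ≠ 0 := by
  intro h0
  have h1 := ((ph_diff_TT ha hs).hasDerivAt).const_mul a
  have hb := (bb_diff_TT ha hs).hasDerivAt
  have h2 := (hb.fun_pow 2).fun_add (hb.const_mul 2)
  have h3 : (fun s => a * ph a s) =ᶠ[𝓝 s] fun s => bb a s ^ 2 + 2 * bb a s := by
    have : Metric.ball (0:ℂ) 1 ∈ 𝓝 s := Metric.isOpen_ball.mem_nhds (by rwa [mem_ball_zero_iff])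
    filter_upwards [this] with t ht
    exact ph_bb_TT ha (by rwa [mem_ball_zero_iff] at ht)
  have := h1.unique (h2.congr_of_eventuallyEq h3)
  rw [h0] at this
  simp at this
  rcases this with h | h
  · exact (TT_Par ha).1 h
  · exact ph_deriv_ne_TT ha hs h

end

end

section
open Filter Topology OnePoint
open MeasureTheory

section
variable {n : ℕ} {a : ℂ}

theorem cc_inj_lt (ha : a ∈ captureSet n) {i j : ℕ} (hij : i < j) (hj : j < n) :
    cc i a ≠ cc j a := by
  intro h
  have h1 : crit a i = crit a j := by rw [crit_cc ha (hij.trans hj), crit_cc ha hj, h]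
  have h2 : crit a (i + (n - j)) = crit a n := by
    rw [← crit_add, h1, crit_add]
    congr 1
    omega
  have h3 : crit a n ∈ Ainf a := ha.2.1
  rw [← h2] at h3
  exact ha.2.2 (i + (n - j)) (by omega) h3

theorem cc_inj (ha : a ∈ captureSet n) {i j : ℕ} (hi : i < n) (hj : j < n)
    (h : cc i a = cc j a) : i = j := by
  rcases lt_trichotomy i j with h1 | h1 | h1
  · exact absurd h (cc_inj_lt ha h1 hj)
  · exact h1
  · exact absurd h.symm (cc_inj_lt ha h1 hi)

theorem cc_deriv (ha : a ∈ captureSet n) {k : ℕ} (hk : k + 1 < n) :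
    deriv (cc (k + 1)) a = ff' a (cc k a) * deriv (cc k) a + 1 / (cc k a ^ 2 + 2 * cc k a) := by
  have h1 := (cc_diff ha (k := k) (by omega)).hasDerivAt
  have h2 := cc_ne ha hk
  have h3 := (hasDerivAt_id' a).fun_div ((h1.fun_pow 2).fun_add (h1.const_mul 2)) h2
  have h4 : deriv (cc (k + 1)) a = _ := h3.deriv
  rw [h4]
  unfold ff'
  push_cast
  field_simp
  ring

theorem cc_one (b : ℂ) : cc 1 b = -b := by
  show b / ((-1) ^ 2 + 2 * (-1)) = -b
  norm_num [div_neg]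

theorem cc_one_deriv : deriv (cc 1) a = -1 := by
  have : cc 1 = fun b => -b := funext cc_one
  rw [this]
  simp

theorem PP_deriv (hn : 2 ≤ n) (ha : a ∈ captureSet n) :
    a * deriv (PP n) a + PP n a = (2 * cc (n - 1) a + 2) * deriv (cc (n - 1)) a := by
  have h1 := (cc_diff ha (k := n - 1) (by omega)).hasDerivAt
  have h2 := (hasDerivAt_id' a).fun_mul (PP_diff hn ha).hasDerivAt
  have h3 := (h1.fun_pow 2).fun_add (h1.const_mul 2)
  have h4 : (fun b => b * PP n b) =ᶠ[𝓝 a] fun b => cc (n - 1) b ^ 2 + 2 * cc (n - 1) b := by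
    filter_upwards [isOpen_ne.mem_nhds ha.1] with b hb
    unfold PP
    exact mul_div_cancel₀ _ hb
  have := h2.unique (h3.congr_of_eventuallyEq h4)
  push_cast at this
  linear_combination this

theorem Orb.contra {c v : ℕ → ℂ} {J : Set ℕ} (H : Orb a c v J)
    (h : Tendsto (fun k => Lam c v (gam a c k)) atTop (𝓝 0)) : False := by
  have h1 : (fun k => Lam c v (gam a c k)) = fun _ => -1 / (c 1 * (c 1 + 2)) :=
    funext fun k => H.Lam_gam k
  rw [h1] at h
  have h2 := tendsto_nhds_unique h tendsto_const_nhds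
  have h3 := H.hJ0 1 H.h1J
  have h4 : c 1 + 2 ≠ 0 := fun h => H.hJ2 1 H.h1J (by linear_combination h)
  have h5 : -1 / (c 1 * (c 1 + 2)) ≠ 0 := div_ne_zero (by norm_num) (mul_ne_zero h3 h4)
  exact h5 h2.symm

theorem cc_mem_OO (hn : 2 ≤ n) (ha : a ∈ captureSet n) {i : ℕ} (hi : i < n) {r s : ℝ}
    (hr : r < 1) (hs : s < 1) : cc i a ∈ OO a r s := by
  rintro (⟨t, ht, h⟩ | ⟨t, ht, h⟩)
  · rw [mem_closedBall_zero_iff] at ht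
    exact cc_not_psi hn ha hi (ht.trans_lt hr) h
  · rw [mem_closedBall_zero_iff] at ht
    exact cc_not_bb hn ha hi (ht.trans_lt hs) (OnePoint.coe_injective h)

/-- transversality at centers -/
theorem trans_center (hn : 2 ≤ n) (ha : a ∈ captureSet n) (h0 : gg n a = 0)
    (hd : deriv (gg n) a = 0) : False := by
  have haT := captureSet_TT hn ha
  have ha0 := ha.1
  have hP0 : PP n a = 0 := by rw [← ph_gg hn ha, h0, ph_zero]
  have hg := (gg_local hn ha).2
  rw [hd, mul_zero, h0] at hg
  have hz : (fun b => ph b 0) = fun _ => (0:ℂ) := funext fun b => ph_zero b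
  rw [hz, deriv_const, sub_zero] at hg
  have hP := PP_deriv hn ha
  rw [hg, hP0, mul_zero, zero_add] at hP
  have hne0 : ∀ j, 1 ≤ j → j < n → cc j a ≠ 0 := by
    intro j hj hjn
    obtain ⟨k, rfl⟩ : ∃ k, j = k + 1 := ⟨j - 1, by omega⟩
    exact div_ne_zero ha0 (cc_ne ha hjn)
  have hm2 : cc (n - 1) a = -2 := by
    unfold PP at hP0
    rw [div_eq_zero_iff] at hP0
    have h1 : cc (n - 1) a * (cc (n - 1) a + 2) = 0 := by
      rcases hP0 with h | h
      · linear_combination h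
      · exact absurd h ha0
    rcases mul_eq_zero.1 h1 with h | h
    · exact absurd h (hne0 _ (by omega) (by omega))
    · linear_combination h
  have hv0 : deriv (cc (n - 1)) a = 0 := by
    rw [hm2] at hP
    norm_num at hP
    exact hP
  have hn3 : 3 ≤ n := by
    by_contra h
    have : n - 1 = 1 := by omega
    rw [this, cc_one_deriv] at hv0
    norm_num at hv0
  have H : Orb a (fun j => cc j a) (fun j => deriv (cc j) a) {j | 1 ≤ j ∧ j ≤ n - 2} := by
    refine ⟨ha0, cc_one a, ⟨le_rfl, by omega⟩, ?_, ?_, ?_, ?_, ?_, cc_one_deriv, ?_⟩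
    · rintro j ⟨h1, h2⟩
      exact hne0 j h1 (by omega)
    · rintro j ⟨h1, h2⟩ h
      apply cc_ne ha (k := j) (by omega)
      rw [show cc j a = -2 from h]; norm_num
    · rintro j ⟨h1, h2⟩ h
      exact cc_inj_lt ha (i := 0) (j := j) (by omega) (by omega) h.symm
    · rintro j ⟨h1, h2⟩
      rfl
    · rintro j ⟨h1, h2⟩
      by_cases h : j + 1 ≤ n - 2
      · exact Or.inl ⟨by omega, h⟩
      · right
        have : j + 1 = n - 1 := by omega
        simp only [this]
        exact ⟨hm2, hv0⟩
    · rintro j ⟨h1, h2⟩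
      exact cc_deriv ha (by omega)
  have hB := (core_B H (Dom_OO haT (r := 1 / 2) (s := 3 / 8) (by norm_num) (by norm_num)
    (by norm_num)) (o := Finset.Icc 1 (n - 2)) (fun i hi => by
      rw [Finset.mem_Icc] at hi
      exact cc_mem_OO hn ha (by omega) (by norm_num) (by norm_num))
    (fun i hi j hj h => by
      rw [Finset.mem_Icc] at hi hj
      exact cc_inj ha (by omega) (by omega) h)
    (fun j hj hjo => absurd (Finset.mem_Icc.2 hj) hjo)).1
  apply H.contra
  have e : ∀ k, Lam (fun j => cc j a) (fun j => deriv (cc j) a) (gam a (fun j => cc j a) k) =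
      ∑ j ∈ Finset.Icc 1 (n - 2), gam a (fun j => cc j a) k j *
        (deriv (cc j) a / (cc j a * (cc j a + 2))) := by
    intro k
    unfold Lam
    rw [Finsupp.linearCombination_apply]
    have hs := (Finsupp.mem_supported ℂ _).1 (H.gam_supp k)
    rw [Finsupp.sum_of_support_subset _ (s := Finset.Icc 1 (n - 2)) (fun j hj =>
      Finset.mem_Icc.2 (hs hj)) _ (by simp)]
    rfl
  simp_rw [e]
  have : (0:ℂ) = ∑ j ∈ Finset.Icc 1 (n - 2), 0 * (deriv (cc j) a / (cc j a * (cc j a + 2))) := by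
    simp
  rw [this]
  exact tendsto_finsetSum _ fun j hj => (hB j hj).mul_const _

theorem contour_bound {ρ M ε : ℝ} (hρ : 0 ≤ ρ) {F : ℕ → ℂ → ℂ} {val : ℕ → ℂ} {S : Finset ℕ}
    {γ : ℕ → ℂ} (hF : ∀ j ∈ S, ContinuousOn (F j) (Metric.sphere 0 ρ))
    (hval : ∀ j ∈ S, (∮ s in C(0, ρ), F j s) = val j) {W q : ℂ → ℂ}
    (hW : ∀ s ∈ Metric.sphere (0:ℂ) ρ, ∑ j ∈ S, γ j * F j s = W s * q s)
    (hM : ∀ s ∈ Metric.sphere (0:ℂ) ρ, ‖W s‖ ≤ M) (hM0 : 0 ≤ M)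
    (hq : ∀ s ∈ Metric.sphere (0:ℂ) ρ, ‖q s‖ ≤ ε) :
    ‖∑ j ∈ S, γ j * val j‖ ≤ 2 * Real.pi * ρ * (M * ε) := by
  have h1 : ∑ j ∈ S, γ j * val j = ∮ s in C(0, ρ), ∑ j ∈ S, γ j * F j s := by
    rw [circleIntegral.integral_fun_sum]
    · apply Finset.sum_congr rfl
      intro j hj
      rw [circleIntegral.integral_const_mul, hval j hj]
    · intro j hj
      exact (continuousOn_const.mul (hF j hj)).circleIntegrable hρ
  rw [h1]
  apply circleIntegral.norm_integral_le_of_norm_le_const hρ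
  intro s hs
  rw [hW s hs, norm_mul]
  exact mul_le_mul (hM s hs) (hq s hs) (norm_nonneg _) hM0

end

end

section
open Filter Topology OnePoint
open MeasureTheory

/-- critical orbit together with the tail in the basin -/
noncomputable def cN (n : ℕ) (a t : ℂ) (j : ℕ) : ℂ :=
  if j < n then cc j a else
    if (j - n) % 2 = 0 then 1 / ph a (t ^ 2 ^ ((j - n) / 2)) else bb a (t ^ 2 ^ ((j - n) / 2 + 1))

noncomputable def vN (n : ℕ) (a t : ℂ) (j : ℕ) : ℂ :=
  if j < n then deriv (cc j) a else
    if (j - n) % 2 = 0 then - dph a (t ^ 2 ^ ((j - n) / 2)) / ph a (t ^ 2 ^ ((j - n) / 2)) ^ 2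
    else dbb a (t ^ 2 ^ ((j - n) / 2 + 1))

section
variable {n : ℕ} {a t : ℂ}

theorem cN_lt {j : ℕ} (h : j < n) : cN n a t j = cc j a := by
  unfold cN; rw [if_pos h]
theorem vN_lt {j : ℕ} (h : j < n) : vN n a t j = deriv (cc j) a := by
  unfold vN; rw [if_pos h]
theorem cN_even (k : ℕ) : cN n a t (n + 2 * k) = 1 / ph a (t ^ 2 ^ k) := by
  unfold cN
  rw [if_neg (by omega), if_pos (by omega), show (n + 2 * k - n) / 2 = k by omega]
theorem vN_even (k : ℕ) :
    vN n a t (n + 2 * k) = - dph a (t ^ 2 ^ k) / ph a (t ^ 2 ^ k) ^ 2 := by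
  unfold vN
  rw [if_neg (by omega), if_pos (by omega), show (n + 2 * k - n) / 2 = k by omega]
theorem cN_odd (k : ℕ) : cN n a t (n + 2 * k + 1) = bb a (t ^ 2 ^ (k + 1)) := by
  unfold cN
  rw [if_neg (by omega), if_neg (by omega), show (n + 2 * k + 1 - n) / 2 = k by omega]
theorem vN_odd (k : ℕ) : vN n a t (n + 2 * k + 1) = dbb a (t ^ 2 ^ (k + 1)) := by
  unfold vN
  rw [if_neg (by omega), if_neg (by omega), show (n + 2 * k + 1 - n) / 2 = k by omega]

theorem N_cases (n j : ℕ) : j < n ∨ (∃ k, j = n + 2 * k) ∨ ∃ k, j = n + 2 * k + 1 := by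
  by_cases h : j < n
  · exact Or.inl h
  · right
    rcases Nat.even_or_odd' (j - n) with ⟨k, h | h⟩
    · exact Or.inl ⟨k, by omega⟩
    · exact Or.inr ⟨k, by omega⟩

theorem tau_norm (ht : ‖t‖ < 1) (k : ℕ) : ‖t ^ 2 ^ k‖ < 1 := by
  rw [norm_pow]
  exact pow_lt_one₀ (norm_nonneg _) ht (by positivity)

theorem tau_norm_le (ht : ‖t‖ < 1) (k : ℕ) : ‖t ^ 2 ^ k‖ ≤ ‖t‖ := by
  rw [norm_pow]
  exact pow_le_of_le_one (norm_nonneg _) ht.le (by positivity)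

theorem tau_norm_le2 (ht : ‖t‖ < 1) (k : ℕ) : ‖t ^ 2 ^ (k + 1)‖ ≤ ‖t‖ ^ 2 := by
  rw [norm_pow]
  apply pow_le_pow_of_le_one (norm_nonneg _) ht.le
  rw [pow_succ]
  have : 1 ≤ 2 ^ k := Nat.one_le_two_pow
  omega

theorem psi_coe (ha : a ∈ TT) {s : ℂ} (hs : ‖s‖ < 1) (h0 : s ≠ 0) :
    psi a s = ((1 / ph a s : ℂ) : RSphere) := by
  have := ph_ne_zero ha hs h0
  unfold psi
  rw [toS_eq_coe]
  exact ⟨this, by field_simp⟩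

theorem bb_ne_zero (ha : a ∈ TT) {s : ℂ} (hs : ‖s‖ < 1) (h0 : s ≠ 0) : bb a s ≠ 0 := by
  intro h
  have h1 := ph_bb_TT ha hs
  rw [h] at h1
  apply mul_ne_zero (TT_Par ha).1 (ph_ne_zero ha hs h0)
  rw [h1]; ring

theorem orbN (hn : 2 ≤ n) (ha : a ∈ captureSet n) (h0 : gg n a ≠ 0) (hd : deriv (gg n) a = 0) :
    Orb a (cN n a (gg n a)) (vN n a (gg n a)) {j | 1 ≤ j} := by
  have haT := captureSet_TT hn ha
  have ha0 : a ≠ 0 := ha.1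
  have ht := (gg_spec hn ha).1
  have hphP := ph_gg hn ha
  have hg := (gg_local hn ha).2
  rw [hd, mul_zero, sub_eq_zero] at hg
  change deriv (PP n) a = dph a (gg n a) at hg
  set t := gg n a with htdef
  have hτ := tau_norm ht
  have hτ0 : ∀ k, t ^ 2 ^ k ≠ 0 := fun k => pow_ne_zero _ h0
  have hPP := PP_deriv hn ha
  have hPne : PP n a ≠ 0 := by rw [← hphP]; exact ph_ne_zero haT ht h0
  have hPdef : a * PP n a = cc (n - 1) a ^ 2 + 2 * cc (n - 1) a := by
    unfold PP; exact mul_div_cancel₀ _ ha0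
  have hcc : ∀ j < n, cc j a ^ 2 + 2 * cc j a ≠ 0 := by
    intro j hj
    by_cases h : j + 1 < n
    · exact cc_ne ha h
    · obtain rfl : j = n - 1 := by omega
      rw [← hPdef]; exact mul_ne_zero ha0 hPne
  have hJ0 : ∀ j ∈ {j : ℕ | 1 ≤ j}, cN n a t j ≠ 0 := by
    intro j hj
    rcases N_cases n j with h | ⟨k, rfl⟩ | ⟨k, rfl⟩
    · rw [cN_lt h]
      intro h'
      apply hcc j h
      rw [h']; ring
    · rw [cN_even]
      exact div_ne_zero one_ne_zero (ph_ne_zero haT (hτ k) (hτ0 k))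
    · rw [cN_odd]
      exact bb_ne_zero haT (hτ _) (hτ0 _)
  have hJ2 : ∀ j ∈ {j : ℕ | 1 ≤ j}, cN n a t j ≠ -2 := by
    intro j hj
    rcases N_cases n j with h | ⟨k, rfl⟩ | ⟨k, rfl⟩
    · rw [cN_lt h]
      intro h'
      apply hcc j h
      rw [h']; ring
    · rw [cN_even]
      intro h
      apply psi_ne_neg_two haT (hτ k)
      rw [psi_coe haT (hτ k) (hτ0 k), h]
    · rw [cN_odd]
      exact bb_ne_neg_two haT (hτ _)
  have hJ1 : ∀ j ∈ {j : ℕ | 1 ≤ j}, cN n a t j ≠ -1 := by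
    intro j hj
    rw [show (-1:ℂ) = cc 0 a from rfl]
    rcases N_cases n j with h | ⟨k, rfl⟩ | ⟨k, rfl⟩
    · rw [cN_lt h]
      exact (cc_inj_lt ha (i := 0) hj h).symm
    · rw [cN_even]
      intro h
      apply cc_not_psi hn ha (i := 0) (by omega) (hτ k)
      rw [psi_coe haT (hτ k) (hτ0 k), h]
    · rw [cN_odd]
      exact cc_not_bb hn ha (by omega) (hτ _)
  have hsq : ∀ k, (t ^ 2 ^ k) ^ 2 = t ^ 2 ^ (k + 1) := by
    intro k; rw [← pow_mul, ← pow_succ]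
  refine ⟨ha0, ?_, by simp, hJ0, hJ2, hJ1, ?_, ?_, ?_, ?_⟩
  · rw [cN_lt (by omega), cc_one]
  · intro j hj
    rcases N_cases n j with h | ⟨k, rfl⟩ | ⟨k, rfl⟩
    · by_cases h' : j + 1 < n
      · rw [cN_lt h, cN_lt h']; rfl
      · obtain rfl : j = n - 1 := by omega
        have e : n - 1 + 1 = n + 2 * 0 := by omega
        rw [e, cN_even, cN_lt h, pow_zero, pow_one, hphP]
        unfold ff
        rw [← hPdef]
        field_simp
    · rw [cN_odd, cN_even, ← hsq, bb_ph_TT haT (hτ k)]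
      have h1 := ph_ne_zero haT (hτ k) (hτ0 k)
      have h2 := ph_add_ne_TT haT (hτ k)
      unfold ff
      have e : (1 / ph a (t ^ 2 ^ k)) ^ 2 + 2 * (1 / ph a (t ^ 2 ^ k)) =
        (1 + 2 * ph a (t ^ 2 ^ k)) / ph a (t ^ 2 ^ k) ^ 2 := by field_simp
      rw [e]
      field_simp
    · have e : n + 2 * k + 1 + 1 = n + 2 * (k + 1) := by ring
      rw [e, cN_odd, cN_even]
      unfold ff
      rw [← ph_bb_TT haT (hτ (k + 1))]
      have h1 := ph_ne_zero haT (hτ (k + 1)) (hτ0 (k + 1))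
      field_simp
  · intro j hj
    exact Or.inl (by simp)
  · rw [vN_lt (by omega), cc_one_deriv]
  · intro j hj
    rcases N_cases n j with h | ⟨k, rfl⟩ | ⟨k, rfl⟩
    · by_cases h' : j + 1 < n
      · rw [cN_lt h, vN_lt h, vN_lt h']
        exact cc_deriv ha h'
      · obtain rfl : j = n - 1 := by omega
        have e : n - 1 + 1 = n + 2 * 0 := by omega
        rw [e, vN_even, cN_lt h, vN_lt h, pow_zero, pow_one, hphP, ← hg]
        unfold ff'
        rw [← hPdef]
        field_simp
        linear_combination -hPP
    · rw [vN_odd, vN_even, cN_even, ← hsq, dbb_dph haT (hτ k)]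
      have h1 := ph_ne_zero haT (hτ k) (hτ0 k)
      have h2 := ph_add_ne_TT haT (hτ k)
      unfold ff'
      have e : (1 / ph a (t ^ 2 ^ k)) ^ 2 + 2 * (1 / ph a (t ^ 2 ^ k)) =
        (1 + 2 * ph a (t ^ 2 ^ k)) / ph a (t ^ 2 ^ k) ^ 2 := by field_simp
      rw [e]
      field_simp
      ring
    · have e : n + 2 * k + 1 + 1 = n + 2 * (k + 1) := by ring
      rw [e, vN_odd, cN_odd, vN_even]
      unfold ff'
      rw [← ph_bb_TT haT (hτ (k + 1))]
      have h1 := ph_ne_zero haT (hτ (k + 1)) (hτ0 (k + 1))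
      have h2 := dph_dbb haT (hτ (k + 1))
      field_simp
      linear_combination -h2

end

end

section
open Filter Topology OnePoint
open MeasureTheory

section
variable {n : ℕ} {a : ℂ}

theorem trans_noncenter (hn : 2 ≤ n) (ha : a ∈ captureSet n) (h0 : gg n a ≠ 0)
    (hd : deriv (gg n) a = 0) : False := by
  have H := orbN hn ha h0 hd
  have haT := captureSet_TT hn ha
  have ha0 : a ≠ 0 := ha.1
  have ht := (gg_spec hn ha).1
  set t := gg n a with htdef
  set c := cN n a t with hc
  set v := vN n a t with hv
  have hτ := tau_norm ht
  have hτ0 : ∀ k, t ^ 2 ^ k ≠ 0 := fun k => pow_ne_zero _ h0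
  obtain ⟨r, htr, hr1⟩ := exists_between ht
  have hr0 : 0 < r := (norm_nonneg t).trans_lt htr
  obtain ⟨s, hrs, hsr⟩ := exists_between (show r ^ 2 < r by nlinarith)
  have hs0 : 0 < s := lt_trans (by positivity) hrs
  obtain ⟨r1, hrr1, hr11⟩ := exists_between hr1
  have hr10 : 0 < r1 := hr0.trans hrr1
  have hs1 : s < r1 := hsr.trans hrr1
  have htr1 : ‖t‖ < r1 := htr.trans hrr1
  -- membership facts
  have hsph : ∀ σ ∈ Metric.sphere (0:ℂ) r1, ‖σ‖ = r1 ∧ ‖σ‖ < 1 ∧ σ ≠ 0 := by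
    intro σ hσ
    rw [mem_sphere_zero_iff_norm] at hσ
    refine ⟨hσ, by rw [hσ]; exact hr11, ?_⟩
    rintro rfl
    rw [norm_zero] at hσ
    linarith
  have hsphb : Metric.sphere (0:ℂ) r1 ⊆ Metric.ball 0 1 := fun σ hσ => by
    rw [mem_ball_zero_iff]; exact (hsph σ hσ).2.1
  have hpd : DifferentiableOn ℂ (ph a) (Metric.ball 0 1) := fun σ hσ =>
    (ph_diff_TT haT (by rwa [mem_ball_zero_iff] at hσ)).differentiableWithinAt
  have hbd : DifferentiableOn ℂ (bb a) (Metric.ball 0 1) := fun σ hσ =>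
    (bb_diff_TT haT (by rwa [mem_ball_zero_iff] at hσ)).differentiableWithinAt
  have hηd := eta_diffOn haT
  have hβd := beta_diffOn haT
  have hpc := hpd.continuousOn.mono hsphb
  have hbc := hbd.continuousOn.mono hsphb
  have hpc' := (hpd.deriv Metric.isOpen_ball).continuousOn.mono hsphb
  have hbc' := (hbd.deriv Metric.isOpen_ball).continuousOn.mono hsphb
  have hηc := hηd.continuousOn.mono hsphb
  have hβc := hβd.continuousOn.mono hsphb
  have hpne : ∀ σ ∈ Metric.sphere (0:ℂ) r1, ph a σ ≠ 0 := fun σ hσ =>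
    ph_ne_zero haT (hsph σ hσ).2.1 (hsph σ hσ).2.2
  -- c j vs the two families, in general
  have hpsi_cc : ∀ j < n, ∀ σ : ℂ, ‖σ‖ < 1 → ph a σ ≠ 1 / cc j a := by
    intro j hj σ hσ h
    have hne : σ ≠ 0 := by
      rintro rfl
      by_cases hj0 : j = 0
      · subst hj0
        rw [ph_zero, show cc 0 a = -1 from rfl] at h
        norm_num at h
      · have := H.hJ0 j (by simp; omega)
        rw [hc, cN_lt hj] at this
        rw [ph_zero] at h
        exact (div_ne_zero one_ne_zero this) h.symm
    apply cc_not_psi hn ha hj hσ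
    rw [psi_coe haT hσ hne, h, one_div_one_div]
  have hpsi_bb : ∀ u σ : ℂ, ‖u‖ < 1 → u ≠ 0 → ‖σ‖ < 1 → ph a σ ≠ 1 / bb a u := by
    intro u σ hu hu0 hσ h
    have hne : σ ≠ 0 := by
      rintro rfl
      rw [ph_zero] at h
      exact (div_ne_zero one_ne_zero (bb_ne_zero haT hu hu0)) h.symm
    apply bb_ne_psi_TT haT hu hσ
    rw [psi_coe haT hσ hne, h, one_div_one_div]
  have hbb_ph : ∀ u σ : ℂ, ‖u‖ < 1 → u ≠ 0 → ‖σ‖ < 1 → bb a σ ≠ 1 / ph a u := by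
    intro u σ hu hu0 hσ h
    apply bb_ne_psi_TT haT hσ hu
    rw [psi_coe haT hu hu0, h]
  have hlt : ∀ k, ‖t ^ 2 ^ k‖ < r1 := fun k => (tau_norm_le ht k).trans_lt htr1
  have hbinj : ∀ x ∈ Metric.ball (0:ℂ) 1, ∀ y ∈ Metric.ball (0:ℂ) 1, bb a x = bb a y → x = y := by
    intro x hx y hy h
    rw [mem_ball_zero_iff] at hx hy
    exact bb_inj_TT haT hx hy h
  have hpinj : ∀ x ∈ Metric.ball (0:ℂ) 1, ∀ y ∈ Metric.ball (0:ℂ) 1, ph a x = ph a y → x = y := by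
    intro x hx y hy h
    rw [mem_ball_zero_iff] at hx hy
    exact ph_inj_TT haT hx hy h
  -- on the circle
  have hp_ne : ∀ j, ∀ σ ∈ Metric.sphere (0:ℂ) r1, ph a σ ≠ 1 / c j := by
    intro j σ hσ
    obtain ⟨e1, e2, e3⟩ := hsph σ hσ
    rcases N_cases n j with h | ⟨k, rfl⟩ | ⟨k, rfl⟩
    · rw [hc, cN_lt h]; exact hpsi_cc j h σ e2
    · rw [hc, cN_even, one_div_one_div]
      intro h
      have := ph_inj_TT haT e2 (hτ k) h
      have h1 := hlt k
      rw [← this] at h1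
      linarith
    · rw [hc, cN_odd]; exact hpsi_bb _ σ (hτ _) (hτ0 _) e2
  have hb_ne : ∀ j, ∀ σ ∈ Metric.sphere (0:ℂ) r1, bb a σ ≠ c j := by
    intro j σ hσ
    obtain ⟨e1, e2, e3⟩ := hsph σ hσ
    rcases N_cases n j with h | ⟨k, rfl⟩ | ⟨k, rfl⟩
    · rw [hc, cN_lt h]; exact cc_not_bb hn ha h e2
    · rw [hc, cN_even]; exact hbb_ph _ σ (hτ _) (hτ0 _) e2
    · rw [hc, cN_odd]
      intro h
      have := bb_inj_TT haT e2 (hτ _) h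
      have h1 := hlt (k + 1)
      rw [← this] at h1
      linarith
  -- integrals
  set Fp : ℕ → ℂ → ℂ := fun j σ => (1 / c j) * (deriv (ph a) σ * eta a σ / (ph a σ - 1 / c j)) with hFp
  set Fb : ℕ → ℂ → ℂ := fun j σ => deriv (bb a) σ * beta a σ / (bb a σ - c j) with hFb
  set vp : ℕ → ℂ := fun j => ∮ σ in C(0, r1), Fp j σ with hvp
  set vb : ℕ → ℂ := fun j => ∮ σ in C(0, r1), Fb j σ with hvb
  have hFpc : ∀ j, ContinuousOn (Fp j) (Metric.sphere 0 r1) := fun j =>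
    continuousOn_const.mul ((hpc'.mul hηc).div (hpc.sub continuousOn_const)
      (fun σ hσ => sub_ne_zero.2 (hp_ne j σ hσ)))
  have hFbc : ∀ j, ContinuousOn (Fb j) (Metric.sphere 0 r1) := fun j =>
    (hbc'.mul hβc).div (hbc.sub continuousOn_const)
      (fun σ hσ => sub_ne_zero.2 (hb_ne j σ hσ))
  have hball : ∀ {x : ℂ}, x ∈ Metric.ball (0:ℂ) 1 → ‖x‖ < 1 := fun h => by
    rwa [mem_ball_zero_iff] at h
  have hval : ∀ j, vp j + vb j = if j < n then 0 else
      2 * Real.pi * Complex.I * (v j / (c j * (c j + 2))) := by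
    intro j
    have evp : vp j = (1 / c j) *
        ∮ σ in C(0, r1), deriv (ph a) σ * eta a σ / (ph a σ - 1 / c j) := by
      simp only [hvp, hFp]
      rw [circleIntegral.integral_const_mul]
    rw [evp]
    rcases N_cases n j with h | ⟨k, rfl⟩ | ⟨k, rfl⟩
    · rw [if_pos h, contour_zero hpd hηd hr10 hr11 (fun σ hσ => by
        rw [hc, cN_lt h]; exact hpsi_cc j h σ (hball hσ)), mul_zero, zero_add]
      exact contour_zero hbd hβd hr10 hr11 (fun σ hσ => by
        rw [hc, cN_lt h]; exact cc_not_bb hn ha h (hball hσ))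
    · rw [if_neg (by omega)]
      have e1 : vb (n + 2 * k) = 0 := contour_zero hbd hβd hr10 hr11 (fun σ hσ => by
        rw [hc, cN_even]; exact hbb_ph _ σ (hτ _) (hτ0 _) (hball hσ))
      have e2 : 1 / c (n + 2 * k) = ph a (t ^ 2 ^ k) := by rw [hc, cN_even, one_div_one_div]
      have hne := ph_ne_zero haT (hτ k) (hτ0 k)
      rw [e1, e2, contour_val hpd hηd hpinj (fun σ hσ => ph_deriv_ne_TT haT (hball hσ)) hr11 (hlt k),
        eta_val haT (hτ k) (hτ0 k), hv, vN_even, hc, cN_even, add_zero]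
      rw [div_mul_eq_div_div_swap, one_div, div_inv_eq_mul]
      ring
    · rw [if_neg (by omega), contour_zero hpd hηd hr10 hr11 (fun σ hσ => by
        rw [hc, cN_odd]; exact hpsi_bb _ σ (hτ _) (hτ0 _) (hball hσ)), mul_zero, zero_add]
      have e2 : c (n + 2 * k + 1) = bb a (t ^ 2 ^ (k + 1)) := by rw [hc, cN_odd]
      simp only [hvb, hFb]
      rw [e2, contour_val hbd hβd hbinj (fun σ hσ => bb_deriv_ne_TT haT (hball hσ)) hr11
        (hlt (k + 1)), beta_val haT (hτ _) (hτ0 _), hv, vN_odd]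
  -- weights
  set Wp : ℂ → ℂ := fun σ => -(deriv (ph a) σ * eta a σ * (1 / ph a σ) ^ 2 * (1 / ph a σ + 2)) with hWp
  set Wb : ℂ → ℂ := fun σ => deriv (bb a) σ * beta a σ * (bb a σ * (bb a σ + 2)) with hWb
  have hipc : ContinuousOn (fun σ => 1 / ph a σ) (Metric.sphere 0 r1) :=
    continuousOn_const.div hpc hpne
  have hWpc : ContinuousOn Wp (Metric.sphere 0 r1) :=
    (((hpc'.mul hηc).mul (hipc.pow 2)).mul (hipc.add continuousOn_const)).neg
  have hWbc : ContinuousOn Wb (Metric.sphere 0 r1) :=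
    (hbc'.mul hβc).mul (hbc.mul (hbc.add continuousOn_const))
  have hcomp : IsCompact (Metric.sphere (0:ℂ) r1) := isCompact_sphere 0 r1
  obtain ⟨M1, hM1⟩ := hcomp.exists_bound_of_continuousOn hWpc
  obtain ⟨M2, hM2⟩ := hcomp.exists_bound_of_continuousOn hWbc
  set M := max (max M1 M2) 0 with hM
  have hM0 : 0 ≤ M := le_max_right _ _
  have hM1' : ∀ σ ∈ Metric.sphere (0:ℂ) r1, ‖Wp σ‖ ≤ M := fun σ hσ =>
    (hM1 σ hσ).trans ((le_max_left _ _).trans (le_max_left _ _))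
  have hM2' : ∀ σ ∈ Metric.sphere (0:ℂ) r1, ‖Wb σ‖ ≤ M := fun σ hσ =>
    (hM2 σ hσ).trans ((le_max_right _ _).trans (le_max_left _ _))
  have hcJ : ∀ j, 1 ≤ j → c j ≠ 0 := fun j hj => H.hJ0 j (by simpa using hj)
  have hidp : ∀ j, 1 ≤ j → ∀ σ ∈ Metric.sphere (0:ℂ) r1, Fp j σ = Wp σ * dd (c j) (1 / ph a σ) := by
    intro j hj σ hσ
    have h1 := hpne σ hσ
    have h2 := ph_add_ne_TT haT (hsph σ hσ).2.1
    have h3 := hcJ j hj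
    have h4 := sub_ne_zero.2 (hp_ne j σ hσ)
    simp only [hFp, hWp, dd]
    have e1 : 1 / ph a σ + 2 = (1 + 2 * ph a σ) / ph a σ := by field_simp
    have e2 : 1 / ph a σ - c j = -(c j * (ph a σ - 1 / c j)) / ph a σ := by field_simp; ring
    rw [e1, e2]
    set X := ph a σ - 1 / c j
    generalize 1 + 2 * ph a σ = Y at h2 ⊢
    field_simp
  have hidb : ∀ j, ∀ σ ∈ Metric.sphere (0:ℂ) r1, Fb j σ = Wb σ * dd (c j) (bb a σ) := by
    intro j σ hσ
    obtain ⟨-, e2, e3⟩ := hsph σ hσ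
    have h1 := bb_ne_zero haT e2 e3
    have h2 : bb a σ + 2 ≠ 0 := fun h => bb_ne_neg_two haT e2 (by linear_combination h)
    have h4 := sub_ne_zero.2 (hb_ne j σ hσ)
    simp only [hFb, hWb, dd]
    field_simp
  -- the compact set
  set K : Set ℂ := (fun σ => 1 / ph a σ) '' Metric.sphere 0 r1 ∪ bb a '' Metric.sphere 0 r1 with hK
  have hKc : IsCompact K := (hcomp.image_of_continuousOn hipc).union (hcomp.image_of_continuousOn hbc)
  have hKΩ : K ⊆ OO a r s := by
    rintro z (⟨σ, hσ, rfl⟩ | ⟨σ, hσ, rfl⟩)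
    · obtain ⟨e1, e2, e3⟩ := hsph σ hσ
      have e := psi_coe haT e2 e3
      rintro (⟨u, hu, h⟩ | ⟨u, hu, h⟩)
      · rw [mem_closedBall_zero_iff] at hu
        simp only at h
        rw [← e] at h
        have := psi_inj_TT haT (hu.trans_lt hr1) e2 h
        rw [this] at hu
        linarith
      · rw [mem_closedBall_zero_iff] at hu
        simp only at h
        rw [← e] at h
        exact bb_ne_psi_TT haT (by linarith) e2 h
    · obtain ⟨e1, e2, e3⟩ := hsph σ hσ
      rintro (⟨u, hu, h⟩ | ⟨u, hu, h⟩)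
      · rw [mem_closedBall_zero_iff] at hu
        exact bb_ne_psi_TT haT e2 (by linarith) h.symm
      · rw [mem_closedBall_zero_iff] at hu
        have := bb_inj_TT haT (by linarith) e2 (OnePoint.coe_injective h)
        rw [this] at hu
        linarith
  have hK2 : (-2:ℂ) ∉ K := by
    rintro (⟨σ, hσ, h⟩ | ⟨σ, hσ, h⟩)
    · obtain ⟨e1, e2, e3⟩ := hsph σ hσ
      apply psi_ne_neg_two haT e2
      rw [psi_coe haT e2 e3]
      exact congrArg _ h
    · exact bb_ne_neg_two haT (hsph σ hσ).2.1 h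
  have hKc' : ∀ i ∈ Finset.Icc 1 (n - 1), c i ∉ K := by
    intro i hi
    rintro (⟨σ, hσ, h⟩ | ⟨σ, hσ, h⟩)
    · apply hp_ne i σ hσ
      rw [← h, one_div_one_div]
    · exact hb_ne i σ hσ h
  obtain ⟨hB1, hB2⟩ := core_B H (Dom_OO haT hrs hsr hr1) (o := Finset.Icc 1 (n - 1)) (fun i hi => by
      rw [Finset.mem_Icc] at hi
      rw [hc, cN_lt (by omega)]
      exact cc_mem_OO hn ha (by omega) hr1 (hsr.trans hr1))
    (fun i hi j hj h => by
      rw [Finset.mem_Icc] at hi hj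
      rw [hc, cN_lt (by omega), cN_lt (by omega)] at h
      exact cc_inj ha (by omega) (by omega) h)
    (fun j hj hjo hΩ => by
      rw [Finset.mem_Icc] at hjo
      replace hj : 1 ≤ j := hj
      rcases N_cases n j with h | ⟨k, rfl⟩ | ⟨k, rfl⟩
      · omega
      · apply hΩ
        left
        refine ⟨t ^ 2 ^ k, ?_, ?_⟩
        · rw [mem_closedBall_zero_iff]
          exact (tau_norm_le ht k).trans htr.le
        · rw [hc, cN_even]; exact psi_coe haT (hτ k) (hτ0 k)
      · apply hΩ
        right
        refine ⟨t ^ 2 ^ (k + 1), ?_, ?_⟩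
        · rw [mem_closedBall_zero_iff]
          have := tau_norm_le2 ht k
          nlinarith [norm_nonneg t]
        · rw [hc, cN_odd])
  apply H.contra
  -- decomposition
  set lam : ℕ → ℂ := fun j => v j / (c j * (c j + 2)) with hlam
  set g : ℕ → ℕ →₀ ℂ := fun k => gam a c k with hgdef
  have hsupp : ∀ k, ∀ j ∈ (g k).support, 1 ≤ j := by
    intro k j hj
    exact (Finsupp.mem_supported ℂ _).1 (H.gam_supp k) hj
  have hL : ∀ k, Lam c v (g k) = ∑ j ∈ (g k).support, g k j * lam j := by
    intro k
    unfold Lam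
    rw [Finsupp.linearCombination_apply]
    rfl
  have hEv : ∀ k z, Ev c z (g k) = ∑ j ∈ (g k).support, g k j * dd (c j) z := by
    intro k z
    unfold Ev
    rw [Finsupp.linearCombination_apply]
    rfl
  have hpi : (2 * Real.pi * Complex.I : ℂ) ≠ 0 := Complex.two_pi_I_ne_zero
  have hdec : ∀ k, Lam c v (g k) = ∑ j ∈ Finset.Icc 1 (n - 1), g k j * lam j +
      (2 * Real.pi * Complex.I : ℂ)⁻¹ * (∑ j ∈ (g k).support, g k j * vp j +
        ∑ j ∈ (g k).support, g k j * vb j) := by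
    intro k
    rw [hL, ← Finset.sum_add_distrib]
    have e1 : ∑ j ∈ Finset.Icc 1 (n - 1), g k j * lam j =
        ∑ j ∈ (g k).support, if j < n then g k j * lam j else 0 := by
      rw [← Finset.sum_filter]
      symm
      apply Finset.sum_subset
      · intro j hj
        rw [Finset.mem_filter] at hj
        rw [Finset.mem_Icc]
        exact ⟨hsupp k j hj.1, by omega⟩
      · intro j hj hj'
        rw [Finset.mem_Icc] at hj
        rw [Finset.mem_filter] at hj'
        have : g k j = 0 := by
          by_contra h
          exact hj' ⟨Finsupp.mem_support_iff.2 h, by omega⟩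
        rw [this, zero_mul]
    rw [e1, Finset.mul_sum, ← Finset.sum_add_distrib]
    apply Finset.sum_congr rfl
    intro j hj
    rw [← mul_add, hval j]
    by_cases h : j < n
    · simp [h]
    · simp only [if_neg h, hlam]
      field_simp
      ring
  have hlim1 : Tendsto (fun k => ∑ j ∈ Finset.Icc 1 (n - 1), g k j * lam j) atTop (𝓝 0) := by
    have : (0:ℂ) = ∑ j ∈ Finset.Icc 1 (n - 1), 0 * lam j := by simp
    rw [this]
    exact tendsto_finsetSum _ fun j hj => (hB1 j hj).mul_const _
  have hbnd : ∀ ε > 0, ∀ᶠ k in atTop,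
      ‖∑ j ∈ (g k).support, g k j * vp j + ∑ j ∈ (g k).support, g k j * vb j‖ ≤
        2 * (2 * Real.pi * r1 * (M * ε)) := by
    intro ε hε
    filter_upwards [hB2 K hKc hKΩ hK2 hKc' ε hε] with k hk
    have b1 := contour_bound (ρ := r1) (M := M) (ε := ε) (S := (g k).support) (γ := fun j => g k j)
      (F := Fp) (val := vp) (W := Wp) (q := fun σ => Ev c (1 / ph a σ) (g k)) hr10.le
      (fun j _ => hFpc j) (fun j _ => rfl) (fun σ hσ => by
        simp only [hEv, Finset.mul_sum]
        apply Finset.sum_congr rfl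
        intro j hj
        rw [hidp j (hsupp k j hj) σ hσ]; ring) hM1' hM0
      (fun σ hσ => hk _ (Or.inl ⟨σ, hσ, rfl⟩))
    have b2 := contour_bound (ρ := r1) (M := M) (ε := ε) (S := (g k).support) (γ := fun j => g k j)
      (F := Fb) (val := vb) (W := Wb) (q := fun σ => Ev c (bb a σ) (g k)) hr10.le
      (fun j _ => hFbc j) (fun j _ => rfl) (fun σ hσ => by
        simp only [hEv, Finset.mul_sum]
        apply Finset.sum_congr rfl
        intro j hj
        rw [hidb j σ hσ]; ring) hM2' hM0
      (fun σ hσ => hk _ (Or.inr ⟨σ, hσ, rfl⟩))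
    refine (norm_add_le _ _).trans ?_
    linarith
  have hlim2 : Tendsto (fun k => ∑ j ∈ (g k).support, g k j * vp j +
      ∑ j ∈ (g k).support, g k j * vb j) atTop (𝓝 0) := by
    rw [Metric.tendsto_nhds]
    intro δ hδ
    set C := 2 * (2 * Real.pi * r1 * (M + 1)) with hC
    have hpos : 0 < C := by have := Real.pi_pos; positivity
    filter_upwards [hbnd (δ / (2 * C)) (by positivity)] with k hk
    rw [dist_zero_right]
    refine hk.trans_lt ?_
    have h1 : 2 * (2 * Real.pi * r1 * (M * (δ / (2 * C)))) ≤ C * (δ / (2 * C)) := by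
      have h2 : 0 < δ / (2 * C) := by positivity
      have h3 : 2 * (2 * Real.pi * r1 * (M * (δ / (2 * C)))) =
        (2 * (2 * Real.pi * r1 * M)) * (δ / (2 * C)) := by ring
      rw [h3]
      apply mul_le_mul_of_nonneg_right _ h2.le
      have h4 : 0 < Real.pi * r1 := mul_pos Real.pi_pos hr10
      rw [hC]
      nlinarith
    have h5 : C * (δ / (2 * C)) = δ / 2 := by field_simp
    linarith
  have hfin := hlim1.add (hlim2.const_mul (2 * Real.pi * Complex.I : ℂ)⁻¹)
  rw [mul_zero, add_zero] at hfin
  exact hfin.congr fun k => (hdec k).symm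

theorem transversality (hn : 2 ≤ n) (ha : a ∈ captureSet n) : deriv (gg n) a ≠ 0 := by
  intro hd
  by_cases h0 : gg n a = 0
  · exact trans_center hn ha h0 hd
  · exact trans_noncenter hn ha h0 hd

end

end

/-- Every parabubble of generation `n ≥ 2` is open, simply connected, and contains a unique
center, i.e. a unique parameter `a₀` with `R_{a₀}^n(−1) = ∞`. -/
theorem parabubble_open_simplyConnected_unique_center (n : ℕ) (hn : 2 ≤ n)
    (P : Set ℂ) (hP : IsParabubble n P) :
    IsOpen P ∧ SimplyConnectedSpace ↥P ∧
    (∃! a₀ : ℂ, a₀ ∈ P ∧ (Rhat a₀)^[n] ((-1 : ℂ) : RSphere) = ∞) := by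
  exact final_assembly n hn (fun _ ha => transversality hn ha) P hP
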